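/- Let f be a transcendental self-map of ℂ* that has a doubly connected Baker domain U. Then the closure of U in ℂ̂ contains both 0 and ∞ (equivalently, inf{|z| : z ∈ U} = 0 and sup{|z| : z ∈ U} = ∞), and consequently I(f) ∪ {0,∞} ⊆ ℂ̂ is connected. -/

import Mathlib

open Complex Topology Filter Set Function OnePoint

noncomputable section

/-- The chordal (spherical) distance on the Riemann sphere, restricted to finite points. -/
def chordalDist (z w : ℂ) : ℝ :=
  ‖z - w‖ / Real.sqrt ((1 + ‖z‖ ^ 2) * (1 + ‖w‖ ^ 2))

/-- A transcendental self-map of `ℂ* = ℂ \ {0}`: a holomorphic self-map of the punctured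
plane with essential singularities at `0` and `∞`; equivalently, on `ℂ*` it has the form
`z ^ m * exp (g z + h z⁻¹)` for some `m : ℤ` and nonconstant entire functions `g, h`. -/
def IsTranscendentalSelfMapCStar (f : ℂ → ℂ) : Prop :=
  ∃ (m : ℤ) (g h : ℂ → ℂ),
    Differentiable ℂ g ∧ Differentiable ℂ h ∧
    (¬ ∃ c : ℂ, ∀ z, g z = c) ∧ (¬ ∃ c : ℂ, ∀ z, h z = c) ∧
    ∀ z : ℂ, z ≠ 0 → f z = z ^ m * Complex.exp (g z + h z⁻¹)

/-- The escaping set `I(f)` of a self-map of the punctured plane: points whose orbit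
accumulates only at `0` and `∞`. -/
def escapingSet (f : ℂ → ℂ) : Set ℂ :=
  {z | z ≠ 0 ∧ ∀ ε : ℝ, 0 < ε → ∃ N : ℕ, ∀ n ≥ N,
    ‖f^[n] z‖ < ε ∨ 1 / ε < ‖f^[n] z‖}

/-- The little escaping set `I_e(f)` with essential itinerary `e` (where `true` stands for the
symbol `∞` and `false` for the symbol `0`). -/
def littleEscapingSet (f : ℂ → ℂ) (e : ℕ → Bool) : Set ℂ :=
  {z | z ∈ escapingSet f ∧ ∃ ℓ k : ℕ, ∀ n : ℕ,
    (1 < ‖f^[n + ℓ] z‖ ↔ e (n + k) = true)}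

/-- The immediate little escaping set `Ĩ_e(f)`. -/
def immediateLittleEscapingSet (f : ℂ → ℂ) (e : ℕ → Bool) : Set ℂ :=
  {z | z ∈ escapingSet f ∧ ∃ ℓ : ℕ, ∀ n : ℕ,
    (1 < ‖f^[n + ℓ] z‖ ↔ e (n + ℓ) = true)}

/-- The Fatou set of a self-map of the punctured plane: points of `ℂ*` with a neighbourhood
(inside `ℂ*`) on which the family of iterates is equicontinuous w.r.t. the chordal metric. -/
def FatouSet (f : ℂ → ℂ) : Set ℂ :=
  {z | z ≠ 0 ∧ ∃ U : Set ℂ, IsOpen U ∧ z ∈ U ∧ (∀ w ∈ U, w ≠ 0) ∧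
    ∀ w ∈ U, ∀ ε : ℝ, 0 < ε → ∃ δ : ℝ, 0 < δ ∧ ∀ w' ∈ U,
      chordalDist w w' < δ → ∀ n : ℕ, chordalDist (f^[n] w) (f^[n] w') < ε}

/-- The Julia set `J(f) = ℂ* \ F(f)`. -/
def JuliaSet (f : ℂ → ℂ) : Set ℂ := {z : ℂ | z ≠ 0} \ FatouSet f

/-- A Fatou component: a connected component of the Fatou set. -/
def IsFatouComponent (f : ℂ → ℂ) (U : Set ℂ) : Prop :=
  ∃ z ∈ FatouSet f, U = connectedComponentIn (FatouSet f) z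

/-- A wandering domain: a Fatou component `U` such that the Fatou components containing the
iterated images `fⁿ(U)` are pairwise distinct. -/
def IsWanderingDomain (f : ℂ → ℂ) (U : Set ℂ) : Prop :=
  IsFatouComponent f U ∧ ∃ V : ℕ → Set ℂ, V 0 = U ∧
    (∀ n, IsFatouComponent f (V n)) ∧
    (∀ n, f '' V n ⊆ V (n + 1)) ∧ Function.Injective V

/-- A set is bounded in `ℂ*` if it lies in some closed annulus `{r ≤ |z| ≤ R}`. -/
def BoundedInCStar (X : Set ℂ) : Prop :=
  ∃ r R : ℝ, 0 < r ∧ r ≤ R ∧ X ⊆ {z : ℂ | r ≤ ‖z‖ ∧ ‖z‖ ≤ R}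

/-- The boundary of a subset of `ℂ*` taken in `ℂ*`. -/
def boundaryInCStar (G : Set ℂ) : Set ℂ := frontier G \ {0}

/-- The set `I(f) ∪ {0, ∞}` regarded as a subset of the Riemann sphere `ℂ̂ = ℂ ∪ {∞}`. -/
def escapingSphere (f : ℂ → ℂ) : Set (OnePoint ℂ) :=
  ((fun z : ℂ => (z : OnePoint ℂ)) '' escapingSet f) ∪ {((0 : ℂ) : OnePoint ℂ), ∞}

/-- The set `I_e(f) ∪ {0, ∞}` regarded as a subset of the Riemann sphere. -/
def littleEscapingSphere (f : ℂ → ℂ) (e : ℕ → Bool) : Set (OnePoint ℂ) :=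
  ((fun z : ℂ => (z : OnePoint ℂ)) '' littleEscapingSet f e) ∪ {((0 : ℂ) : OnePoint ℂ), ∞}

/-- A subset of the sphere has exactly two connected components. -/
def HasExactlyTwoComponents (K : Set (OnePoint ℂ)) : Prop :=
  ∃ x ∈ K, ∃ y ∈ K, connectedComponentIn K x ≠ connectedComponentIn K y ∧
    ∀ z ∈ K, connectedComponentIn K z = connectedComponentIn K x ∨
      connectedComponentIn K z = connectedComponentIn K y

/-- A domain `U ⊆ ℂ*` is doubly connected if its complement in the Riemann sphere has
exactly two connected components. -/
def DoublyConnected (U : Set ℂ) : Prop :=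
  HasExactlyTwoComponents (((fun z : ℂ => (z : OnePoint ℂ)) '' U)ᶜ)

/-- A transcendental entire function. -/
def IsTranscendentalEntire (f : ℂ → ℂ) : Prop :=
  Differentiable ℂ f ∧ ¬ ∃ p : Polynomial ℂ, ∀ z, f z = p.eval z

/-- The Fatou set of an entire function. -/
def FatouSetEntire (f : ℂ → ℂ) : Set ℂ :=
  {z | ∃ U : Set ℂ, IsOpen U ∧ z ∈ U ∧
    ∀ w ∈ U, ∀ ε : ℝ, 0 < ε → ∃ δ : ℝ, 0 < δ ∧ ∀ w' ∈ U,
      chordalDist w w' < δ → ∀ n : ℕ, chordalDist (f^[n] w) (f^[n] w') < ε}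

/-- The Julia set of an entire function. -/
def JuliaSetEntire (f : ℂ → ℂ) : Set ℂ := (FatouSetEntire f)ᶜ

/-- `f` has a finite asymptotic value. -/
def HasFiniteAsymptoticValue (f : ℂ → ℂ) : Prop :=
  ∃ (a : ℂ) (γ : ℝ → ℂ), ContinuousOn γ (Set.Ici (0 : ℝ)) ∧
    Tendsto (fun t => ‖γ t‖) atTop atTop ∧
    Tendsto (fun t => f (γ t)) atTop (nhds a)

open MeasureTheory
open scoped ComplexConjugate

/-- Twice the Wirtinger derivative `∂/∂z̄`. -/
def dbar (ψ : ℂ → ℂ) (z : ℂ) : ℂ := fderiv ℝ ψ z 1 + I * fderiv ℝ ψ z I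

theorem integral_fderiv_apply_eq_zero {ψ : ℂ → ℂ} (hψ : ContDiff ℝ 1 ψ)
    (hc : HasCompactSupport ψ) (v : ℂ) : ∫ z, fderiv ℝ ψ z v = 0 := by
  have hinteg : Integrable (fun z => fderiv ℝ ψ z v) :=
    ((hψ.continuous_fderiv one_ne_zero).clm_apply continuous_const).integrable_of_hasCompactSupport
      (hc.fderiv_apply (𝕜 := ℝ) v)
  have := integral_mul_fderiv_eq_neg_fderiv_mul_of_integrable (𝕜 := ℂ) (μ := volume)
    (f := fun _ : ℂ => (1 : ℂ)) (g := ψ) (v := v) (by simp) (by simpa using hinteg)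
    (by simpa using hψ.continuous.integrable_of_hasCompactSupport hc)
    (fun x _ => by fun_prop) (fun x _ => (hψ.differentiable one_ne_zero) x)
  simpa using this

theorem integral_dbar_eq_zero {ψ : ℂ → ℂ} (hψ : ContDiff ℝ 1 ψ)
    (hc : HasCompactSupport ψ) : ∫ z, dbar ψ z = 0 := by
  have hinteg : ∀ v, Integrable (fun z => fderiv ℝ ψ z v) := fun v =>
    ((hψ.continuous_fderiv one_ne_zero).clm_apply continuous_const).integrable_of_hasCompactSupport
      (hc.fderiv_apply (𝕜 := ℝ) v)
  unfold dbar
  rw [integral_add (hinteg 1) ((hinteg I).const_mul I), integral_const_mul,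
    integral_fderiv_apply_eq_zero hψ hc, integral_fderiv_apply_eq_zero hψ hc]
  simp

theorem HasFDerivAt.dbar_eq {ψ : ℂ → ℂ} {L : ℂ →L[ℝ] ℂ} {z : ℂ} (h : HasFDerivAt ψ L z) :
    dbar ψ z = L 1 + I * L I := by
  rw [dbar, h.fderiv]

theorem dbar_mul {a b : ℂ → ℂ} {z : ℂ} (ha : DifferentiableAt ℝ a z)
    (hb : DifferentiableAt ℝ b z) :
    dbar (fun w => a w * b w) z = dbar a z * b z + a z * dbar b z := by
  have h : HasFDerivAt (fun w => a w * b w) _ z := ha.hasFDerivAt.mul hb.hasFDerivAt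
  rw [h.dbar_eq]
  simp [dbar]; ring

theorem dbar_holo {b : ℂ → ℂ} {z : ℂ} (hb : DifferentiableAt ℂ b z) : dbar b z = 0 := by
  rw [(hb.hasDerivAt.hasFDerivAt.restrictScalars ℝ).dbar_eq]
  simp
  rw [← mul_assoc, I_mul_I]; ring

theorem dbar_comp {η F : ℂ → ℂ} {z : ℂ} (hη : DifferentiableAt ℝ η (F z))
    (hF : DifferentiableAt ℂ F z) :
    dbar (fun w => η (F w)) z = dbar η (F z) * (starRingEnd ℂ) (deriv F z) := by
  have h1 := hF.hasDerivAt.hasFDerivAt.restrictScalars ℝ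
  have h2 : HasFDerivAt (fun w => η (F w)) _ z := hη.hasFDerivAt.comp z h1
  rw [h2.dbar_eq]
  have key : ∀ v : ℂ, fderiv ℝ η (F z) v = v.re * fderiv ℝ η (F z) 1
      + v.im * fderiv ℝ η (F z) I := by
    intro v
    conv_lhs => rw [← Complex.re_add_im v]
    have : (v.re : ℂ) + v.im * I = v.re • (1:ℂ) + v.im • I := by simp
    rw [this, map_add, _root_.map_smul, _root_.map_smul]; simp
  simp only [ContinuousLinearMap.comp_apply, ContinuousLinearMap.coe_restrictScalars',
    ContinuousLinearMap.toSpanSingleton_apply, dbar]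
  rw [key ((1:ℂ) • deriv F z), key (I • deriv F z)]
  have hc : (starRingEnd ℂ) (deriv F z) = (deriv F z).re - (deriv F z).im * I := by
    apply Complex.ext <;> simp
  rw [hc]
  simp only [smul_eq_mul, one_mul, mul_re, mul_im, I_re, I_im, zero_mul, one_mul, zero_sub,
    zero_add, ofReal_neg]
  linear_combination (deriv F z).im * fderiv ℝ η (F z) I * I_mul_I

theorem dbar_congr {a b : ℂ → ℂ} {z : ℂ} (h : a =ᶠ[𝓝 z] b) : dbar a z = dbar b z := by
  rw [dbar, dbar, h.fderiv_eq]

theorem contDiff_of_contDiffAt_tsupport {n : WithTop ℕ∞} {ψ : ℂ → ℂ}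
    (h : ∀ z ∈ tsupport ψ, ContDiffAt ℝ n ψ z) : ContDiff ℝ n ψ := by
  rw [contDiff_iff_contDiffAt]
  intro z
  by_cases hz : z ∈ tsupport ψ
  · exact h z hz
  · exact contDiffAt_const.congr_of_eventuallyEq (notMem_tsupport_iff_eventuallyEq.mp hz)

/-- The pairing of `∂χ/∂z̄` with `G`; depends only on `G` near the support of `dχ`. -/
def dbarPairing (χ G : ℂ → ℂ) : ℂ := ∫ z, dbar χ z * G z

theorem dbar_eq_zero_of_notMem {χ : ℂ → ℂ} {z : ℂ} (hz : z ∉ tsupport (fderiv ℝ χ)) :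
    dbar χ z = 0 := by
  simp [dbar, image_eq_zero_of_notMem_tsupport hz]

theorem tsupport_dbar_subset (χ : ℂ → ℂ) : tsupport (dbar χ) ⊆ tsupport (fderiv ℝ χ) := by
  apply closure_minimal _ (isClosed_tsupport _)
  intro z hz
  by_contra h
  exact hz (dbar_eq_zero_of_notMem h)

theorem ContDiff.continuous_dbar {χ : ℂ → ℂ} (hχ : ContDiff ℝ 1 χ) : Continuous (dbar χ) := by
  have : ∀ v, Continuous fun z => fderiv ℝ χ z v := fun v =>
    (hχ.continuous_fderiv one_ne_zero).clm_apply continuous_const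
  unfold dbar
  exact (this 1).add (continuous_const.mul (this I))

theorem dbarPairing_integrable {χ G : ℂ → ℂ} {O : Set ℂ} (hχ : ContDiff ℝ 1 χ)
    (hc : HasCompactSupport χ) (hO : IsOpen O) (hSO : tsupport (fderiv ℝ χ) ⊆ O)
    (hG : ContinuousOn G O) : Integrable fun z => dbar χ z * G z := by
  have hsub : tsupport (fun z => dbar χ z * G z) ⊆ tsupport (fderiv ℝ χ) :=
    (closure_mono fun z hz => left_ne_zero_of_mul hz).trans (tsupport_dbar_subset χ)
  have hcs : HasCompactSupport fun z => dbar χ z * G z :=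
    (hc.fderiv (𝕜 := ℝ)).of_isClosed_subset (isClosed_tsupport _) hsub
  exact (((hχ.continuous_dbar.continuousOn).mul hG).continuous_of_tsupport_subset hO
    (hsub.trans hSO)).integrable_of_hasCompactSupport hcs

theorem dbarPairing_congr {χ G G' : ℂ → ℂ} (h : ∀ z ∈ tsupport (fderiv ℝ χ), G z = G' z) :
    dbarPairing χ G = dbarPairing χ G' := by
  unfold dbarPairing
  congr 1
  ext z
  by_cases hz : z ∈ tsupport (fderiv ℝ χ)
  · rw [h z hz]
  · simp [dbar_eq_zero_of_notMem hz]

theorem dbarPairing_sub {χ G G' : ℂ → ℂ} {O : Set ℂ} (hχ : ContDiff ℝ 1 χ)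
    (hc : HasCompactSupport χ) (hO : IsOpen O) (hSO : tsupport (fderiv ℝ χ) ⊆ O)
    (hG : ContinuousOn G O) (hG' : ContinuousOn G' O) :
    dbarPairing χ (fun z => G z - G' z) = dbarPairing χ G - dbarPairing χ G' := by
  unfold dbarPairing
  rw [← integral_sub (dbarPairing_integrable hχ hc hO hSO hG)
    (dbarPairing_integrable hχ hc hO hSO hG')]
  simp only [mul_sub]

theorem dbarPairing_add {χ G G' : ℂ → ℂ} {O : Set ℂ} (hχ : ContDiff ℝ 1 χ)
    (hc : HasCompactSupport χ) (hO : IsOpen O) (hSO : tsupport (fderiv ℝ χ) ⊆ O)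
    (hG : ContinuousOn G O) (hG' : ContinuousOn G' O) :
    dbarPairing χ (fun z => G z + G' z) = dbarPairing χ G + dbarPairing χ G' := by
  unfold dbarPairing
  rw [← integral_add (dbarPairing_integrable hχ hc hO hSO hG)
    (dbarPairing_integrable hχ hc hO hSO hG')]
  simp only [mul_add]

theorem dbarPairing_const_mul (χ G : ℂ → ℂ) (c : ℂ) :
    dbarPairing χ (fun z => c * G z) = c * dbarPairing χ G := by
  unfold dbarPairing
  rw [← integral_const_mul]
  simp only [mul_left_comm]

/-- Exact forms are annihilated by the pairing. -/
theorem dbarPairing_deriv_eq_zero {χ P G : ℂ → ℂ} {O : Set ℂ} (hχ : ContDiff ℝ 2 χ)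
    (hc : HasCompactSupport χ) (hO : IsOpen O) (hSO : tsupport (fderiv ℝ χ) ⊆ O)
    (hP : ∀ z ∈ O, HasDerivAt P (G z) z) : dbarPairing χ G = 0 := by
  have hPan : ∀ z ∈ O, ContDiffAt ℝ 1 P z := fun z hz =>
    ((DifferentiableOn.analyticAt (fun w hw => (hP w hw).differentiableAt.differentiableWithinAt)
      (hO.mem_nhds hz)).contDiffAt (n := 1)).restrict_scalars ℝ
  have hd : ∀ v, ContDiff ℝ 1 fun z => fderiv ℝ χ z v := fun v =>
    (hχ.fderiv_right (m := 1) (by norm_num)).clm_apply contDiff_const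
  have hsub : ∀ v, tsupport (fun z => fderiv ℝ χ z v * P z) ⊆ tsupport (fderiv ℝ χ) := by
    intro v
    apply closure_mono
    intro z hz h0
    apply hz
    simp [h0]
  have hψ : ∀ v, ContDiff ℝ 1 fun z => fderiv ℝ χ z v * P z := fun v =>
    contDiff_of_contDiffAt_tsupport fun z hz =>
      (hd v).contDiffAt.mul (hPan z (hSO (hsub v hz)))
  have hψc : ∀ v, HasCompactSupport fun z => fderiv ℝ χ z v * P z := fun v =>
    (hc.fderiv (𝕜 := ℝ)).of_isClosed_subset (isClosed_tsupport _) (hsub v)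
  have hinteg : ∀ v u, Integrable (fun z => fderiv ℝ (fun z => fderiv ℝ χ z v * P z) z u) :=
    fun v u => (((hψ v).continuous_fderiv one_ne_zero).clm_apply
      continuous_const).integrable_of_hasCompactSupport ((hψc v).fderiv_apply (𝕜 := ℝ) u)
  have key : ∀ z, dbar χ z * G z = I * (fderiv ℝ (fun z => fderiv ℝ χ z I * P z) z 1
      - fderiv ℝ (fun z => fderiv ℝ χ z 1 * P z) z I) := by
    intro z
    by_cases hz : z ∈ tsupport (fderiv ℝ χ)
    · have h1 : HasFDerivAt P _ z := (hP z (hSO hz)).hasFDerivAt.restrictScalars ℝ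
      have h2 : ∀ v, HasFDerivAt (fun z => fderiv ℝ χ z v * P z) _ z := fun v =>
        ((hd v).differentiable one_ne_zero z).hasFDerivAt.mul h1
      have hsymm : fderiv ℝ (fun z => fderiv ℝ χ z I) z 1 =
          fderiv ℝ (fun z => fderiv ℝ χ z 1) z I := by
        have hdd : DifferentiableAt ℝ (fderiv ℝ χ) z :=
          (hχ.fderiv_right (m := 1) (by norm_num)).differentiable one_ne_zero z
        have hs : IsSymmSndFDerivAt ℝ χ z := hχ.contDiffAt.isSymmSndFDerivAt (by simp)
        have hev : ∀ v u, fderiv ℝ (fun z => fderiv ℝ χ z v) z u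
            = fderiv ℝ (fderiv ℝ χ) z u v := by
          intro v u
          have := hdd.hasFDerivAt.clm_apply (hasFDerivAt_const v z)
          rw [this.fderiv]; simp
        rw [hev, hev]
        exact hs.eq 1 I
      rw [(h2 I).fderiv, (h2 1).fderiv]
      simp only [dbar, _root_.add_apply, _root_.smul_apply,
        ContinuousLinearMap.coe_restrictScalars', ContinuousLinearMap.toSpanSingleton_apply,
        smul_eq_mul, hsymm]
      linear_combination fderiv ℝ χ z 1 * G z * I_mul_I
    · have : ∀ v, fderiv ℝ (fun z => fderiv ℝ χ z v * P z) z = 0 := fun v =>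
        image_eq_zero_of_notMem_tsupport fun h =>
          hz (hsub v (tsupport_fderiv_subset ℝ h))
      simp [this, dbar_eq_zero_of_notMem hz]
  unfold dbarPairing
  simp only [key]
  rw [integral_const_mul, integral_sub (hinteg I 1) (hinteg 1 I),
    integral_fderiv_apply_eq_zero (hψ I) (hψc I), integral_fderiv_apply_eq_zero (hψ 1) (hψc 1)]
  simp

/-- A smoothed winding number of `F` around `q` along `dχ`. -/
def smoothWinding (χ F : ℂ → ℂ) (q : ℂ) : ℂ := dbarPairing χ fun z => deriv F z / (F z - q)

theorem smoothWinding_eq_of_dist_lt {χ F : ℂ → ℂ} {O : Set ℂ} (hχ : ContDiff ℝ 2 χ)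
    (hc : HasCompactSupport χ) (hO : IsOpen O) (hSO : tsupport (fderiv ℝ χ) ⊆ O)
    (hF : DifferentiableOn ℂ F O) {q q' : ℂ}
    (h : ∀ z ∈ tsupport (fderiv ℝ χ), ‖q' - q‖ < ‖F z - q'‖) :
    smoothWinding χ F q = smoothWinding χ F q' := by
  set O' := O ∩ {z | ‖q' - q‖ < ‖F z - q'‖} with hO'
  have hOo : IsOpen O' := by
    have : ContinuousOn (fun z => ‖F z - q'‖) O := (hF.continuousOn.sub continuousOn_const).norm
    exact this.isOpen_inter_preimage hO isOpen_Ioi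
  have hSO' : tsupport (fderiv ℝ χ) ⊆ O' := fun z hz => ⟨hSO hz, h z hz⟩
  have hne' : ∀ z ∈ O', F z - q' ≠ 0 := fun z hz h0 => by
    have := hz.2; simp only [mem_ofPred_eq, h0, norm_zero] at this
    exact absurd this (not_lt.mpr (norm_nonneg _))
  have hne : ∀ z ∈ O', F z - q ≠ 0 := fun z hz h0 => by
    have := hz.2
    rw [mem_ofPred_eq, ← norm_neg (F z - q'), show -(F z - q') = q' - q by
      linear_combination -h0] at this
    exact lt_irrefl _ this
  have hdF : ContinuousOn (deriv F) O' := ((hF.mono inter_subset_left).deriv hOo).continuousOn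
  have hFc := hF.continuousOn.mono (inter_subset_left : O' ⊆ O)
  have hcont : ContinuousOn (fun z => deriv F z / (F z - q)) O' :=
    hdF.div (hFc.sub continuousOn_const) hne
  have hcont' : ContinuousOn (fun z => deriv F z / (F z - q')) O' :=
    hdF.div (hFc.sub continuousOn_const) hne'
  have := dbarPairing_sub (hχ.of_le (by norm_num)) hc hOo hSO' hcont hcont'
  rw [← sub_eq_zero]
  unfold smoothWinding
  rw [← this]
  apply dbarPairing_deriv_eq_zero (P := fun z => Complex.log (1 + (q' - q) / (F z - q')))
    hχ hc hOo hSO'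
  intro z hz
  have hFd : HasDerivAt F (deriv F z) z := (hF.differentiableAt (hO.mem_nhds hz.1)).hasDerivAt
  have h1 : HasDerivAt (fun z => 1 + (q' - q) / (F z - q'))
      (-(q' - q) * deriv F z / (F z - q') ^ 2) z := by
    have := ((hasDerivAt_const z (q' - q)).div (hFd.sub_const q') (hne' z hz)).const_add 1
    exact this.congr_deriv (by ring)
  have hsl : 1 + (q' - q) / (F z - q') ∈ slitPlane := by
    apply Complex.mem_slitPlane_of_norm_lt_one
    rw [norm_div, div_lt_one (norm_pos_iff.mpr (hne' z hz))]
    exact hz.2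
  convert h1.clog hsl using 1
  have e1 := hne z hz
  have e2 := hne' z hz
  have e3 : 1 + (q' - q) / (F z - q') = (F z - q) / (F z - q') := by field_simp; ring
  rw [e3]
  field_simp
  ring

theorem smoothWinding_eq_zero_of_norm_lt {χ F : ℂ → ℂ} {O : Set ℂ} (hχ : ContDiff ℝ 2 χ)
    (hc : HasCompactSupport χ) (hO : IsOpen O) (hSO : tsupport (fderiv ℝ χ) ⊆ O)
    (hF : DifferentiableOn ℂ F O) {q : ℂ}
    (h : ∀ z ∈ tsupport (fderiv ℝ χ), ‖F z‖ < ‖q‖) : smoothWinding χ F q = 0 := by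
  set O' := O ∩ {z | ‖F z‖ < ‖q‖} with hO'
  have hOo : IsOpen O' := hF.continuousOn.norm.isOpen_inter_preimage hO isOpen_Iio
  have hSO' : tsupport (fderiv ℝ χ) ⊆ O' := fun z hz => ⟨hSO hz, h z hz⟩
  apply dbarPairing_deriv_eq_zero (P := fun z => Complex.log (1 + (-F z / q))) hχ hc hOo hSO'
  intro z hz
  have hq : q ≠ 0 := norm_pos_iff.mp ((norm_nonneg _).trans_lt hz.2)
  have hFd : HasDerivAt F (deriv F z) z := (hF.differentiableAt (hO.mem_nhds hz.1)).hasDerivAt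
  have hne : F z - q ≠ 0 := fun h0 => by
    have := hz.2; rw [mem_ofPred_eq, sub_eq_zero.mp h0] at this
    exact lt_irrefl _ this
  have hsl : 1 + (-F z / q) ∈ slitPlane := by
    apply Complex.mem_slitPlane_of_norm_lt_one
    rw [norm_div, div_lt_one (norm_pos_iff.mpr hq), norm_neg]
    exact hz.2
  have h1 : HasDerivAt (fun z => 1 + (-F z / q)) (-deriv F z / q) z :=
    (hFd.neg.div_const q).const_add 1
  convert h1.clog hsl using 1
  have e3 : 1 + -F z / q = -(F z - q) / q := by field_simp; ring
  rw [e3]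
  have : -(F z - q) ≠ 0 := neg_ne_zero.mpr hne
  field_simp

theorem IsPreconnected.eq_of_eventually_eq {α β : Type*} [TopologicalSpace α] {X : Set α}
    (hX : IsPreconnected X) {g : α → β} (h : ∀ x ∈ X, ∀ᶠ y in 𝓝 x, g y = g x) {x y : α}
    (hx : x ∈ X) (hy : y ∈ X) : g x = g y := by
  let _ : TopologicalSpace β := ⊥
  have : DiscreteTopology β := ⟨rfl⟩
  refine hX.constant_of_mapsTo (T := univ) (f := g) .univ
    (fun z hz => ?_) (mapsTo_univ _ _) hx hy
  apply ContinuousAt.continuousWithinAt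
  rw [ContinuousAt, nhds_discrete β, tendsto_pure]
  exact h z hz

theorem IsCompact.exists_pos_forall_lt {α : Type*} [TopologicalSpace α] {S : Set α}
    (hS : IsCompact S) {g : α → ℝ} (hg : ContinuousOn g S) (hpos : ∀ z ∈ S, 0 < g z) :
    ∃ d > 0, ∀ z ∈ S, d < g z := by
  rcases S.eq_empty_or_nonempty with rfl | hne
  · exact ⟨1, one_pos, by simp⟩
  obtain ⟨z0, hz0, hmin⟩ := hS.exists_isMinOn hne hg
  exact ⟨g z0 / 2, half_pos (hpos z0 hz0), fun z hz =>
    (half_lt_self (hpos z0 hz0)).trans_le (hmin hz)⟩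

theorem IsCompact.exists_pos_forall_norm_lt {α : Type*} [TopologicalSpace α] {S : Set α}
    (hS : IsCompact S) {F : α → ℂ} (hF : ContinuousOn F S) :
    ∃ M > 0, ∀ z ∈ S, ‖F z‖ < M := by
  obtain ⟨C, hC⟩ := hS.exists_bound_of_continuousOn hF
  exact ⟨max C 0 + 1, by positivity, fun z hz => (hC z hz).trans_lt
    (lt_of_le_of_lt (le_max_left _ _) (lt_add_one _))⟩

theorem eventually_smoothWinding_eq {χ F : ℂ → ℂ} {O : Set ℂ} (hχ : ContDiff ℝ 2 χ)
    (hc : HasCompactSupport χ) (hO : IsOpen O) (hSO : tsupport (fderiv ℝ χ) ⊆ O)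
    (hF : DifferentiableOn ℂ F O) {q : ℂ} (h : ∀ z ∈ tsupport (fderiv ℝ χ), F z ≠ q) :
    ∀ᶠ q' in 𝓝 q, smoothWinding χ F q' = smoothWinding χ F q := by
  have hS : IsCompact (tsupport (fderiv ℝ χ)) := hc.fderiv (𝕜 := ℝ)
  obtain ⟨d, hd, hlt⟩ := hS.exists_pos_forall_lt (g := fun z => ‖F z - q‖)
    ((hF.continuousOn.mono hSO).sub continuousOn_const).norm
    (fun z hz => norm_pos_iff.mpr (sub_ne_zero.mpr (h z hz)))
  filter_upwards [Metric.ball_mem_nhds q hd] with q' hq'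
  refine smoothWinding_eq_of_dist_lt hχ hc hO hSO hF fun z hz => ?_
  rw [Metric.mem_ball, dist_comm, dist_eq_norm] at hq'
  exact hq'.trans (hlt z hz)

theorem smoothWinding_extend_eq {χ F : ℂ → ℂ} {O : Set ℂ} (hχ : ContDiff ℝ 2 χ)
    (hc : HasCompactSupport χ) (hO : IsOpen O) (hSO : tsupport (fderiv ℝ χ) ⊆ O)
    (hF : DifferentiableOn ℂ F O) {X : Set (OnePoint ℂ)} (hX : IsPreconnected X)
    (h : ∀ z ∈ tsupport (fderiv ℝ χ), (F z : OnePoint ℂ) ∉ X) {x y : OnePoint ℂ}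
    (hx : x ∈ X) (hy : y ∈ X) :
    x.elim 0 (smoothWinding χ F) = y.elim 0 (smoothWinding χ F) := by
  refine hX.eq_of_eventually_eq (g := fun x => x.elim 0 (smoothWinding χ F))
    (fun x hx => ?_) hx hy
  induction x using OnePoint.rec with
  | infty =>
    have hS : IsCompact (tsupport (fderiv ℝ χ)) := hc.fderiv (𝕜 := ℝ)
    obtain ⟨M, -, hM⟩ := hS.exists_pos_forall_norm_lt (hF.continuousOn.mono hSO)
    rw [OnePoint.nhds_infty_eq, eventually_sup]
    refine ⟨?_, by simp⟩
    rw [eventually_map, coclosedCompact_eq_cocompact]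
    filter_upwards [(tendsto_norm_cocompact_atTop (E := ℂ)).eventually_ge_atTop M] with q hq
    simpa using smoothWinding_eq_zero_of_norm_lt hχ hc hO hSO hF
      fun z hz => (hM z hz).trans_le hq
  | coe q =>
    rw [OnePoint.nhds_coe_eq, eventually_map]
    simpa using eventually_smoothWinding_eq hχ hc hO hSO hF (q := q)
      fun z hz hzq => h z hz (hzq ▸ hx)

theorem smoothWinding_eq_of_mem {χ F : ℂ → ℂ} {O : Set ℂ} (hχ : ContDiff ℝ 2 χ)
    (hc : HasCompactSupport χ) (hO : IsOpen O) (hSO : tsupport (fderiv ℝ χ) ⊆ O)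
    (hF : DifferentiableOn ℂ F O) {X : Set (OnePoint ℂ)} (hX : IsPreconnected X)
    (h : ∀ z ∈ tsupport (fderiv ℝ χ), (F z : OnePoint ℂ) ∉ X) {q q' : ℂ}
    (hq : (q : OnePoint ℂ) ∈ X) (hq' : (q' : OnePoint ℂ) ∈ X) :
    smoothWinding χ F q = smoothWinding χ F q' := by
  simpa using smoothWinding_extend_eq hχ hc hO hSO hF hX h hq hq'

theorem smoothWinding_eq_zero_of_mem {χ F : ℂ → ℂ} {O : Set ℂ} (hχ : ContDiff ℝ 2 χ)
    (hc : HasCompactSupport χ) (hO : IsOpen O) (hSO : tsupport (fderiv ℝ χ) ⊆ O)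
    (hF : DifferentiableOn ℂ F O) {X : Set (OnePoint ℂ)} (hX : IsPreconnected X)
    (h : ∀ z ∈ tsupport (fderiv ℝ χ), (F z : OnePoint ℂ) ∉ X) (hX' : ∞ ∈ X) {q : ℂ}
    (hq : (q : OnePoint ℂ) ∈ X) :
    smoothWinding χ F q = 0 := by
  simpa using smoothWinding_extend_eq hχ hc hO hSO hF hX h hq hX'

theorem hasDerivAt_max_zero_pow_three (s : ℝ) :
    HasDerivAt (fun s : ℝ => (max 0 s) ^ 3) (3 * (max 0 s) ^ 2) s := by
  rcases lt_trichotomy s 0 with hs | rfl | hs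
  · rw [max_eq_left hs.le]
    have : (fun s : ℝ => (max 0 s) ^ 3) =ᶠ[𝓝 s] fun _ => 0 := by
      filter_upwards [Iio_mem_nhds hs] with t ht
      rw [max_eq_left (le_of_lt ht)]; norm_num
    simpa using (hasDerivAt_const s (0:ℝ)).congr_of_eventuallyEq this
  · rw [hasDerivAt_iff_isLittleO]
    have h1 : (fun x : ℝ => max 0 x ^ 3 - max 0 0 ^ 3 - (x - 0) • (3 * max 0 0 ^ 2)) =O[𝓝 0]
        fun x : ℝ => x ^ 3 := by
      apply Asymptotics.IsBigO.of_bound 1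
      filter_upwards with x
      simp only [max_self, ne_eq, OfNat.ofNat_ne_zero, not_false_eq_true, zero_pow, sub_zero, mul_zero,
        smul_zero, norm_pow, one_mul, Real.norm_eq_abs]
      refine pow_le_pow_left₀ (abs_nonneg _) ?_ 3
      rw [abs_of_nonneg (le_max_left 0 x)]
      exact max_le (abs_nonneg _) (le_abs_self _)
    refine h1.trans_isLittleO ?_
    have : (fun x : ℝ => x - 0) = fun x => x ^ 1 := by ext; simp
    rw [this]
    exact Asymptotics.isLittleO_pow_pow (by norm_num)
  · rw [max_eq_right hs.le]
    have : (fun s : ℝ => (max 0 s) ^ 3) =ᶠ[𝓝 s] fun s => s ^ 3 := by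
      filter_upwards [Ioi_mem_nhds hs] with t ht
      rw [max_eq_right (le_of_lt ht)]
    simpa using (hasDerivAt_pow 3 s).congr_of_eventuallyEq this

theorem contDiff_max_zero_pow_three : ContDiff ℝ 1 fun s : ℝ => (max 0 s) ^ 3 := by
  rw [contDiff_one_iff_deriv]
  refine ⟨fun s => (hasDerivAt_max_zero_pow_three s).differentiableAt, ?_⟩
  rw [funext fun s => (hasDerivAt_max_zero_pow_three s).deriv]
  fun_prop

theorem hasFDerivAt_normSq (v : ℂ) :
    HasFDerivAt (fun v : ℂ => Complex.normSq v) ((2 * v.re) • reCLM + (2 * v.im) • imCLM) v := by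
  have h1 : HasFDerivAt (fun v : ℂ => v.re) reCLM v := reCLM.hasFDerivAt
  have h2 : HasFDerivAt (fun v : ℂ => v.im) imCLM v := imCLM.hasFDerivAt
  have := (h1.mul h1).add (h2.mul h2)
  refine (this.congr_of_eventuallyEq ?_).congr_fderiv ?_
  · filter_upwards with w; simp [normSq_apply]
  · ext; simp; ring

/-- A `C¹` regularisation at scale `δ` of the Cauchy kernel `1 / v`. -/
def regKernel (δ : ℝ) (v : ℂ) : ℂ :=
  ((1 - (max 0 (1 - normSq v / δ ^ 2)) ^ 3 : ℝ) : ℂ) / v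

theorem regKernel_eq_inv {δ : ℝ} (hδ : 0 < δ) {v : ℂ} (hv : δ ≤ ‖v‖) : regKernel δ v = 1 / v := by
  have : max 0 (1 - normSq v / δ ^ 2) = 0 := by
    apply max_eq_left
    rw [sub_nonpos, le_div_iff₀ (by positivity), one_mul, normSq_eq_norm_sq]
    gcongr
  simp [regKernel, this]

theorem regKernel_eventuallyEq {δ : ℝ} (hδ : 0 < δ) :
    regKernel δ =ᶠ[𝓝 0] fun v => ((1 / δ ^ 2 : ℝ) : ℂ) * (conj v *
      ((3 - 3 * (normSq v / δ ^ 2) + (normSq v / δ ^ 2) ^ 2 : ℝ) : ℂ)) := by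
  filter_upwards [Metric.ball_mem_nhds 0 hδ] with v hv
  rw [mem_ball_zero_iff] at hv
  by_cases h0 : v = 0
  · simp [h0, regKernel]
  have : max 0 (1 - normSq v / δ ^ 2) = 1 - normSq v / δ ^ 2 := by
    apply max_eq_right
    rw [sub_nonneg, div_le_iff₀ (by positivity), one_mul, normSq_eq_norm_sq]
    gcongr
  rw [regKernel, this, div_eq_iff h0]
  have e : (normSq v : ℂ) = conj v * v := normSq_eq_conj_mul_self
  have hδ' : (δ : ℂ) ≠ 0 := by exact_mod_cast hδ.ne'
  push_cast
  rw [e]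
  field_simp
  ring

theorem contDiff_normSq : ContDiff ℝ 1 (fun v : ℂ => normSq v) := by
  have : (fun v : ℂ => normSq v) = fun v => reCLM v * reCLM v + imCLM v * imCLM v := by
    ext v; simp [normSq_apply]
  rw [this]; fun_prop

theorem contDiff_ofReal_comp {n : WithTop ℕ∞} {u : ℂ → ℝ} (hu : ContDiff ℝ n u) :
    ContDiff ℝ n fun z => (u z : ℂ) := ofRealCLM.contDiff.comp hu

theorem contDiff_regKernel {δ : ℝ} (hδ : 0 < δ) : ContDiff ℝ 1 (regKernel δ) := by
  rw [contDiff_iff_contDiffAt]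
  intro v
  by_cases h0 : v = 0
  · subst h0
    refine ContDiffAt.congr_of_eventuallyEq ?_ (regKernel_eventuallyEq hδ)
    have h1 : ContDiff ℝ 1 (fun v : ℂ => (conj v : ℂ)) := conjCLE.contDiff
    refine (contDiff_const.mul (h1.mul (contDiff_ofReal_comp ?_))).contDiffAt
    have := contDiff_normSq
    fun_prop
  · have h1 : ContDiff ℝ 1 fun v : ℂ => (1 - (max 0 (1 - normSq v / δ ^ 2)) ^ 3 : ℝ) :=
      contDiff_const.sub (contDiff_max_zero_pow_three.comp
        (contDiff_const.sub (contDiff_normSq.div_const _)))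
    exact ((contDiff_ofReal_comp h1).contDiffAt.mul
      ((contDiffAt_inv ℂ h0).restrict_scalars ℝ)).congr_of_eventuallyEq
        (Eventually.of_forall fun w => div_eq_mul_inv _ _)

theorem dbar_ofReal {u : ℂ → ℝ} {L : ℂ →L[ℝ] ℝ} {z : ℂ} (h : HasFDerivAt u L z) :
    dbar (fun z => (u z : ℂ)) z = L 1 + I * L I := by
  have : HasFDerivAt (fun z => (u z : ℂ)) _ z := ofRealCLM.hasFDerivAt.comp z h
  rw [this.dbar_eq]; simp

theorem dbar_regKernel_of_ne {δ : ℝ} {v : ℂ} (h0 : v ≠ 0) :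
    dbar (regKernel δ) v = ((6 * (max 0 (1 - normSq v / δ ^ 2)) ^ 2 / δ ^ 2 : ℝ) : ℂ) := by
  have h0' : HasFDerivAt (fun v => 1 - normSq v / δ ^ 2)
      (-((δ ^ 2)⁻¹ • ((2 * v.re) • reCLM + (2 * v.im) • imCLM))) v := by
    simpa only [div_eq_mul_inv] using ((hasFDerivAt_normSq v).mul_const (δ ^ 2)⁻¹).const_sub 1
  have h1 := ((hasDerivAt_max_zero_pow_three (1 - normSq v / δ ^ 2)).comp_hasFDerivAt v
    h0').const_sub 1
  change HasFDerivAt (fun v => 1 - (max 0 (1 - normSq v / δ ^ 2)) ^ 3) _ v at h1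
  have h4 := dbar_mul (ofRealCLM.hasFDerivAt.comp v h1).differentiableAt
    ((differentiableAt_inv (𝕜 := ℂ) h0).restrictScalars ℝ)
  rw [dbar_holo (differentiableAt_inv h0), mul_zero, add_zero] at h4
  refine Eq.trans ?_ (h4.trans ?_)
  · congr 1
  · have := dbar_ofReal h1
    refine (congrArg (· * v⁻¹) this).trans ?_
    simp only [neg_apply, smul_apply, add_apply, reCLM_apply, imCLM_apply, one_re, one_im,
      I_re, I_im, smul_eq_mul]
    push_cast
    have e : (v.re : ℂ) + v.im * I = v := re_add_im v
    rw [← div_eq_mul_inv, div_eq_iff h0]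
    linear_combination (6 * (max 0 (1 - normSq v / δ ^ 2) : ℝ) ^ 2 / δ ^ 2 : ℂ) * e

theorem dbar_regKernel {δ : ℝ} (hδ : 0 < δ) (v : ℂ) :
    dbar (regKernel δ) v = ((6 * (max 0 (1 - normSq v / δ ^ 2)) ^ 2 / δ ^ 2 : ℝ) : ℂ) := by
  have hc : Continuous fun v : ℂ =>
      ((6 * (max 0 (1 - normSq v / δ ^ 2)) ^ 2 / δ ^ 2 : ℝ) : ℂ) := by
    have := contDiff_normSq.continuous
    fun_prop
  have := Continuous.ext_on (s := {(0 : ℂ)}ᶜ) (dense_compl_singleton 0)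
    (contDiff_regKernel hδ).continuous_dbar hc fun v hv => dbar_regKernel_of_ne hv
  exact congrFun this v

/-- A positivity form of the argument principle. -/
theorem smoothWinding_ne_zero {χ : ℂ → ℝ} {F : ℂ → ℂ} {O : Set ℂ} (hχ : ContDiff ℝ 2 χ)
    (hc : HasCompactSupport χ) (hχ0 : ∀ z, 0 ≤ χ z) (hO : IsOpen O) (hSO : tsupport χ ⊆ O)
    (hF : DifferentiableOn ℂ F O) {z₀ : ℂ} (hz₀ : 0 < χ z₀)
    (hd : ¬ ∀ᶠ z in 𝓝 z₀, deriv F z = 0) {δ : ℝ} (hδ : 0 < δ)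
    (hS : ∀ z ∈ tsupport (fderiv ℝ fun z => (χ z : ℂ)), δ ≤ ‖F z - F z₀‖) :
    smoothWinding (fun z => (χ z : ℂ)) F (F z₀) ≠ 0 := by
  intro hW
  set χc : ℂ → ℂ := fun z => (χ z : ℂ) with hχc
  have hχcd : ContDiff ℝ 1 χc := contDiff_ofReal_comp (hχ.of_le (by norm_num))
  have hsupp : ∀ {G : ℂ → ℂ}, tsupport (fun z => χc z * G z) ⊆ tsupport χ := fun {G} => by
    apply closure_mono
    intro z hz h0
    apply hz
    simp [hχc, h0]
  have hFan : ∀ z ∈ O, AnalyticAt ℂ F z := fun z hz => hF.analyticAt (hO.mem_nhds hz)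
  have hG : ∀ z ∈ O, ContDiffAt ℝ 1 (fun z => regKernel δ (F z - F z₀) * deriv F z) z := by
    intro z hz
    have h1 : ContDiffAt ℝ 1 F z := ((hFan z hz).contDiffAt (n := 1)).restrict_scalars ℝ
    have h2 : ContDiffAt ℝ 1 (deriv F) z :=
      ((hFan z hz).deriv.contDiffAt (n := 1)).restrict_scalars ℝ
    exact ((contDiff_regKernel hδ).contDiffAt.comp z (h1.sub contDiffAt_const)).mul h2
  set ψ : ℂ → ℂ := fun z => χc z * (regKernel δ (F z - F z₀) * deriv F z) with hψ
  have hψd : ContDiff ℝ 1 ψ := contDiff_of_contDiffAt_tsupport fun z hz =>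
    hχcd.contDiffAt.mul (hG z (hSO (hsupp hz)))
  have hψc : HasCompactSupport ψ := hc.of_isClosed_subset (isClosed_tsupport _) hsupp
  set k : ℂ → ℝ := fun z => χ z * (6 * (max 0 (1 - normSq (F z - F z₀) / δ ^ 2)) ^ 2 / δ ^ 2
    * normSq (deriv F z)) with hk
  have hk0 : ∀ z, 0 ≤ k z := fun z => mul_nonneg (hχ0 z)
    (mul_nonneg (by positivity) (normSq_nonneg _))
  have hksupp : tsupport k ⊆ tsupport χ := closure_mono fun z hz => left_ne_zero_of_mul hz
  have hkc : Continuous k := by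
    have h1 : ContinuousOn F O := hF.continuousOn
    have h2 : ContinuousOn (deriv F) O := (hF.deriv hO).continuousOn
    have h3 := contDiff_normSq.continuous
    have h4 := hχ.continuous
    refine ContinuousOn.continuous_of_tsupport_subset (s := O) ?_ hO (hksupp.trans hSO)
    fun_prop
  have hkcs : HasCompactSupport k := hc.of_isClosed_subset (isClosed_tsupport _) hksupp
  have key : ∀ z, dbar ψ z = dbar χc z * (deriv F z / (F z - F z₀)) + (k z : ℂ) := by
    intro z
    by_cases hz : z ∈ tsupport χ
    · have hzO := hSO hz
      have e1 := dbar_mul (hχcd.differentiable one_ne_zero z)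
        ((hG z hzO).differentiableAt one_ne_zero)
      have hFd : DifferentiableAt ℂ (fun z => F z - F z₀) z :=
        (hFan z hzO).differentiableAt.sub_const _
      have e2 : dbar (fun z => regKernel δ (F z - F z₀) * deriv F z) z
          = dbar (regKernel δ) (F z - F z₀) * conj (deriv F z) * deriv F z := by
        have hη := (contDiff_regKernel hδ).differentiable one_ne_zero (F z - F z₀)
        rw [dbar_mul ?_ ((hFan z hzO).deriv.differentiableAt.restrictScalars ℝ),
          dbar_holo (hFan z hzO).deriv.differentiableAt,
          dbar_comp (F := fun z => F z - F z₀) hη hFd]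
        · simp
        · exact DifferentiableAt.comp z hη (hFd.restrictScalars ℝ)
      rw [hψ, e1, e2, dbar_regKernel hδ]
      congr 1
      · by_cases hzS : z ∈ tsupport (fderiv ℝ χc)
        · rw [regKernel_eq_inv hδ (hS z hzS)]; ring
        · simp [dbar_eq_zero_of_notMem hzS]
      · simp only [hk, hχc]
        push_cast
        rw [normSq_eq_conj_mul_self]; ring
    · have hz1 : χc =ᶠ[𝓝 z] fun _ => 0 := by
        filter_upwards [notMem_tsupport_iff_eventuallyEq.mp hz] with w hw
        simp [hχc, hw]
      have hz2 : ψ =ᶠ[𝓝 z] fun _ => 0 := by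
        filter_upwards [hz1] with w hw
        simp [hψ, hw]
      have : χ z = 0 := image_eq_zero_of_notMem_tsupport hz
      rw [dbar_congr hz1, dbar_congr hz2]
      simp [dbar, hk, this]
  have hki : Integrable fun z => (k z : ℂ) :=
    (hkc.integrable_of_hasCompactSupport hkcs).ofReal
  have h0 := integral_dbar_eq_zero hψd hψc
  simp only [key] at h0
  rw [integral_add (dbarPairing_integrable (O := O ∩ {z | F z ≠ F z₀})
    (G := fun z => deriv F z / (F z - F z₀)) hχcd ?_ ?_ ?_ ?_)
    hki] at h0
  · have hW' : ∫ z, dbar χc z * (deriv F z / (F z - F z₀)) = 0 := hW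
    rw [hW', zero_add, integral_complex_ofReal] at h0
    have hinteg : ∫ z, k z = 0 := by exact_mod_cast h0
    have hkz : k = 0 := by
      by_contra hne
      obtain ⟨x, hx⟩ := Function.ne_iff.mp hne
      exact (hkc.integral_pos_of_hasCompactSupport_nonneg_nonzero hkcs hk0 hx).ne' hinteg
    apply hd
    have hzO : z₀ ∈ O := hSO (subset_tsupport _ hz₀.ne')
    have c1 : ∀ᶠ z in 𝓝 z₀, 0 < χ z := hχ.continuous.continuousAt.eventually_const_lt hz₀
    have c2 : ∀ᶠ z in 𝓝 z₀, 0 < 1 - normSq (F z - F z₀) / δ ^ 2 := by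
      have : ContinuousAt (fun z => 1 - normSq (F z - F z₀) / δ ^ 2) z₀ := by
        have h1 := (hFan z₀ hzO).continuousAt
        have h3 := contDiff_normSq.continuous
        fun_prop
      exact this.eventually_const_lt (by simp)
    filter_upwards [c1, c2] with z hz1 hz2
    have := congrFun hkz z
    simp only [hk, max_eq_right hz2.le, Pi.zero_apply] at this
    have h3 : 6 * (1 - normSq (F z - F z₀) / δ ^ 2) ^ 2 / δ ^ 2 ≠ 0 := by positivity
    simpa [hz1.ne', h3] using this
  · exact hc.of_isClosed_subset (isClosed_tsupport _)
      (closure_mono fun z hz h => hz (by simp [hχc, h]))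
  · exact hF.continuousOn.isOpen_inter_preimage hO isOpen_compl_singleton
  · intro z hz
    refine ⟨hSO ?_, fun h => ?_⟩
    · have hsub : tsupport χc ⊆ tsupport χ := closure_mono fun z hz h => hz (by simp [hχc, h])
      exact hsub (tsupport_fderiv_subset ℝ hz)
    · have := hS z hz
      rw [h, sub_self, norm_zero] at this
      exact absurd hδ this.not_gt
  · exact (((hF.deriv hO).continuousOn).mono inter_subset_left).div
      ((hF.continuousOn.mono inter_subset_left).sub continuousOn_const)
      fun z hz => sub_ne_zero.mpr hz.2

theorem eq_const_of_re_le_log {h : ℂ → ℂ} (hh : Differentiable ℂ h) {A N : ℝ}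
    (hA : ∀ w, (h w).re ≤ A + N * Real.log (1 + ‖w‖)) : ∃ c, ∀ z, h z = c := by
  have hlog : ∀ w : ℂ, 0 ≤ Real.log (1 + ‖w‖) := fun w =>
    Real.log_nonneg (by linarith [norm_nonneg w])
  suffices hd : ∀ z, deriv h z = 0 from ⟨h 0, fun z => is_const_of_deriv_eq_zero hh hd z 0⟩
  intro z
  have key : ∀ R > 0, ‖deriv h z‖ ≤
      (4 * (|A| + 1 + |N| * Real.log (1 + 3 * (‖z‖ + R))) + 5 * ‖h 0‖) / R := by
    intro R hR
    refine Complex.norm_deriv_le_of_forall_mem_sphere_norm_le hR hh.diffContOnCl ?_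
    intro w hw
    have hwn : ‖w‖ ≤ ‖z‖ + R := by
      rw [mem_sphere_iff_norm] at hw
      calc ‖w‖ = ‖z + (w - z)‖ := by ring_nf
        _ ≤ ‖z‖ + ‖w - z‖ := norm_add_le _ _
        _ = ‖z‖ + R := by rw [hw]
    set S := ‖z‖ + R with hS
    have hSpos : 0 < S := by positivity
    set M := |A| + 1 + |N| * Real.log (1 + 3 * S) with hM
    have hMpos : 0 < M := by
      have : 0 ≤ Real.log (1 + 3 * S) := Real.log_nonneg (by linarith)
      positivity
    have hmaps : MapsTo h (Metric.ball 0 (3 * S)) {z | z.re ≤ M} := by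
      intro u hu
      rw [mem_ball_zero_iff] at hu
      have h1 : Real.log (1 + ‖u‖) ≤ Real.log (1 + 3 * S) :=
        Real.log_le_log (by positivity) (by linarith)
      have h2 : N * Real.log (1 + ‖u‖) ≤ |N| * Real.log (1 + 3 * S) :=
        (mul_le_mul_of_nonneg_right (le_abs_self N) (hlog u)).trans
          (mul_le_mul_of_nonneg_left h1 (abs_nonneg N))
      have := hA u
      have := le_abs_self A
      simp only [mem_ofPred_eq]
      linarith
    have hwb : w ∈ Metric.ball (0 : ℂ) (3 * S) := by
      rw [mem_ball_zero_iff]; linarith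
    have hb := Complex.borelCaratheodory hMpos hh.differentiableOn hmaps (by positivity) hwb
    have hden : 2 * S ≤ 3 * S - ‖w‖ := by linarith
    have e1 : 2 * M * ‖w‖ / (3 * S - ‖w‖) ≤ 4 * M := by
      rw [div_le_iff₀ (by linarith)]
      nlinarith [norm_nonneg w]
    have e2 : ‖h 0‖ * (3 * S + ‖w‖) / (3 * S - ‖w‖) ≤ 5 * ‖h 0‖ := by
      rw [div_le_iff₀ (by linarith)]
      nlinarith [norm_nonneg (h 0), norm_nonneg w]
    linarith
  have hlim : Tendsto (fun R : ℝ =>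
      (4 * (|A| + 1 + |N| * Real.log (1 + 3 * (‖z‖ + R))) + 5 * ‖h 0‖) / R) atTop (𝓝 0) := by
    have h1 : Tendsto (fun R : ℝ => Real.log (1 + 3 * (‖z‖ + R)) / R) atTop (𝓝 0) := by
      have h2 : Tendsto (fun R : ℝ => 1 + 3 * (‖z‖ + R)) atTop atTop := by
        apply tendsto_atTop_add_const_left
        exact (tendsto_atTop_add_const_left _ _ tendsto_id).const_mul_atTop (by norm_num)
      have h3 : (fun R : ℝ => Real.log (1 + 3 * (‖z‖ + R))) =o[atTop] fun R => 1 + 3 * (‖z‖ + R) :=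
        Real.isLittleO_log_id_atTop.comp_tendsto h2
      have h4 : (fun R : ℝ => 1 + 3 * (‖z‖ + R)) =O[atTop] fun R => R := by
        apply Asymptotics.IsBigO.of_bound (4 + 3 * ‖z‖)
        filter_upwards [eventually_ge_atTop 1] with R hR
        rw [Real.norm_of_nonneg (by positivity), Real.norm_of_nonneg (by positivity)]
        nlinarith [norm_nonneg z]
      exact (h3.trans_isBigO h4).tendsto_div_nhds_zero
    have h5 := (h1.const_mul (4 * |N|)).add
      ((tendsto_inv_atTop_zero (𝕜 := ℝ)).const_mul (4 * (|A| + 1) + 5 * ‖h 0‖))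
    rw [mul_zero, mul_zero, add_zero] at h5
    refine h5.congr fun R => ?_
    ring
  have := ge_of_tendsto hlim ((eventually_gt_atTop 0).mono key)
  exact norm_le_zero_iff.mp this

namespace IsTranscendentalSelfMapCStar

variable {f : ℂ → ℂ}

theorem ne_zero (hf : IsTranscendentalSelfMapCStar f) {z : ℂ} (hz : z ≠ 0) : f z ≠ 0 := by
  obtain ⟨m, g, h, -, -, -, -, hfm⟩ := hf
  rw [hfm z hz]
  exact mul_ne_zero (zpow_ne_zero _ hz) (Complex.exp_ne_zero _)

theorem iterate_ne_zero (hf : IsTranscendentalSelfMapCStar f) (n : ℕ) {z : ℂ} (hz : z ≠ 0) :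
    f^[n] z ≠ 0 := by
  induction n generalizing z with
  | zero => simpa
  | succ n ih => rw [iterate_succ_apply]; exact ih (hf.ne_zero hz)

theorem differentiableAt (hf : IsTranscendentalSelfMapCStar f) {z : ℂ} (hz : z ≠ 0) :
    DifferentiableAt ℂ f z := by
  obtain ⟨m, g, h, hg, hh, -, -, hfm⟩ := hf
  have : f =ᶠ[𝓝 z] fun z => z ^ m * Complex.exp (g z + h z⁻¹) := by
    filter_upwards [isOpen_ne.mem_nhds hz] with w hw using hfm w hw
  refine DifferentiableAt.congr_of_eventuallyEq ?_ this
  have h1 : DifferentiableAt ℂ (fun z => h z⁻¹) z := (hh _).comp z (differentiableAt_inv hz)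
  have h2 : DifferentiableAt ℂ (fun z : ℂ => z ^ m) z := differentiableAt_zpow.mpr (Or.inl hz)
  exact h2.mul ((hg z).add h1).cexp

theorem differentiableAt_iterate (hf : IsTranscendentalSelfMapCStar f) (n : ℕ) {z : ℂ}
    (hz : z ≠ 0) : DifferentiableAt ℂ f^[n] z := by
  induction n generalizing z with
  | zero => exact differentiableAt_id
  | succ n ih =>
    rw [iterate_succ]
    exact (ih (hf.ne_zero hz)).comp z (hf.differentiableAt hz)

theorem differentiableOn_iterate (hf : IsTranscendentalSelfMapCStar f) (n : ℕ) :
    DifferentiableOn ℂ f^[n] {0}ᶜ :=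
  fun _ hz => (hf.differentiableAt_iterate n hz).differentiableWithinAt

theorem continuousAt_iterate (hf : IsTranscendentalSelfMapCStar f) (n : ℕ) {z : ℂ}
    (hz : z ≠ 0) : ContinuousAt f^[n] z := (hf.differentiableAt_iterate n hz).continuousAt

/-- Conjugating by `z ↦ 1 / z` preserves the class of transcendental self-maps of `ℂ*`. -/
theorem inv_conj (hf : IsTranscendentalSelfMapCStar f) :
    IsTranscendentalSelfMapCStar fun z => (f z⁻¹)⁻¹ := by
  obtain ⟨m, g, h, hg, hh, hgc, hhc, hfm⟩ := hf
  refine ⟨m, fun z => -h z, fun z => -g z, hh.neg, hg.neg, ?_, ?_, fun z hz => ?_⟩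
  · rintro ⟨c, hc⟩; exact hhc ⟨-c, fun z => by rw [← hc z, neg_neg]⟩
  · rintro ⟨c, hc⟩; exact hgc ⟨-c, fun z => by rw [← hc z, neg_neg]⟩
  · simp only []
    rw [hfm _ (inv_ne_zero hz), mul_inv, ← Complex.exp_neg, inv_inv, inv_zpow, inv_inv]
    congr 2; ring

theorem iterate_inv_conj (f : ℂ → ℂ) (n : ℕ) (z : ℂ) :
    (fun z => (f z⁻¹)⁻¹)^[n] z = (f^[n] z⁻¹)⁻¹ := by
  induction n generalizing z with
  | zero => simp
  | succ n ih => rw [iterate_succ_apply, ih, iterate_succ_apply, inv_inv]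

theorem not_meromorphicAt_zero (hf : IsTranscendentalSelfMapCStar f) : ¬ MeromorphicAt f 0 := by
  rintro ⟨n, hn⟩
  obtain ⟨m, g, h, hg, hh, -, hhc, hfm⟩ := hf
  apply hhc
  obtain ⟨r, hr, hr1, hb⟩ : ∃ r > 0, r < 1 ∧ ∀ z ∈ Metric.ball (0:ℂ) r,
      ‖(z - 0) ^ n • f z‖ < ‖((0:ℂ) - 0) ^ n • f 0‖ + 1 := by
    have := hn.continuousAt.norm.eventually_lt_const (lt_add_one _)
    obtain ⟨r, hr, hb⟩ := Metric.eventually_nhds_iff_ball.mp this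
    exact ⟨min r (1/2), by positivity, by linarith [min_le_right r (1/2)], fun z hz =>
      hb z (Metric.ball_subset_ball (min_le_left _ _) hz)⟩
  set C := ‖((0:ℂ) - 0) ^ n • f 0‖ + 1 with hC
  have hCpos : 0 < C := by positivity
  obtain ⟨B, hB⟩ := (isCompact_closedBall (0 : ℂ) 1).exists_bound_of_continuousOn
    hg.continuous.continuousOn
  obtain ⟨D, hD⟩ := (isCompact_closedBall (0 : ℂ) r⁻¹).exists_bound_of_continuousOn
    hh.continuous.continuousOn
  have hD0 : 0 ≤ D := (norm_nonneg _).trans (hD 0 (by simp [hr.le]))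
  have hB0 : 0 ≤ B := (norm_nonneg _).trans (hB 0 (by simp))
  refine eq_const_of_re_le_log hh (A := D + |Real.log C| + B) (N := |((n : ℤ) + m : ℝ)|) fun w => ?_
  have hl : 0 ≤ Real.log (1 + ‖w‖) := Real.log_nonneg (by linarith [norm_nonneg w])
  by_cases hw : ‖w‖ ≤ r⁻¹
  · have := hD w (by simpa using hw)
    have := (Complex.re_le_norm (h w))
    have : 0 ≤ |((n : ℤ) + m : ℝ)| * Real.log (1 + ‖w‖) := by positivity
    have := abs_nonneg (Real.log C)
    linarith
  · push Not at hw
    have hwpos : 0 < ‖w‖ := (by positivity : 0 < r⁻¹).trans hw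
    have hw0 : w ≠ 0 := norm_pos_iff.mp hwpos
    have hw1 : 1 ≤ ‖w‖ := ((one_le_inv₀ hr).mpr hr1.le).trans hw.le
    have hz := hb w⁻¹ (by
      rw [mem_ball_zero_iff, norm_inv]; exact inv_lt_of_inv_lt₀ hr hw)
    rw [hfm _ (inv_ne_zero hw0), inv_inv, smul_eq_mul, sub_zero, norm_mul, norm_mul,
      Complex.norm_exp, norm_pow, norm_zpow, norm_inv, add_re] at hz
    have hgw : |(g w⁻¹).re| ≤ B := (Complex.abs_re_le_norm _).trans
      (hB w⁻¹ (by rw [mem_closedBall_zero_iff, norm_inv]; exact inv_le_one_of_one_le₀ hw1))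
    have hlz := Real.log_lt_log (by positivity) hz
    rw [Real.log_mul (by positivity) (by positivity), Real.log_mul (by positivity) (by positivity),
      Real.log_exp, Real.log_pow, Real.log_zpow, Real.log_inv] at hlz
    have h1 : Real.log ‖w‖ ≤ Real.log (1 + ‖w‖) := Real.log_le_log hwpos (by linarith)
    have h0 : 0 ≤ Real.log ‖w‖ := Real.log_nonneg hw1
    have h2 : ((n : ℤ) + m : ℝ) * Real.log ‖w‖ ≤ |((n : ℤ) + m : ℝ)| * Real.log (1 + ‖w‖) :=
      (mul_le_mul_of_nonneg_right (le_abs_self _) h0).trans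
        (mul_le_mul_of_nonneg_left h1 (abs_nonneg _))
    have := le_abs_self (Real.log C)
    have := neg_abs_le (g w⁻¹).re
    push_cast at h2 ⊢
    nlinarith

/-- A form of the Casorati–Weierstrass theorem at the origin. -/
theorem exists_norm_sub_lt (hf : IsTranscendentalSelfMapCStar f) {r : ℝ} (hr : 0 < r) (a : ℂ)
    {ε : ℝ} (hε : 0 < ε) : ∃ z, z ≠ 0 ∧ ‖z‖ < r ∧ ‖f z - a‖ < ε := by
  by_contra! hno
  apply hf.not_meromorphicAt_zero
  have hne : ∀ z ∈ Metric.ball (0:ℂ) r \ {0}, f z - a ≠ 0 := fun z hz h0 => by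
    have := hno z hz.2 (by simpa using hz.1)
    rw [h0, norm_zero] at this
    exact absurd hε this.not_gt
  set k : ℂ → ℂ := fun z => (f z - a)⁻¹ with hk
  have hkd : DifferentiableOn ℂ k (Metric.ball 0 r \ {0}) := fun z hz =>
    (((hf.differentiableAt hz.2).sub_const a).inv (hne z hz)).differentiableWithinAt
  have hkb : BddAbove (norm ∘ k '' (Metric.ball 0 r \ {0})) := by
    refine ⟨ε⁻¹, ?_⟩
    rintro _ ⟨z, hz, rfl⟩
    simp only [hk, comp_apply, norm_inv]
    exact inv_anti₀ hε (hno z hz.2 (by simpa using hz.1))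
  have hball := Metric.ball_mem_nhds (0:ℂ) hr
  have hext := (Complex.differentiableOn_update_limUnder_of_bddAbove hball hkd hkb).analyticAt hball
  have hkm : MeromorphicAt k 0 := by
    refine hext.meromorphicAt.congr ?_
    filter_upwards [self_mem_nhdsWithin] with z hz
    rw [update_of_ne hz]
  refine (hkm.inv.add (MeromorphicAt.const a 0)).congr ?_
  filter_upwards with z
  simp [hk]

theorem not_bounded_iterate (hf : IsTranscendentalSelfMapCStar f) (k : ℕ) {r R : ℝ} (hr : 0 < r) :
    ∃ z, z ≠ 0 ∧ ‖z‖ < r ∧ R < ‖f^[k + 1] z‖ := by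
  by_contra! hno
  induction k generalizing r with
  | zero =>
    obtain ⟨z, hz, hzr, hlt⟩ := hf.exists_norm_sub_lt hr (|R| + 1 : ℝ) one_pos
    have := hno z hz hzr
    have h1 : ‖((|R| + 1 : ℝ) : ℂ)‖ ≤ ‖f z‖ + ‖f z - (|R| + 1 : ℝ)‖ := by
      have := norm_sub_le (f z) (f z - (|R| + 1 : ℝ))
      rwa [sub_sub_cancel] at this
    rw [Complex.norm_of_nonneg (by positivity)] at h1
    simp only [zero_add, iterate_one] at this
    have := le_abs_self R
    linarith
  | succ k ih =>
    refine ih one_pos fun w hw _ => ?_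
    refine le_of_forall_pos_lt_add fun ε hε => ?_
    obtain ⟨δ, hδ, hball⟩ := Metric.continuousAt_iff.mp (hf.continuousAt_iterate (k + 1) hw) ε hε
    obtain ⟨z, hz, hzr, hlt⟩ := hf.exists_norm_sub_lt hr w hδ
    have h1 := hball (by rwa [dist_eq_norm] : dist (f z) w < δ)
    have h2 := hno z hz hzr
    rw [iterate_succ_apply] at h2
    rw [dist_eq_norm, norm_sub_rev] at h1
    have h3 : ‖f^[k + 1] w‖ ≤ ‖f^[k + 1] (f z)‖ + ‖f^[k + 1] w - f^[k + 1] (f z)‖ := by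
      have := norm_add_le (f^[k + 1] (f z)) (f^[k + 1] w - f^[k + 1] (f z))
      rwa [add_sub_cancel] at this
    linarith

end IsTranscendentalSelfMapCStar

/-- Smooth cutoff functions. -/
theorem exists_smooth_cutoff {K O : Set ℂ} (hK : IsCompact K) (hO : IsOpen O) (hKO : K ⊆ O) :
    ∃ χ : ℂ → ℝ, ContDiff ℝ 2 χ ∧ HasCompactSupport χ ∧ tsupport χ ⊆ O ∧
      (∀ᶠ z in 𝓝ˢ K, χ z = 1) ∧ ∀ z, χ z ∈ Icc (0 : ℝ) 1 := by
  obtain ⟨L, hL, hKL, hLO⟩ := exists_compact_between hK hO hKO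
  obtain ⟨χ, h0, h1, h01⟩ := exists_contMDiffMap_zero_one_nhds_of_isClosed (n := 2)
    (modelWithCornersSelf ℝ ℂ) (s := (interior L)ᶜ) (t := K) isOpen_interior.isClosed_compl
    hK.isClosed (disjoint_compl_left_iff_subset.mpr hKL)
  have hsub : tsupport χ ⊆ L := by
    refine closure_minimal ?_ hL.isClosed
    intro z hz
    by_contra hzL
    exact hz (h0.self_of_nhdsSet z fun h => hzL (interior_subset h))
  exact ⟨χ, χ.contMDiff.contDiff, hL.of_isClosed_subset (isClosed_tsupport _) hsub,
    hsub.trans hLO, h1, h01⟩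

namespace IsTranscendentalSelfMapCStar

variable {f : ℂ → ℂ}

theorem exists_zpow_mul_exp (hf : IsTranscendentalSelfMapCStar f) :
    ∃ m : ℤ, ∀ n : ℕ, ∃ Φ : ℂ → ℂ, DifferentiableOn ℂ Φ {0}ᶜ ∧
      ∀ z ≠ 0, f^[n] z = z ^ (m ^ n) * Complex.exp (Φ z) := by
  have hf' := hf
  obtain ⟨m, g, h, hg, hh, -, -, hfm⟩ := hf
  refine ⟨m, fun n => ?_⟩
  induction n with
  | zero => exact ⟨fun _ => 0, differentiableOn_const _, fun z _ => by simp⟩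
  | succ n ih =>
    obtain ⟨Φ, hΦ, hΦe⟩ := ih
    refine ⟨fun z => (m ^ n : ℤ) * (g z + h z⁻¹) + Φ (f z), ?_, fun z hz => ?_⟩
    · intro z hz
      have h1 : DifferentiableAt ℂ (fun z => h z⁻¹) z := (hh _).comp z (differentiableAt_inv hz)
      have h2 : DifferentiableAt ℂ (fun z => Φ (f z)) z :=
        (hΦ.differentiableAt (isOpen_compl_singleton.mem_nhds (hf'.ne_zero hz))).comp z
          (hf'.differentiableAt hz)
      exact ((((hg z).add h1).const_mul _).add h2).differentiableWithinAt
    · have hpow : f z ^ (m ^ n) = z ^ (m ^ (n + 1)) *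
          Complex.exp ((m ^ n : ℤ) * (g z + h z⁻¹)) := by
        rw [hfm z hz, mul_zpow, ← Complex.exp_int_mul, ← zpow_mul, pow_succ']
      rw [iterate_succ_apply, hΦe _ (hf'.ne_zero hz), hpow, Complex.exp_add, mul_assoc]

theorem smoothWinding_iterate_zero (hf : IsTranscendentalSelfMapCStar f) :
    ∃ m : ℤ, ∀ (n : ℕ) (χ : ℂ → ℂ), ContDiff ℝ 2 χ → HasCompactSupport χ →
      tsupport (fderiv ℝ χ) ⊆ {0}ᶜ →
      smoothWinding χ f^[n] 0 = (m : ℂ) ^ n * smoothWinding χ id 0 := by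
  obtain ⟨m, hm⟩ := hf.exists_zpow_mul_exp
  refine ⟨m, fun n χ hχ hc hS => ?_⟩
  obtain ⟨Φ, hΦ, hΦe⟩ := hm n
  have ho : IsOpen ({0}ᶜ : Set ℂ) := isOpen_compl_singleton
  have hcong : smoothWinding χ f^[n] 0 =
      dbarPairing χ fun z => (m : ℂ) ^ n * z⁻¹ + deriv Φ z := by
    refine dbarPairing_congr fun z hz => ?_
    have hz0 : z ≠ 0 := hS hz
    have hev : f^[n] =ᶠ[𝓝 z] fun z => z ^ (m ^ n) * Complex.exp (Φ z) := by
      filter_upwards [ho.mem_nhds hz0] with w hw using hΦe w hw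
    have hd := (hasDerivAt_zpow (m ^ n) z (Or.inl hz0)).mul
      (hΦ.differentiableAt (ho.mem_nhds hz0)).hasDerivAt.cexp
    have hd' : deriv f^[n] z = _ := (hd.congr_of_eventuallyEq hev).deriv
    rw [hd', sub_zero, hΦe z hz0, zpow_sub_one₀ hz0]
    have := Complex.exp_ne_zero (Φ z)
    have := zpow_ne_zero (m ^ n) hz0
    push_cast
    field_simp
  rw [hcong, dbarPairing_add (O := {0}ᶜ) (G := fun z => (m : ℂ) ^ n * z⁻¹) (G' := deriv Φ)
    (hχ.of_le (by norm_num)) hc ho hS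
    (continuousOn_const.mul (continuousOn_inv₀.mono fun z hz => hz)) (hΦ.deriv ho).continuousOn,
    dbarPairing_const_mul, dbarPairing_deriv_eq_zero hχ hc ho hS
      fun z hz => (hΦ.differentiableAt (ho.mem_nhds hz)).hasDerivAt, add_zero]
  simp [smoothWinding]

theorem not_eventually_deriv_iterate_eq_zero (hf : IsTranscendentalSelfMapCStar f) {p : ℕ}
    (hp : 0 < p) {z₀ : ℂ} (hz₀ : z₀ ≠ 0) : ¬ ∀ᶠ z in 𝓝 z₀, deriv f^[p] z = 0 := by
  intro h
  have ho : IsOpen ({0}ᶜ : Set ℂ) := isOpen_compl_singleton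
  have hconn : IsPreconnected ({0}ᶜ : Set ℂ) :=
    (isConnected_compl_singleton_of_one_lt_rank (by simp) 0).isPreconnected
  have hF := hf.differentiableOn_iterate p
  have h0 : EqOn (deriv f^[p]) 0 {0}ᶜ :=
    ((hF.deriv ho).analyticOnNhd ho).eqOn_zero_of_preconnected_of_eventuallyEq_zero hconn hz₀ h
  obtain ⟨c, hc⟩ := ho.exists_is_const_of_deriv_eq_zero hconn hF h0
  obtain ⟨k, rfl⟩ := Nat.exists_eq_succ_of_ne_zero hp.ne'
  obtain ⟨z, hz, -, hlt⟩ := hf.not_bounded_iterate k (R := ‖c‖) one_pos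
  rw [← hc z hz] at hlt
  exact lt_irrefl _ hlt

end IsTranscendentalSelfMapCStar

theorem smoothWinding_id_zero_ne_zero {χ : ℂ → ℝ} (hχ : ContDiff ℝ 2 χ)
    (hc : HasCompactSupport χ) (hχ0 : ∀ z, 0 ≤ χ z) (h1 : ∀ᶠ z in 𝓝 0, χ z = 1) :
    smoothWinding (fun z => (χ z : ℂ)) id 0 ≠ 0 := by
  obtain ⟨δ, hδ, hball⟩ := Metric.eventually_nhds_iff_ball.mp h1
  refine smoothWinding_ne_zero (F := id) (z₀ := 0) hχ hc hχ0 isOpen_univ (subset_univ _)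
    differentiableOn_id ?_ ?_ hδ ?_
  · rw [h1.self_of_nhds]; exact one_pos
  · simp [(inferInstance : NeBot (𝓝 (0 : ℂ))).ne]
  · intro z hz
    by_contra! hlt
    have hev : (fun z => (χ z : ℂ)) =ᶠ[𝓝 z] fun _ => 1 := by
      filter_upwards [Metric.isOpen_ball.mem_nhds (show z ∈ Metric.ball 0 δ by simpa using hlt)]
        with w hw
      simp [hball w hw]
    refine (notMem_tsupport_iff_eventuallyEq.mpr ?_) hz
    filter_upwards [hev.fderiv (𝕜 := ℝ)] with w hw
    simp [hw]

theorem smoothWinding_sub_left {χ₁ χ₂ : ℂ → ℝ} {F : ℂ → ℂ} {q : ℂ} {O : Set ℂ}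
    (h1 : ContDiff ℝ 2 χ₁) (h2 : ContDiff ℝ 2 χ₂) (hc1 : HasCompactSupport χ₁)
    (hc2 : HasCompactSupport χ₂) (hO : IsOpen O)
    (hS1 : tsupport (fderiv ℝ fun z => (χ₁ z : ℂ)) ⊆ O)
    (hS2 : tsupport (fderiv ℝ fun z => (χ₂ z : ℂ)) ⊆ O)
    (hF : DifferentiableOn ℂ F O) (hq : ∀ z ∈ O, F z ≠ q) :
    smoothWinding (fun z => ((χ₂ z - χ₁ z : ℝ) : ℂ)) F q =
      smoothWinding (fun z => (χ₂ z : ℂ)) F q - smoothWinding (fun z => (χ₁ z : ℂ)) F q := by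
  have e1 := contDiff_ofReal_comp h1
  have e2 := contDiff_ofReal_comp h2
  have hG : ContinuousOn (fun z => deriv F z / (F z - q)) O :=
    (hF.deriv hO).continuousOn.div (hF.continuousOn.sub continuousOn_const)
      fun z hz => sub_ne_zero.mpr (hq z hz)
  have i1 := dbarPairing_integrable (e1.of_le (by norm_num)) (hc1.comp_left ofReal_zero) hO hS1 hG
  have i2 := dbarPairing_integrable (e2.of_le (by norm_num)) (hc2.comp_left ofReal_zero) hO hS2 hG
  rw [smoothWinding, smoothWinding, smoothWinding, dbarPairing, dbarPairing, dbarPairing,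
    ← integral_sub i2 i1]
  congr 1
  ext z
  have d1 : DifferentiableAt ℝ (fun z => (χ₁ z : ℂ)) z := e1.differentiable (by norm_num) z
  have d2 : DifferentiableAt ℝ (fun z => (χ₂ z : ℂ)) z := e2.differentiable (by norm_num) z
  have := (d2.hasFDerivAt.sub d1.hasFDerivAt).dbar_eq
  have h3 : dbar (fun z => ((χ₂ z - χ₁ z : ℝ) : ℂ)) z =
      dbar (fun z => (χ₂ z : ℂ)) z - dbar (fun z => (χ₁ z : ℂ)) z := by
    rw [show (fun z => ((χ₂ z - χ₁ z : ℝ) : ℂ)) = (fun z => (χ₂ z : ℂ)) - fun z => (χ₁ z : ℂ) by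
      ext w; simp, this]
    simp only [dbar, sub_apply]
    ring
  rw [h3]
  ring

/-- A smooth cutoff separating `K₀` from `K₁`. -/
structure IsRingCutoff (K₀ K₁ : Set ℂ) (χ : ℂ → ℝ) : Prop where
  contDiff : ContDiff ℝ 2 χ
  hasCompactSupport : HasCompactSupport χ
  tsupport_subset : tsupport χ ⊆ K₁ᶜ
  eq_one : ∀ᶠ z in 𝓝ˢ K₀, χ z = 1
  mem_Icc : ∀ z, χ z ∈ Icc (0 : ℝ) 1

theorem tsupport_fderiv_ofReal_subset (χ : ℂ → ℝ) :
    tsupport (fderiv ℝ fun z => (χ z : ℂ)) ⊆ tsupport χ := by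
  refine (tsupport_fderiv_subset ℝ).trans (closure_mono fun z hz => ?_)
  simpa using hz

theorem notMem_tsupport_fderiv_of_eventually_one {χ : ℂ → ℝ} {z : ℂ}
    (h : ∀ᶠ w in 𝓝 z, χ w = 1) : z ∉ tsupport (fderiv ℝ fun z => (χ z : ℂ)) := by
  have hev : (fun z => (χ z : ℂ)) =ᶠ[𝓝 z] fun _ => 1 := by
    filter_upwards [h] with w hw
    simp [hw]
  refine notMem_tsupport_iff_eventuallyEq.mpr ?_
  filter_upwards [hev.fderiv (𝕜 := ℝ)] with w hw
  simp [hw]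

namespace IsRingCutoff

variable {K₀ K₁ : Set ℂ} {χ : ℂ → ℝ}

theorem tsupport_fderiv_subset (h : IsRingCutoff K₀ K₁ χ) :
    tsupport (fderiv ℝ fun z => (χ z : ℂ)) ⊆ (K₀ ∪ K₁)ᶜ := by
  rintro z hz (h0 | h1)
  · exact notMem_tsupport_fderiv_of_eventually_one (h.eq_one.filter_mono (nhds_le_nhdsSet h0)) hz
  · exact h.tsupport_subset (tsupport_fderiv_ofReal_subset χ hz) h1

theorem contDiff_ofReal (h : IsRingCutoff K₀ K₁ χ) : ContDiff ℝ 2 fun z => (χ z : ℂ) :=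
  contDiff_ofReal_comp h.contDiff

theorem hasCompactSupport_ofReal (h : IsRingCutoff K₀ K₁ χ) :
    HasCompactSupport fun z => (χ z : ℂ) :=
  h.hasCompactSupport.comp_left ofReal_zero

theorem isCompact_tsupport_fderiv (h : IsRingCutoff K₀ K₁ χ) :
    IsCompact (tsupport (fderiv ℝ fun z => (χ z : ℂ))) :=
  h.hasCompactSupport.isCompact.of_isClosed_subset (isClosed_tsupport _)
    (tsupport_fderiv_ofReal_subset χ)

end IsRingCutoff

theorem exists_isRingCutoff {K₀ K₁ K : Set ℂ} (hK : IsCompact K) (h1 : IsClosed K₁)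
    (h0K : K₀ ⊆ K) (hK1 : K ⊆ K₁ᶜ) :
    ∃ χ, IsRingCutoff K₀ K₁ χ ∧ ∀ᶠ z in 𝓝ˢ K, χ z = 1 := by
  obtain ⟨χ, a, b, c, d, e⟩ := exists_smooth_cutoff hK h1.isOpen_compl hK1
  exact ⟨χ, ⟨a, b, c, d.filter_mono (nhdsSet_mono h0K), e⟩, d⟩

/-- A bounded domain of the punctured plane whose spherical complement is split into two
continua around `0` and `∞`, invariant under `f^[p]`, on which orbits escape. -/
structure IsEscapingRing (f : ℂ → ℂ) (p : ℕ) (V : Set ℂ) (X₀ X₁ : Set (OnePoint ℂ)) : Prop where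
  isOpen : IsOpen V
  isPreconnected : IsPreconnected V
  isBounded : Bornology.IsBounded V
  mapsTo : MapsTo f^[p] V V
  escaping : ∀ C ⊆ V, IsCompact C → ∀ ε > (0 : ℝ), ∃ N : ℕ, ∀ n ≥ N, ∀ z ∈ C,
    ‖f^[n] z‖ < ε ∨ 1 / ε < ‖f^[n] z‖
  frontier_notMem : ∀ z ∈ frontier V, z ≠ 0 → f^[p] z ∉ V
  isClosed₀ : IsClosed X₀
  isClosed₁ : IsClosed X₁
  isPreconnected₀ : IsPreconnected X₀
  isPreconnected₁ : IsPreconnected X₁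
  disjoint : Disjoint X₀ X₁
  union_eq : X₀ ∪ X₁ = ((fun z : ℂ => (z : OnePoint ℂ)) '' V)ᶜ
  zero_mem : ((0 : ℂ) : OnePoint ℂ) ∈ X₀
  infty_mem : ∞ ∈ X₁

theorem IsOpen.exists_isCompact_isPreconnected {V : Set ℂ} (hV : IsOpen V)
    (hc : IsPreconnected V) {a b : ℂ} (ha : a ∈ V) (hb : b ∈ V) :
    ∃ Q ⊆ V, IsCompact Q ∧ IsPreconnected Q ∧ a ∈ Q ∧ b ∈ Q := by
  have hp : IsPathConnected V := hV.isConnected_iff_isPathConnected.mp ⟨⟨a, ha⟩, hc⟩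
  obtain ⟨γ, hγ⟩ := hp.joinedIn a ha b hb
  exact ⟨range γ, range_subset_iff.mpr hγ, isCompact_range γ.continuous,
    isPreconnected_range γ.continuous, ⟨0, γ.source⟩, ⟨1, γ.target⟩⟩

namespace IsEscapingRing

variable {f : ℂ → ℂ} {p : ℕ} {V : Set ℂ} {X₀ X₁ : Set (OnePoint ℂ)}

local notation "K[" X "]" => ((fun z : ℂ => (z : OnePoint ℂ)) ⁻¹' X)

theorem infty_notMem (h : IsEscapingRing f p V X₀ X₁) : ∞ ∉ X₀ :=
  fun h' => Set.disjoint_left.mp h.disjoint h' h.infty_mem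

theorem isCompact_preimage (h : IsEscapingRing f p V X₀ X₁) : IsCompact K[X₀] :=
  ((OnePoint.isClosed_iff_of_notMem h.infty_notMem).mp h.isClosed₀).2

theorem isClosed_preimage (h : IsEscapingRing f p V X₀ X₁) : IsClosed K[X₁] :=
  h.isClosed₁.preimage continuous_coe

theorem mem_iff (h : IsEscapingRing f p V X₀ X₁) {z : ℂ} :
    z ∈ V ↔ z ∉ K[X₀] ∪ K[X₁] := by
  have : (z : OnePoint ℂ) ∈ X₀ ∪ X₁ ↔
      (z : OnePoint ℂ) ∈ ((fun z : ℂ => (z : OnePoint ℂ)) '' V)ᶜ := by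
    rw [h.union_eq]
  rw [mem_compl_iff, (OnePoint.coe_injective).mem_set_image] at this
  rw [← preimage_union, mem_preimage, this, not_not]

theorem compl_union (h : IsEscapingRing f p V X₀ X₁) : (K[X₀] ∪ K[X₁])ᶜ = V := by
  ext z
  exact h.mem_iff.symm

theorem disjoint_preimage (h : IsEscapingRing f p V X₀ X₁) : K[X₀] ⊆ K[X₁]ᶜ :=
  fun _ h0 h1 => Set.disjoint_left.mp h.disjoint h0 h1

theorem zero_notMem (h : IsEscapingRing f p V X₀ X₁) : (0 : ℂ) ∉ V :=
  fun h' => h.mem_iff.mp h' (Or.inl h.zero_mem)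

theorem mapsTo_iterate (h : IsEscapingRing f p V X₀ X₁) (n : ℕ) : MapsTo f^[p * n] V V := by
  rw [iterate_mul]
  exact h.mapsTo.iterate n

theorem exists_iterate_small (h : IsEscapingRing f p V X₀ X₁) (hp : 0 < p) {C : Set ℂ}
    (hCV : C ⊆ V) (hC : IsCompact C) {ε : ℝ} (hε : 0 < ε) :
    ∃ n, ∀ z ∈ C, ‖f^[p * n] z‖ < ε := by
  obtain ⟨R, hR⟩ := h.isBounded.exists_norm_le
  obtain ⟨N, hN⟩ := h.escaping C hCV hC (min ε (1 / (|R| + 1))) (by positivity)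
  refine ⟨N, fun z hz => ?_⟩
  have hN' := hN (p * N) (Nat.le_mul_of_pos_left _ hp) z hz
  refine (hN'.resolve_right ?_).trans_le (min_le_left _ _)
  have h1 : ‖f^[p * N] z‖ ≤ R := hR _ (h.mapsTo_iterate N (hCV hz))
  have h2 : |R| + 1 ≤ 1 / min ε (1 / (|R| + 1)) := by
    rw [le_div_iff₀ (by positivity)]
    calc (|R| + 1) * min ε (1 / (|R| + 1)) ≤ (|R| + 1) * (1 / (|R| + 1)) := by
          gcongr; exact min_le_right _ _
      _ = 1 := by field_simp
  have := le_abs_self R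
  linarith

theorem tsupport_fderiv_subset (h : IsEscapingRing f p V X₀ X₁) {χ : ℂ → ℝ}
    (hχ : IsRingCutoff K[X₀] K[X₁] χ) : tsupport (fderiv ℝ fun z => (χ z : ℂ)) ⊆ V :=
  h.compl_union ▸ hχ.tsupport_fderiv_subset

theorem subset_compl_zero (h : IsEscapingRing f p V X₀ X₁) : V ⊆ {0}ᶜ :=
  fun _ hz h0 => h.zero_notMem (h0 ▸ hz)

theorem iterate_notMem (h : IsEscapingRing f p V X₀ X₁) (n : ℕ) {z : ℂ} (hz : z ∈ V) :
    (f^[p * n] z : OnePoint ℂ) ∉ X₀ ∧ (f^[p * n] z : OnePoint ℂ) ∉ X₁ := by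
  have := h.mem_iff.mp (h.mapsTo_iterate n hz)
  exact ⟨fun h' => this (Or.inl h'), fun h' => this (Or.inr h')⟩

/-- The complementary component at the origin is not reduced to a point. -/
theorem exists_mem_ne_zero (h : IsEscapingRing f p V X₀ X₁)
    (hf : IsTranscendentalSelfMapCStar f) (hp : 0 < p) : ∃ a ≠ 0, a ∈ K[X₀] := by
  by_contra! hcon
  have hnhds : K[X₁]ᶜ ∈ 𝓝 (0 : ℂ) :=
    h.isClosed_preimage.isOpen_compl.mem_nhds (h.disjoint_preimage h.zero_mem)
  obtain ⟨r, hr, hball⟩ := Metric.mem_nhds_iff.mp hnhds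
  obtain ⟨R, hR⟩ := h.isBounded.exists_norm_le
  obtain ⟨k, rfl⟩ := Nat.exists_eq_succ_of_ne_zero hp.ne'
  obtain ⟨z, hz, hzr, hlt⟩ := hf.not_bounded_iterate k (R := R) hr
  refine absurd (hR _ (h.mapsTo (h.mem_iff.mpr ?_))) hlt.not_ge
  rintro (h0 | h1)
  · exact hcon z hz h0
  · exact hball (by simpa using hzr) h1

theorem smoothWinding_zero_eq_zero (h : IsEscapingRing f p V X₀ X₁)
    (hf : IsTranscendentalSelfMapCStar f) (hp : 0 < p) {χ : ℂ → ℝ}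
    (hχ : IsRingCutoff K[X₀] K[X₁] χ) :
    smoothWinding (fun z => (χ z : ℂ)) f^[p] 0 = 0 := by
  obtain ⟨m, hm⟩ := hf.smoothWinding_iterate_zero
  have hS := h.tsupport_fderiv_subset hχ
  have hS0 := hS.trans h.subset_compl_zero
  obtain ⟨a, ha, haX⟩ := h.exists_mem_ne_zero hf hp
  obtain ⟨n, hn⟩ := h.exists_iterate_small hp hS hχ.isCompact_tsupport_fderiv (norm_pos_iff.mpr ha)
  have e1 := smoothWinding_eq_zero_of_norm_lt hχ.contDiff_ofReal hχ.hasCompactSupport_ofReal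
    isOpen_compl_singleton hS0 (hf.differentiableOn_iterate (p * n)) hn
  have e2 := smoothWinding_eq_of_mem hχ.contDiff_ofReal hχ.hasCompactSupport_ofReal
    isOpen_compl_singleton hS0 (hf.differentiableOn_iterate (p * n)) h.isPreconnected₀
    (fun z hz => (h.iterate_notMem n (hS hz)).1) haX h.zero_mem
  have hJ := smoothWinding_id_zero_ne_zero hχ.contDiff hχ.hasCompactSupport
    (fun z => (hχ.mem_Icc z).1)
    (hχ.eq_one.filter_mono (nhds_le_nhdsSet (show (0 : ℂ) ∈ _ from h.zero_mem)))
  rw [e2, hm _ _ hχ.contDiff_ofReal hχ.hasCompactSupport_ofReal hS0] at e1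
  have hm0 : (m : ℂ) = 0 := by
    rcases mul_eq_zero.mp e1 with h1 | h1
    · exact eq_zero_of_pow_eq_zero h1
    · exact absurd h1 hJ
  rw [hm _ _ hχ.contDiff_ofReal hχ.hasCompactSupport_ofReal hS0, hm0, zero_pow hp.ne', zero_mul]

theorem smoothWinding_notMem_eq_zero (h : IsEscapingRing f p V X₀ X₁)
    (hf : IsTranscendentalSelfMapCStar f) (hp : 0 < p) {χ : ℂ → ℝ}
    (hχ : IsRingCutoff K[X₀] K[X₁] χ) {β : ℂ} (hβ : β ∉ V) :
    smoothWinding (fun z => (χ z : ℂ)) f^[p] β = 0 := by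
  have hS := h.tsupport_fderiv_subset hχ
  have hS0 := hS.trans h.subset_compl_zero
  rw [h.mem_iff, not_not] at hβ
  have hnot := fun z hz => by simpa using h.iterate_notMem 1 (z := z) (hS hz)
  rcases hβ with hβ | hβ
  · rw [smoothWinding_eq_of_mem hχ.contDiff_ofReal hχ.hasCompactSupport_ofReal
      isOpen_compl_singleton hS0 (hf.differentiableOn_iterate p) h.isPreconnected₀
      (fun z hz => (hnot z hz).1) hβ h.zero_mem, h.smoothWinding_zero_eq_zero hf hp hχ]
  · exact smoothWinding_eq_zero_of_mem hχ.contDiff_ofReal hχ.hasCompactSupport_ofReal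
      isOpen_compl_singleton hS0 (hf.differentiableOn_iterate p) h.isPreconnected₁
      (fun z hz => (hnot z hz).2) h.infty_mem hβ

theorem exists_frontier_mem (h : IsEscapingRing f p V X₀ X₁) : ∃ b ∈ frontier V, b ∈ K[X₁] := by
  by_contra! hcon
  have e : K[X₁]ᶜ = closure V ∪ K[X₀] := by
    refine Subset.antisymm (fun z hz => ?_)
      (union_subset (fun z hz h1 => ?_) h.disjoint_preimage)
    · by_cases h0 : z ∈ K[X₀]
      · exact Or.inr h0
      · exact Or.inl (subset_closure (h.mem_iff.mpr fun h' => h'.elim h0 hz))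
    · refine hcon z ⟨hz, fun hi => ?_⟩ h1
      exact h.mem_iff.mp (interior_subset hi) (Or.inr h1)
  have hcpt : IsCompact (K[X₁]ᶜ) := e ▸ h.isBounded.isCompact_closure.union h.isCompact_preimage
  have hclopen : IsClopen (K[X₁]ᶜ) := ⟨hcpt.isClosed, h.isClosed_preimage.isOpen_compl⟩
  have := hclopen.eq_univ ⟨0, h.disjoint_preimage h.zero_mem⟩
  exact noncompact_univ ℂ (this ▸ hcpt)

theorem not_isEscapingRing (hf : IsTranscendentalSelfMapCStar f) (hp : 0 < p) :
    ¬ IsEscapingRing f p V X₀ X₁ := by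
  intro h
  obtain ⟨b, hbV, hb1⟩ := h.exists_frontier_mem
  have h0X : (0 : ℂ) ∈ K[X₀] := h.zero_mem
  have hb0 : b ≠ 0 := fun e => h.disjoint_preimage (e ▸ h0X) hb1
  have hβ := h.frontier_notMem b hbV hb0
  obtain ⟨χ₁, hχ₁, -⟩ := exists_isRingCutoff h.isCompact_preimage h.isClosed_preimage
    Subset.rfl h.disjoint_preimage
  have ho : IsOpen ({0}ᶜ : Set ℂ) := isOpen_compl_singleton
  have hF := hf.differentiableOn_iterate p
  have hS1 := h.tsupport_fderiv_subset hχ₁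
  have hS10 := hS1.trans h.subset_compl_zero
  have hw1 := h.smoothWinding_notMem_eq_zero hf hp hχ₁ hβ
  have hFS1 : ∀ z ∈ tsupport (fderiv ℝ fun z => (χ₁ z : ℂ)), f^[p] z ≠ f^[p] b :=
    fun z hz e => hβ (e ▸ h.mapsTo (hS1 hz))
  have himg : IsCompact (f^[p] '' tsupport (fderiv ℝ fun z => (χ₁ z : ℂ))) :=
    hχ₁.isCompact_tsupport_fderiv.image_of_continuousOn (hF.continuousOn.mono hS10)
  have hev := (eventually_smoothWinding_eq hχ₁.contDiff_ofReal hχ₁.hasCompactSupport_ofReal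
    ho hS10 hF hFS1).and (himg.isClosed.isOpen_compl.mem_nhds
      (show f^[p] b ∈ _ from fun ⟨z, hz, e⟩ => hFS1 z hz e))
  have hev' := ((hf.continuousAt_iterate p hb0).eventually hev).and
    ((isClosed_tsupport χ₁).isOpen_compl.mem_nhds fun hb => hχ₁.tsupport_subset hb hb1)
  obtain ⟨z₀, hz₀V, ⟨hwz, hz₀img⟩, hz₀supp⟩ :=
    ((mem_closure_iff_frequently.mp hbV.1).and_eventually hev').exists
  rw [hw1] at hwz
  set T := closure V \ interior {z | χ₁ z = 1} with hT
  have hTc : IsCompact T := h.isBounded.isCompact_closure.diff isOpen_interior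
  have hT0 : T ⊆ {0}ᶜ := by
    rintro z hz rfl
    exact hz.2 (mem_interior_iff_mem_nhds.mpr (hχ₁.eq_one.filter_mono (nhds_le_nhdsSet h0X)))
  obtain ⟨c, hc, hcT⟩ := hTc.exists_pos_forall_lt (hF.continuousOn.mono hT0).norm
    fun z hz => norm_pos_iff.mpr (hf.iterate_ne_zero p (hT0 hz))
  obtain ⟨n, hn⟩ := h.exists_iterate_small hp (singleton_subset_iff.mpr hz₀V)
    isCompact_singleton hc
  obtain ⟨Q, hQV, hQc, hQconn, hq₀, hq'⟩ := h.isOpen.exists_isCompact_isPreconnected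
    h.isPreconnected (h.mapsTo hz₀V) (h.mapsTo_iterate n hz₀V)
  have hEc : IsCompact (T ∩ f^[p] ⁻¹' Q) :=
    hTc.of_isClosed_subset ((hF.continuousOn.mono hT0).preimage_isClosed_of_isClosed
      hTc.isClosed hQc.isClosed) inter_subset_left
  have hEV : T ∩ f^[p] ⁻¹' Q ⊆ V := by
    rintro z ⟨hzT, hzQ⟩
    by_contra hzV
    exact h.frontier_notMem z ⟨hzT.1, fun hi => hzV (interior_subset hi)⟩ (hT0 hzT) (hQV hzQ)
  have hVK : V ⊆ K[X₁]ᶜ := fun z hz h1 => h.mem_iff.mp hz (Or.inr h1)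
  obtain ⟨χ₂, hχ₂, hχ₂one⟩ := exists_isRingCutoff
    (K := K[X₀] ∪ tsupport χ₁ ∪ {z₀} ∪ (T ∩ f^[p] ⁻¹' Q))
    (((h.isCompact_preimage.union hχ₁.hasCompactSupport.isCompact).union
      isCompact_singleton).union hEc) h.isClosed_preimage
    (subset_union_left.trans <| subset_union_left.trans subset_union_left)
    (union_subset (union_subset (union_subset h.disjoint_preimage hχ₁.tsupport_subset)
      (singleton_subset_iff.mpr (hVK hz₀V))) (hEV.trans hVK))
  have hone : ∀ z ∈ K[X₀] ∪ tsupport χ₁ ∪ {z₀} ∪ (T ∩ f^[p] ⁻¹' Q), ∀ᶠ w in 𝓝 z, χ₂ w = 1 :=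
    fun z hz => hχ₂one.filter_mono (nhds_le_nhdsSet hz)
  have hS2 := h.tsupport_fderiv_subset hχ₂
  have hS20 := hS2.trans h.subset_compl_zero
  have hS2T : tsupport (fderiv ℝ fun z => (χ₂ z : ℂ)) ⊆ T := by
    refine fun z hz => ⟨subset_closure (hS2 hz), fun hi => ?_⟩
    refine notMem_tsupport_fderiv_of_eventually_one (hone z (Or.inl (Or.inl (Or.inr ?_)))) hz
    refine subset_tsupport _ ?_
    have : z ∈ {z | χ₁ z = 1} := interior_subset hi
    rw [mem_ofPred_eq] at this
    simp [this]
  have hS2Q : ∀ z ∈ tsupport (fderiv ℝ fun z => (χ₂ z : ℂ)), f^[p] z ∉ Q := fun z hz hq =>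
    notMem_tsupport_fderiv_of_eventually_one (hone z (Or.inr ⟨hS2T hz, hq⟩)) hz
  have hw2 : smoothWinding (fun z => (χ₂ z : ℂ)) f^[p] (f^[p] z₀) = 0 := by
    rw [smoothWinding_eq_of_mem hχ₂.contDiff_ofReal hχ₂.hasCompactSupport_ofReal ho hS20 hF
      (hQconn.image _ continuous_coe.continuousOn)
      (fun z hz => by simpa using hS2Q z hz) (mem_image_of_mem _ hq₀) (mem_image_of_mem _ hq'),
      smoothWinding_eq_of_mem hχ₂.contDiff_ofReal hχ₂.hasCompactSupport_ofReal ho hS20 hF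
      ((convex_ball (0 : ℂ) c).isPreconnected.image _ continuous_coe.continuousOn)
      (fun z hz => by simpa using (hcT z (hS2T hz)).le)
      (mem_image_of_mem _ (by simpa using hn z₀ rfl))
      (mem_image_of_mem _ (Metric.mem_ball_self hc)),
      h.smoothWinding_zero_eq_zero hf hp hχ₂]
  have hq₀ne : ∀ z ∈ tsupport (fderiv ℝ fun z => (χ₁ z : ℂ)) ∪
      tsupport (fderiv ℝ fun z => (χ₂ z : ℂ)), f^[p] z ≠ f^[p] z₀ := by
    rintro z (hz | hz) e
    · exact hz₀img ⟨z, hz, e⟩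
    · exact hS2Q z hz (e ▸ hq₀)
  have hO : IsOpen ({0}ᶜ ∩ f^[p] ⁻¹' {f^[p] z₀}ᶜ) :=
    hF.continuousOn.isOpen_inter_preimage ho isOpen_compl_singleton
  have hsub := smoothWinding_sub_left hχ₁.contDiff hχ₂.contDiff hχ₁.hasCompactSupport
    hχ₂.hasCompactSupport hO (fun z hz => ⟨hS10 hz, hq₀ne z (Or.inl hz)⟩)
    (fun z hz => ⟨hS20 hz, hq₀ne z (Or.inr hz)⟩) (hF.mono inter_subset_left) fun z hz => hz.2
  rw [hwz, hw2, sub_zero] at hsub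
  obtain ⟨δ, hδ, hδS⟩ := (hχ₁.isCompact_tsupport_fderiv.union
    hχ₂.isCompact_tsupport_fderiv).exists_pos_forall_lt (g := fun z => ‖f^[p] z - f^[p] z₀‖)
    ((hF.continuousOn.mono (union_subset hS10 hS20)).sub continuousOn_const).norm
    fun z hz => norm_pos_iff.mpr (sub_ne_zero.mpr (hq₀ne z hz))
  refine smoothWinding_ne_zero (χ := fun z => χ₂ z - χ₁ z) (z₀ := z₀)
    (hχ₂.contDiff.sub hχ₁.contDiff) (hχ₂.hasCompactSupport.sub hχ₁.hasCompactSupport)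
    (fun z => ?_) ho ?_ hF ?_
    (hf.not_eventually_deriv_iterate_eq_zero hp (h.subset_compl_zero hz₀V)) hδ
    (fun z hz => (hδS z ?_).le) hsub
  · by_cases hz : z ∈ tsupport χ₁
    · rw [(hone z (Or.inl (Or.inl (Or.inr hz)))).self_of_nhds]
      exact sub_nonneg.mpr (hχ₁.mem_Icc z).2
    · rw [image_eq_zero_of_notMem_tsupport hz, sub_zero]
      exact (hχ₂.mem_Icc z).1
  · rintro z hz rfl
    refine notMem_tsupport_iff_eventuallyEq.mpr ?_ hz
    filter_upwards [hone 0 (Or.inl (Or.inl (Or.inl h0X))),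
      hχ₁.eq_one.filter_mono (nhds_le_nhdsSet h0X)] with w h2 h1
    simp [h1, h2]
  · simp [image_eq_zero_of_notMem_tsupport hz₀supp,
      (hone z₀ (Or.inl (Or.inr rfl))).self_of_nhds]
  · have e : (fderiv ℝ fun z => ((χ₂ z - χ₁ z : ℝ) : ℂ)) =
        (fderiv ℝ fun z => (χ₂ z : ℂ)) - fderiv ℝ fun z => (χ₁ z : ℂ) := by
      ext1 w
      simp only [ofReal_sub, Pi.sub_apply]
      exact fderiv_fun_sub (hχ₂.contDiff_ofReal.differentiable (by norm_num) w)
        (hχ₁.contDiff_ofReal.differentiable (by norm_num) w)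
    rw [e] at hz
    have := closure_mono (support_sub _ _) hz
    rw [closure_union] at this
    exact this.symm

end IsEscapingRing

theorem exists_eq_mul_exp_of_ne_zero {h : ℂ → ℂ} {c : ℂ} {R : ℝ} (hR : 0 < R)
    (hd : DifferentiableOn ℂ h (Metric.ball c R)) (h0 : ∀ z ∈ Metric.ball c R, h z ≠ 0) :
    ∃ F : ℂ → ℂ, DifferentiableOn ℂ F (Metric.ball c R) ∧ F c = 0 ∧
      ∀ z ∈ Metric.ball c R, h z = h c * Complex.exp (F z) := by
  have ho : IsOpen (Metric.ball c R) := Metric.isOpen_ball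
  obtain ⟨P, hP⟩ := ((hd.deriv ho).div hd h0).isExactOn_ball
  have hder : ∀ z ∈ Metric.ball c R,
      HasDerivAt (fun z => h z * Complex.exp (-(P z - P c))) 0 z := fun z hz => by
    have hh := (hd.differentiableAt (ho.mem_nhds hz)).hasDerivAt.mul
      (((hP z hz).sub_const (P c)).neg.cexp)
    refine hh.congr_deriv ?_
    have := h0 z hz
    simp only [Pi.div_apply]
    field_simp
    ring
  have hconst := fun z hz => ho.is_const_of_deriv_eq_zero
    (convex_ball c R).isPreconnected
    (fun z hz => (hder z hz).differentiableAt.differentiableWithinAt)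
    (fun z hz => (hder z hz).deriv) (x := z) (y := c) hz (Metric.mem_ball_self hR)
  refine ⟨fun z => P z - P c, fun z hz => ((hP z hz).differentiableAt.sub_const
    _).differentiableWithinAt, sub_self _, fun z hz => ?_⟩
  have := hconst z hz
  simp only [sub_self, neg_zero, Complex.exp_zero, mul_one] at this
  rw [← this, mul_assoc, ← Complex.exp_add]
  simp

/-- A form of Harnack's inequality. -/
theorem norm_pow_three_le_of_norm_lt_one {h : ℂ → ℂ} {c : ℂ} {R : ℝ}
    (hd : DifferentiableOn ℂ h (Metric.ball c R)) (h0 : ∀ z ∈ Metric.ball c R, h z ≠ 0)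
    (h1 : ∀ z ∈ Metric.ball c R, ‖h z‖ < 1) {z : ℂ} (hz : ‖z - c‖ < R / 2) :
    ‖h c‖ ^ 3 ≤ ‖h z‖ := by
  have hR : 0 < R := by linarith [norm_nonneg (z - c)]
  obtain ⟨F, hF, hFc, hFe⟩ := exists_eq_mul_exp_of_ne_zero hR hd h0
  have hc := Metric.mem_ball_self (x := c) hR
  have hcpos : 0 < ‖h c‖ := norm_pos_iff.mpr (h0 c hc)
  have hM : 0 < -Real.log ‖h c‖ := neg_pos.mpr (Real.log_neg hcpos (h1 c hc))
  have hshift : ∀ w ∈ Metric.ball (0 : ℂ) R, c + w ∈ Metric.ball c R := fun w hw => by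
    simpa using hw
  have hzR : z - c ∈ Metric.ball (0 : ℂ) R := by simpa using hz.trans (half_lt_self hR)
  have hzc : c + (z - c) = z := by ring
  have hbc := borelCaratheodory_zero (f := fun w => F (c + w)) (R := R) hM
    (hF.comp (by fun_prop) hshift) (fun w hw => ?_) hR hzR (by simpa using hFc)
  · have hzb : z ∈ Metric.ball c R := hzc ▸ hshift _ hzR
    rw [hzc] at hbc
    have h2 : 2 * -Real.log ‖h c‖ * ‖z - c‖ / (R - ‖z - c‖) ≤ -Real.log ‖h c‖ * 2 := by
      rw [div_le_iff₀ (by linarith)]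
      nlinarith
    have h3 : Real.log ‖h c‖ * 2 ≤ (F z).re := by
      have := (abs_le.mp (abs_re_le_norm (F z))).1
      linarith
    rw [hFe z hzb, norm_mul, Complex.norm_exp, pow_succ']
    gcongr
    rw [← Real.exp_log (pow_pos hcpos 2), Real.log_pow]
    gcongr
    push_cast
    linarith
  · have hlt := h1 _ (hshift w hw)
    rw [hFe _ (hshift w hw), norm_mul, Complex.norm_exp, ← Real.exp_log hcpos, ← Real.exp_add,
      Real.exp_lt_one_iff] at hlt
    simp only [mem_ofPred_eq]
    linarith

theorem chordalDist_comm (z w : ℂ) : chordalDist z w = chordalDist w z := by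
  rw [chordalDist, chordalDist, norm_sub_rev, mul_comm]

theorem chordalDist_le (z w : ℂ) : chordalDist z w ≤ ‖z - w‖ := by
  refine div_le_self (norm_nonneg _) (Real.one_le_sqrt.mpr ?_)
  nlinarith [sq_nonneg ‖z‖, sq_nonneg ‖w‖, mul_nonneg (sq_nonneg ‖z‖) (sq_nonneg ‖w‖)]

theorem norm_sub_le_chordalDist {z w : ℂ} {M : ℝ} (hz : ‖z‖ ≤ M) (hw : ‖w‖ ≤ M) :
    ‖z - w‖ ≤ (1 + M ^ 2) * chordalDist z w := by
  have hs : Real.sqrt ((1 + ‖z‖ ^ 2) * (1 + ‖w‖ ^ 2)) ≤ 1 + M ^ 2 := by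
    rw [Real.sqrt_le_left (by positivity), sq (1 + M ^ 2)]
    gcongr
  have hpos : 0 < Real.sqrt ((1 + ‖z‖ ^ 2) * (1 + ‖w‖ ^ 2)) := by positivity
  rw [chordalDist, ← mul_div_assoc, le_div_iff₀ hpos, mul_comm]
  gcongr

theorem chordalDist_inv {z w : ℂ} (hz : z ≠ 0) (hw : w ≠ 0) :
    chordalDist z⁻¹ w⁻¹ = chordalDist z w := by
  have hz' := norm_pos_iff.mpr hz
  have hw' := norm_pos_iff.mpr hw
  have e1 : z⁻¹ - w⁻¹ = (w - z) / (z * w) := by field_simp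
  have e2 : (1 + ‖z⁻¹‖ ^ 2) * (1 + ‖w⁻¹‖ ^ 2) =
      ((1 + ‖z‖ ^ 2) * (1 + ‖w‖ ^ 2)) / (‖z‖ * ‖w‖) ^ 2 := by
    rw [norm_inv, norm_inv]
    field_simp
    ring
  rw [chordalDist, chordalDist, e1, e2, Real.sqrt_div (by positivity),
    Real.sqrt_sq (by positivity), norm_div, norm_mul, norm_sub_rev,
    div_div_div_cancel_right₀ (by positivity)]

/-- Points chordally close to a small point are small. -/
theorem exists_chordalDist_small {ε : ℝ} (hε : 0 < ε) :
    ∃ ε' > 0, ∃ η > 0, ∀ X Y : ℂ, ‖X‖ < ε' → chordalDist X Y < η → ‖Y‖ < ε := by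
  refine ⟨min 1 (ε / 2), by positivity, ε / (2 * (2 * (1 + ε))), by positivity,
    fun X Y hX hXY => ?_⟩
  by_contra! hY
  have hX1 : ‖X‖ < 1 := hX.trans_le (min_le_left _ _)
  have hX2 : ‖X‖ < ε / 2 := hX.trans_le (min_le_right _ _)
  have hs : Real.sqrt ((1 + ‖X‖ ^ 2) * (1 + ‖Y‖ ^ 2)) ≤ 2 * (1 + ‖Y‖) := by
    rw [Real.sqrt_le_left (by positivity), mul_pow]
    have := norm_nonneg X
    have := norm_nonneg Y
    gcongr <;> nlinarith
  have h1 : ‖Y‖ / 2 ≤ ‖X - Y‖ := by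
    have := norm_sub_norm_le Y X
    rw [norm_sub_rev] at this
    linarith
  have h2 : ‖Y‖ / 2 / (2 * (1 + ‖Y‖)) ≤ chordalDist X Y := by
    rw [chordalDist]
    gcongr
  refine absurd (h2.trans_lt hXY) (not_lt.mpr ?_)
  rw [div_div, div_le_div_iff₀ (by positivity) (by positivity)]
  nlinarith

theorem exists_chordalDist_large {ε : ℝ} (hε : 0 < ε) :
    ∃ ε' > 0, ∃ η > 0, ∀ X Y : ℂ, X ≠ 0 → Y ≠ 0 → 1 / ε' < ‖X‖ → chordalDist X Y < η →
      1 / ε < ‖Y‖ := by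
  obtain ⟨ε', hε', η, hη, h⟩ := exists_chordalDist_small hε
  refine ⟨ε', hε', η, hη, fun X Y hX hY h1 h2 => ?_⟩
  have hY' := norm_pos_iff.mpr hY
  have := h X⁻¹ Y⁻¹ (by rw [norm_inv]; exact inv_lt_of_inv_lt₀ hε' (by rwa [← one_div]))
    (by rwa [chordalDist_inv hX hY])
  rw [norm_inv] at this
  rw [one_div]
  exact inv_lt_of_inv_lt₀ hY' this

theorem exists_chordalDist_escape {ε : ℝ} (hε : 0 < ε) :
    ∃ ε' > 0, ∃ η > 0, ∀ X Y : ℂ, X ≠ 0 → Y ≠ 0 → (‖X‖ < ε' ∨ 1 / ε' < ‖X‖) →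
      chordalDist X Y < η → ‖Y‖ < ε ∨ 1 / ε < ‖Y‖ := by
  obtain ⟨a, ha, η, hη, h⟩ := exists_chordalDist_small hε
  obtain ⟨a', ha', η', hη', h'⟩ := exists_chordalDist_large hε
  refine ⟨min a a', lt_min ha ha', min η η', lt_min hη hη', fun X Y hX hY hX' hXY => ?_⟩
  rcases hX' with hX' | hX'
  · exact Or.inl (h X Y (hX'.trans_le (min_le_left _ _)) (hXY.trans_le (min_le_left _ _)))
  · refine Or.inr (h' X Y hX hY (lt_of_le_of_lt ?_ hX') (hXY.trans_le (min_le_right _ _)))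
    gcongr
    exact min_le_right _ _

/-- Equicontinuity of the iterates at a point, for the Euclidean metric on the source and the
chordal metric on the target. -/
def ChordalEquicontinuousAt (f : ℂ → ℂ) (z : ℂ) : Prop :=
  ∀ ε > 0, ∀ᶠ w in 𝓝 z, ∀ n : ℕ, chordalDist (f^[n] z) (f^[n] w) < ε

theorem mem_fatouSet_iff {f : ℂ → ℂ} {z : ℂ} :
    z ∈ FatouSet f ↔ z ≠ 0 ∧ ∀ᶠ w in 𝓝 z, ChordalEquicontinuousAt f w := by
  constructor
  · rintro ⟨hz, U, hU, hzU, -, h⟩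
    refine ⟨hz, ?_⟩
    filter_upwards [hU.mem_nhds hzU] with w hw ε hε
    obtain ⟨δ, hδ, hδ'⟩ := h w hw ε hε
    filter_upwards [hU.mem_nhds hw, Metric.ball_mem_nhds w hδ] with w' hw' hd
    refine hδ' w' hw' ((chordalDist_le _ _).trans_lt ?_)
    rwa [Metric.mem_ball, dist_eq_norm, norm_sub_rev] at hd
  · rintro ⟨hz, h⟩
    obtain ⟨r, hr, hball⟩ := Metric.eventually_nhds_iff_ball.mp
      (h.and (isOpen_ne.mem_nhds hz))
    refine ⟨hz, Metric.ball z r, Metric.isOpen_ball, Metric.mem_ball_self hr,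
      fun w hw => (hball w hw).2, fun w hw ε hε => ?_⟩
    obtain ⟨δ, hδ, hδ'⟩ := Metric.eventually_nhds_iff_ball.mp ((hball w hw).1 ε hε)
    have hM : ∀ w ∈ Metric.ball z r, ‖w‖ ≤ ‖z‖ + r := fun w hw => by
      have := norm_sub_norm_le w z
      rw [Metric.mem_ball, dist_eq_norm] at hw
      linarith
    refine ⟨δ / (1 + (‖z‖ + r) ^ 2), by positivity, fun w' hw' hd n => hδ' w' ?_ n⟩
    rw [lt_div_iff₀' (by positivity)] at hd
    rw [Metric.mem_ball, dist_comm, dist_eq_norm]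
    exact (norm_sub_le_chordalDist (hM w hw) (hM w' hw')).trans_lt hd

theorem isOpen_fatouSet {f : ℂ → ℂ} : IsOpen (FatouSet f) := by
  rw [isOpen_iff_mem_nhds]
  intro z hz
  obtain ⟨hz0, h⟩ := mem_fatouSet_iff.mp hz
  filter_upwards [eventually_eventually_nhds.mpr h, isOpen_ne.mem_nhds hz0] with w h1 h2
  exact mem_fatouSet_iff.mpr ⟨h2, h1⟩

theorem ChordalEquicontinuousAt.of_mem_fatouSet {f : ℂ → ℂ} {z : ℂ} (h : z ∈ FatouSet f) :
    ChordalEquicontinuousAt f z :=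
  (mem_fatouSet_iff.mp h).2.self_of_nhds

theorem IsTranscendentalSelfMapCStar.mem_fatouSet_of_iterate {f : ℂ → ℂ}
    (hf : IsTranscendentalSelfMapCStar f) {z : ℂ} (hz : z ≠ 0) {n : ℕ}
    (h : f^[n] z ∈ FatouSet f) : z ∈ FatouSet f := by
  induction n generalizing z with
  | zero => exact h
  | succ n ih =>
    have hfz := mem_fatouSet_iff.mp (ih (hf.ne_zero hz) h)
    refine mem_fatouSet_iff.mpr ⟨hz, ?_⟩
    filter_upwards [(hf.differentiableAt hz).continuousAt.eventually hfz.2, isOpen_ne.mem_nhds hz]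
      with w hw hw0 ε hε
    filter_upwards [(hf.differentiableAt hw0).continuousAt.eventually (hw ε hε),
      Metric.ball_mem_nhds w hε] with w' hw' hb n
    cases n with
    | zero =>
      refine (chordalDist_le _ _).trans_lt ?_
      rwa [Metric.mem_ball, dist_comm, dist_eq_norm] at hb
    | succ n => exact hw' n

theorem IsFatouComponent.isOpen {f : ℂ → ℂ} {U : Set ℂ} (h : IsFatouComponent f U) :
    IsOpen U := by
  obtain ⟨z, -, rfl⟩ := h
  exact isOpen_fatouSet.connectedComponentIn

theorem IsFatouComponent.subset {f : ℂ → ℂ} {U : Set ℂ} (h : IsFatouComponent f U) :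
    U ⊆ FatouSet f := by
  obtain ⟨z, -, rfl⟩ := h
  exact connectedComponentIn_subset _ _

theorem IsFatouComponent.isPreconnected {f : ℂ → ℂ} {U : Set ℂ} (h : IsFatouComponent f U) :
    IsPreconnected U := by
  obtain ⟨z, -, rfl⟩ := h
  exact isPreconnected_connectedComponentIn

theorem IsFatouComponent.nonempty {f : ℂ → ℂ} {U : Set ℂ} (h : IsFatouComponent f U) :
    U.Nonempty := by
  obtain ⟨z, hz, rfl⟩ := h
  exact ⟨z, mem_connectedComponentIn hz⟩

theorem IsFatouComponent.notMem_fatouSet_of_mem_frontier {f : ℂ → ℂ} {U : Set ℂ}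
    (h : IsFatouComponent f U) {w : ℂ} (hw : w ∈ frontier U) : w ∉ FatouSet f := by
  intro hwF
  have hwU : w ∉ U := fun hwU => by
    rw [h.isOpen.frontier_eq] at hw
    exact hw.2 hwU
  obtain ⟨z, hz, rfl⟩ := h
  obtain ⟨y, hy, hyz⟩ := mem_closure_iff.mp hw.1 _ isOpen_fatouSet.connectedComponentIn
    (mem_connectedComponentIn hwF)
  refine hwU ?_
  rw [connectedComponentIn_eq hyz, ← connectedComponentIn_eq hy]
  exact mem_connectedComponentIn hwF

theorem escapingSet_iterate_mem {f : ℂ → ℂ} (hf : IsTranscendentalSelfMapCStar f) {z : ℂ}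
    (n : ℕ) (hz : z ≠ 0) : f^[n] z ∈ escapingSet f ↔ z ∈ escapingSet f := by
  constructor
  · rintro ⟨-, h⟩
    refine ⟨hz, fun ε hε => ?_⟩
    obtain ⟨N, hN⟩ := h ε hε
    refine ⟨N + n, fun k hk => ?_⟩
    obtain ⟨j, rfl⟩ := Nat.exists_eq_add_of_le hk
    have := hN (N + j) (by omega)
    rwa [← iterate_add_apply, show N + j + n = N + n + j by omega] at this
  · rintro ⟨-, h⟩
    refine ⟨hf.iterate_ne_zero n hz, fun ε hε => ?_⟩
    obtain ⟨N, hN⟩ := h ε hε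
    refine ⟨N, fun k hk => ?_⟩
    rw [← iterate_add_apply]
    exact hN _ (by omega)

/-- Escape is locally uniform at points of equicontinuity. -/
theorem ChordalEquicontinuousAt.exists_forall_escape {f : ℂ → ℂ}
    (hf : IsTranscendentalSelfMapCStar f) {w : ℂ} (hw : ChordalEquicontinuousAt f w)
    (hwI : w ∈ escapingSet f) {ε : ℝ} (hε : 0 < ε) :
    ∃ N : ℕ, ∀ᶠ z in 𝓝 w, ∀ n ≥ N, ‖f^[n] z‖ < ε ∨ 1 / ε < ‖f^[n] z‖ := by
  obtain ⟨ε', hε', η, hη, h⟩ := exists_chordalDist_escape hε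
  obtain ⟨N, hN⟩ := hwI.2 ε' hε'
  refine ⟨N, ?_⟩
  filter_upwards [hw η hη, isOpen_ne.mem_nhds hwI.1] with z hz hz0 n hn
  exact h _ _ (hf.iterate_ne_zero n hwI.1) (hf.iterate_ne_zero n hz0) (hN n hn) (hz n)

theorem exists_forall_escape_of_isCompact {f : ℂ → ℂ} (hf : IsTranscendentalSelfMapCStar f)
    {C : Set ℂ} (hC : IsCompact C) (hCF : ∀ w ∈ C, ChordalEquicontinuousAt f w)
    (hCI : C ⊆ escapingSet f) {ε : ℝ} (hε : 0 < ε) :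
    ∃ N : ℕ, ∀ n ≥ N, ∀ z ∈ C, ‖f^[n] z‖ < ε ∨ 1 / ε < ‖f^[n] z‖ := by
  refine hC.induction_on (p := fun C => ∃ N : ℕ, ∀ n ≥ N, ∀ z ∈ C,
    ‖f^[n] z‖ < ε ∨ 1 / ε < ‖f^[n] z‖) ⟨0, by simp⟩ ?_ ?_ ?_
  · rintro s t hst ⟨N, hN⟩
    exact ⟨N, fun n hn z hz => hN n hn z (hst hz)⟩
  · rintro s t ⟨N, hN⟩ ⟨M, hM⟩
    refine ⟨max N M, fun n hn z hz => ?_⟩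
    rcases hz with hz | hz
    · exact hN n (le_of_max_le_left hn) z hz
    · exact hM n (le_of_max_le_right hn) z hz
  · intro w hw
    obtain ⟨N, hN⟩ := (hCF w hw).exists_forall_escape hf (hCI hw) hε
    exact ⟨_, mem_nhdsWithin_of_mem_nhds hN, N, fun n hn z hz => hz n hn⟩

/-- The two ways to be far from the unit scale cannot both occur on a connected set. -/
theorem IsPreconnected.forall_norm_lt_or_forall_lt_norm {C : Set ℂ} (hC : IsPreconnected C)
    {g : ℂ → ℂ} (hg : ContinuousOn g C) {ε : ℝ} (hε : 0 < ε) (hε1 : ε ≤ 1)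
    (h : ∀ z ∈ C, ‖g z‖ < ε ∨ 1 / ε < ‖g z‖) :
    (∀ z ∈ C, ‖g z‖ < ε) ∨ ∀ z ∈ C, 1 / ε < ‖g z‖ := by
  have h1 : 1 ≤ 1 / ε := (one_le_div hε).mpr hε1
  have hord : OrdConnected ((fun z => ‖g z‖) '' C) :=
    (hC.image _ hg.norm).ordConnected
  by_contra! hcon
  obtain ⟨⟨a, ha, ha'⟩, b, hb, hb'⟩ := hcon
  have ha2 := (h a ha).resolve_left ha'.not_gt
  have hb2 := (h b hb).resolve_right hb'.not_gt
  obtain ⟨c, hc, hc'⟩ := hord.out (mem_image_of_mem _ hb) (mem_image_of_mem _ ha)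
    (⟨(hb2.trans_le hε1).le, h1.trans ha2.le⟩ : (1 : ℝ) ∈ Icc _ _)
  simp only at hc'
  rcases h c hc with h' | h' <;> linarith

/-- The escaping set is relatively open in the domain of equicontinuity. -/
theorem eventually_mem_escapingSet {f : ℂ → ℂ} (hf : IsTranscendentalSelfMapCStar f) {w : ℂ}
    (hw : ChordalEquicontinuousAt f w) (hwI : w ∈ escapingSet f) :
    ∀ᶠ z in 𝓝 w, z ∈ escapingSet f := by
  obtain ⟨N, hN⟩ := hw.exists_forall_escape hf hwI one_pos
  obtain ⟨r, hr, hball⟩ := Metric.eventually_nhds_iff_ball.mp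
    (hN.and (isOpen_ne.mem_nhds hwI.1))
  filter_upwards [Metric.ball_mem_nhds w (show 0 < r / 4 by positivity)] with c hc
  rw [Metric.mem_ball, dist_eq_norm] at hc
  have hsub : Metric.ball c (r / 2) ⊆ Metric.ball w r := by
    intro z hz
    rw [Metric.mem_ball] at hz ⊢
    have := dist_triangle z c w
    rw [dist_eq_norm c w] at this
    linarith
  have hne : ∀ z ∈ Metric.ball c (r / 2), z ≠ 0 := fun z hz => (hball z (hsub hz)).2
  have hdiff := fun n => (hf.differentiableOn_iterate n).mono hne
  have hwc : ‖w - c‖ < r / 2 / 2 := by rw [norm_sub_rev]; linarith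
  have hcc : c ∈ Metric.ball c (r / 2) := Metric.mem_ball_self (by positivity)
  refine ⟨hne c hcc, fun ε hε => ?_⟩
  obtain ⟨M, hM⟩ := hwI.2 (min ε 1 ^ 3) (by positivity)
  have hδ : 0 < min ε 1 := by positivity
  have hδ1 : min ε 1 ≤ 1 := min_le_right _ _
  have hδ3 : min ε 1 ^ 3 ≤ 1 := pow_le_one₀ hδ.le hδ1
  have hδ3' : 1 ≤ 1 / min ε 1 ^ 3 := (one_le_div (by positivity)).mpr hδ3
  refine ⟨max N M, fun n hn => ?_⟩
  have hwn := hM n (le_of_max_le_right hn)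
  have hesc : ∀ z ∈ Metric.ball c (r / 2), ‖f^[n] z‖ < 1 ∨ 1 / 1 < ‖f^[n] z‖ :=
    fun z hz => (hball z (hsub hz)).1 n (le_of_max_le_left hn)
  have hwb : w ∈ Metric.ball c (r / 2) := by
    rw [Metric.mem_ball, dist_eq_norm]; linarith
  have hn0 : ∀ z ∈ Metric.ball c (r / 2), f^[n] z ≠ 0 := fun z hz =>
    hf.iterate_ne_zero n (hne z hz)
  rcases (convex_ball c (r / 2)).isPreconnected.forall_norm_lt_or_forall_lt_norm
    (hdiff n).continuousOn one_pos le_rfl hesc with h | h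
  · left
    have h1 := norm_pow_three_le_of_norm_lt_one (hdiff n) hn0 h hwc
    have h2 : ‖f^[n] w‖ < min ε 1 ^ 3 := hwn.resolve_right fun h' => by
      have := h w hwb
      linarith
    exact (lt_of_pow_lt_pow_left₀ 3 hδ.le (h1.trans_lt h2)).trans_le (min_le_left _ _)
  · right
    have h1 := norm_pow_three_le_of_norm_lt_one (h := fun z => (f^[n] z)⁻¹) ((hdiff n).inv hn0)
      (fun z hz => inv_ne_zero (hn0 z hz)) (fun z hz => ?_) hwc
    · have h2 : 1 / min ε 1 ^ 3 < ‖f^[n] w‖ := hwn.resolve_left fun h' => by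
        have := h w hwb
        rw [div_one] at this
        linarith
      simp only [norm_inv] at h1
      rw [one_div] at h2
      have h3 : ‖f^[n] c‖⁻¹ < min ε 1 := lt_of_pow_lt_pow_left₀ 3 hδ.le
        (h1.trans_lt (inv_lt_of_inv_lt₀ (by positivity) h2))
      rw [one_div]
      exact inv_lt_of_inv_lt₀ (norm_pos_iff.mpr (hn0 c hcc)) (h3.trans_le (min_le_left _ _))
    · rw [norm_inv]
      exact inv_lt_one_of_one_lt₀ (by simpa using h z hz)

theorem mem_escapingSet_of_frequently {f : ℂ → ℂ} (hf : IsTranscendentalSelfMapCStar f) {w : ℂ}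
    (hw0 : w ≠ 0) (hw : ChordalEquicontinuousAt f w) (hwI : ∃ᶠ z in 𝓝 w, z ∈ escapingSet f) :
    w ∈ escapingSet f := by
  refine ⟨hw0, fun ε hε => ?_⟩
  obtain ⟨ε', hε', η, hη, h⟩ := exists_chordalDist_escape hε
  obtain ⟨z, hzI, hz⟩ := (hwI.and_eventually (hw η hη)).exists
  obtain ⟨N, hN⟩ := hzI.2 ε' hε'
  refine ⟨N, fun n hn => h _ _ (hf.iterate_ne_zero n hzI.1) (hf.iterate_ne_zero n hw0) (hN n hn) ?_⟩
  rw [chordalDist_comm]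
  exact hz n

/-- A connected set of equicontinuity meeting the escaping set lies in it. -/
theorem IsPreconnected.subset_escapingSet {f : ℂ → ℂ} (hf : IsTranscendentalSelfMapCStar f)
    {G : Set ℂ} (hG : IsPreconnected G) (h0 : ∀ w ∈ G, w ≠ 0)
    (hGF : ∀ w ∈ G, ChordalEquicontinuousAt f w) {z : ℂ} (hz : z ∈ G) (hzI : z ∈ escapingSet f) :
    G ⊆ escapingSet f := by
  intro w hw
  have := hG.eq_of_eventually_eq (g := fun w => w ∈ escapingSet f) (fun x hx => ?_) hz hw
  · exact this.mp hzI
  · by_cases hxI : x ∈ escapingSet f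
    · filter_upwards [eventually_mem_escapingSet hf (hGF x hx) hxI] with y hy
      simp [hy, hxI]
    · have := mt (mem_escapingSet_of_frequently hf (h0 x hx) (hGF x hx)) hxI
      filter_upwards [not_frequently.mp this] with y hy
      simp [hy, hxI]

theorem IsClosed.isClosed_connectedComponentIn {α : Type*} [TopologicalSpace α] {K : Set α}
    (hK : IsClosed K) (x : α) : IsClosed (connectedComponentIn K x) := by
  by_cases hx : x ∈ K
  · refine isClosed_of_closure_subset ?_
    exact isPreconnected_connectedComponentIn.closure.subset_connectedComponentIn
      (subset_closure (mem_connectedComponentIn hx))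
      (closure_minimal (connectedComponentIn_subset _ _) hK)
  · rw [connectedComponentIn_eq_empty hx]
    exact isClosed_empty

theorem disjoint_connectedComponentIn {α : Type*} [TopologicalSpace α] {K : Set α} {x y : α}
    (h : connectedComponentIn K x ≠ connectedComponentIn K y) :
    Disjoint (connectedComponentIn K x) (connectedComponentIn K y) := by
  rw [Set.disjoint_left]
  intro z hx hy
  exact h ((connectedComponentIn_eq hx).trans (connectedComponentIn_eq hy).symm)

/-- A compact subset of a plane domain lies in a compact connected subset. -/
theorem IsCompact.exists_isPreconnected_superset {U C : Set ℂ} (hC : IsCompact C)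
    (hU : IsOpen U) (hUc : IsPreconnected U) (hne : U.Nonempty) (hCU : C ⊆ U) :
    ∃ D ⊆ U, C ⊆ D ∧ IsCompact D ∧ IsPreconnected D := by
  obtain ⟨u, hu⟩ := hne
  suffices ∃ D ⊆ U, C ⊆ D ∧ IsCompact D ∧ IsPreconnected D ∧ u ∈ D by
    obtain ⟨D, a, b, c, d, -⟩ := this
    exact ⟨D, a, b, c, d⟩
  refine hC.induction_on (p := fun C => ∃ D ⊆ U, C ⊆ D ∧ IsCompact D ∧ IsPreconnected D ∧ u ∈ D)
    ⟨{u}, by simpa using hu, empty_subset _, isCompact_singleton, isPreconnected_singleton, rfl⟩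
    ?_ ?_ ?_
  · rintro s t hst ⟨D, a, b, c⟩
    exact ⟨D, a, hst.trans b, c⟩
  · rintro s t ⟨D, a, b, c, d, e⟩ ⟨D', a', b', c', d', e'⟩
    exact ⟨D ∪ D', union_subset a a', union_subset_union b b', c.union c', d.union u e e' d',
      Or.inl e⟩
  · intro x hx
    obtain ⟨r, hr, hball⟩ := Metric.nhds_basis_closedBall.mem_iff.mp (hU.mem_nhds (hCU hx))
    obtain ⟨Q, hQU, hQ, hQc, huQ, hxQ⟩ := hU.exists_isCompact_isPreconnected hUc hu (hCU hx)
    exact ⟨_, mem_nhdsWithin_of_mem_nhds (Metric.closedBall_mem_nhds x hr),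
      Q ∪ Metric.closedBall x r, union_subset hQU hball, subset_union_right,
      hQ.union (isCompact_closedBall x r),
      hQc.union x hxQ (Metric.mem_closedBall_self hr.le) (convex_closedBall x r).isPreconnected,
      Or.inl huQ⟩

theorem escape_of_frontier {f : ℂ → ℂ} (hf : IsTranscendentalSelfMapCStar f) {W D : Set ℂ}
    (hW : Bornology.IsBounded W) (hW0 : ∀ z ∈ closure W, z ≠ 0) (hD : IsCompact D)
    (hDc : IsPreconnected D) (hWD : frontier W ⊆ D) (hDF : ∀ w ∈ D, ChordalEquicontinuousAt f w)
    (hDI : D ⊆ escapingSet f) {ε : ℝ} (hε : 0 < ε) (hε1 : ε ≤ 1) :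
    ∃ N : ℕ, ∀ n ≥ N, (∀ z ∈ W, ‖f^[n] z‖ ≤ ε) ∨ ∀ z ∈ W, ‖(f^[n] z)⁻¹‖ ≤ ε := by
  obtain ⟨N, hN⟩ := exists_forall_escape_of_isCompact hf hD hDF hDI hε
  refine ⟨N, fun n hn => ?_⟩
  have hd : DifferentiableOn ℂ f^[n] (closure W) := (hf.differentiableOn_iterate n).mono hW0
  have hne := fun z hz => hf.iterate_ne_zero n (hW0 z hz)
  rcases hDc.forall_norm_lt_or_forall_lt_norm
    ((hf.differentiableOn_iterate n).continuousOn.mono fun z hz => (hDI hz).1) hε hε1 (hN n hn)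
    with h | h
  · exact Or.inl fun z hz => Complex.norm_le_of_forall_mem_frontier_norm_le hW hd.diffContOnCl
      (fun w hw => (h w (hWD hw)).le) (subset_closure hz)
  · refine Or.inr fun z hz => Complex.norm_le_of_forall_mem_frontier_norm_le hW
      (hd.inv hne).diffContOnCl (fun w hw => ?_) (subset_closure hz)
    have := h w (hWD hw)
    rw [one_div] at this
    rw [Pi.inv_apply, norm_inv]
    exact (inv_lt_of_inv_lt₀ hε this).le

theorem ChordalEquicontinuousAt.of_frontier {f : ℂ → ℂ} (hf : IsTranscendentalSelfMapCStar f)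
    {W D : Set ℂ} (hWo : IsOpen W)
    (hW : Bornology.IsBounded W) (hW0 : ∀ z ∈ closure W, z ≠ 0) (hD : IsCompact D)
    (hDc : IsPreconnected D) (hWD : frontier W ⊆ D) (hDF : ∀ w ∈ D, ChordalEquicontinuousAt f w)
    (hDI : D ⊆ escapingSet f) {z : ℂ} (hz : z ∈ W) : ChordalEquicontinuousAt f z := by
  intro η hη
  obtain ⟨N, hN⟩ := escape_of_frontier hf hW hW0 hD hDc hWD hDF hDI
    (ε := min (η / 3) 1) (by positivity) (min_le_right _ _)
  have hlt : min (η / 3) 1 + min (η / 3) 1 < η := by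
    have := min_le_left (η / 3) 1
    linarith
  have hz0 := hW0 z (subset_closure hz)
  have hfin : ∀ᶠ w in 𝓝 z, ∀ n < N, chordalDist (f^[n] z) (f^[n] w) < η := by
    refine (Set.finite_lt_nat N).eventually_all.mpr fun n _ => ?_
    filter_upwards [(hf.continuousAt_iterate n hz0).eventually (Metric.ball_mem_nhds _ hη)]
      with w hw
    refine (chordalDist_le _ _).trans_lt ?_
    rwa [← dist_eq_norm, dist_comm]
  filter_upwards [hfin, hWo.mem_nhds hz] with w hw hwW n
  rcases lt_or_ge n N with hn | hn
  · exact hw n hn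
  · rcases hN n hn with h | h
    · calc _ ≤ _ := chordalDist_le _ _
        _ ≤ _ := norm_sub_le _ _
        _ ≤ _ := add_le_add (h z hz) (h w hwW)
        _ < _ := hlt
    · rw [← chordalDist_inv (hf.iterate_ne_zero n hz0)
        (hf.iterate_ne_zero n (hW0 w (subset_closure hwW)))]
      calc _ ≤ _ := chordalDist_le _ _
        _ ≤ _ := norm_sub_le _ _
        _ ≤ _ := add_le_add (h z hz) (h w hwW)
        _ < _ := hlt

/-- For a doubly connected escaping Fatou component, `0` and `∞` lie in different components of
the complement. -/
theorem connectedComponentIn_zero_ne_infty {f : ℂ → ℂ} (hf : IsTranscendentalSelfMapCStar f)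
    {U : Set ℂ} (hU : IsFatouComponent f U) (hUI : U ⊆ escapingSet f) {t : OnePoint ℂ}
    (ht : t ∈ ((fun z : ℂ => (z : OnePoint ℂ)) '' U)ᶜ)
    (hK : ∀ z ∈ ((fun z : ℂ => (z : OnePoint ℂ)) '' U)ᶜ,
      z ∈ connectedComponentIn ((fun z : ℂ => (z : OnePoint ℂ)) '' U)ᶜ ((0 : ℂ) : OnePoint ℂ) ∨
      z ∈ connectedComponentIn ((fun z : ℂ => (z : OnePoint ℂ)) '' U)ᶜ t)
    (htne : connectedComponentIn ((fun z : ℂ => (z : OnePoint ℂ)) '' U)ᶜ t ≠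
      connectedComponentIn ((fun z : ℂ => (z : OnePoint ℂ)) '' U)ᶜ ((0 : ℂ) : OnePoint ℂ)) :
    connectedComponentIn ((fun z : ℂ => (z : OnePoint ℂ)) '' U)ᶜ ((0 : ℂ) : OnePoint ℂ) ≠
      connectedComponentIn ((fun z : ℂ => (z : OnePoint ℂ)) '' U)ᶜ ∞ := by
  intro heq
  set K := ((fun z : ℂ => (z : OnePoint ℂ)) '' U)ᶜ with hKdef
  have hKc : IsClosed K := (isOpenEmbedding_coe.isOpenMap _ hU.isOpen).isClosed_compl
  have hmem : ∀ z : ℂ, (z : OnePoint ℂ) ∈ K ↔ z ∉ U := fun z => by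
    rw [hKdef, mem_compl_iff, coe_injective.mem_set_image]
  have h0K : ((0 : ℂ) : OnePoint ℂ) ∈ K := (hmem 0).mpr fun h => (hUI h).1 rfl
  have hinfK : ∞ ∈ K := by simp [hKdef]
  set X := connectedComponentIn K ((0 : ℂ) : OnePoint ℂ)
  set Y := connectedComponentIn K t
  have hdisj : Disjoint Y X := disjoint_connectedComponentIn htne
  have h0X : ((0 : ℂ) : OnePoint ℂ) ∈ X := mem_connectedComponentIn h0K
  have hinfX : ∞ ∈ X := heq ▸ mem_connectedComponentIn hinfK
  have hinfY : ∞ ∉ Y := Set.disjoint_right.mp hdisj hinfX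
  set Y' : Set ℂ := (fun z : ℂ => (z : OnePoint ℂ)) ⁻¹' Y
  have hY' : IsCompact Y' :=
    ((OnePoint.isClosed_iff_of_notMem hinfY).mp (hKc.isClosed_connectedComponentIn t)).2
  have hX' : IsClosed ((fun z : ℂ => (z : OnePoint ℂ)) ⁻¹' X) :=
    (hKc.isClosed_connectedComponentIn _).preimage continuous_coe
  obtain ⟨L, hL, hYL, hLX⟩ := exists_compact_between hY' hX'.isOpen_compl
    fun z hz => Set.disjoint_left.mp hdisj hz
  have hL0 : ∀ z ∈ closure (interior L), z ≠ 0 := by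
    rintro z hz rfl
    exact hLX (closure_minimal interior_subset hL.isClosed hz) h0X
  have hLU : L \ interior L ⊆ U := by
    rintro z ⟨hzL, hzi⟩
    by_contra hzU
    rcases hK z ((hmem z).mpr hzU) with h | h
    · exact hLX hzL h
    · exact hzi (hYL h)
  obtain ⟨D, hDU, hLD, hD, hDc⟩ := (hL.diff isOpen_interior).exists_isPreconnected_superset
    hU.isOpen hU.isPreconnected hU.nonempty hLU
  have hfr : frontier (interior L) ⊆ D := by
    refine fun z hz => hLD ⟨?_, ?_⟩
    · exact closure_minimal interior_subset hL.isClosed hz.1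
    · rw [isOpen_interior.frontier_eq] at hz
      exact hz.2
  have hWF : interior L ⊆ FatouSet f := by
    have heq : ∀ w ∈ interior L, ChordalEquicontinuousAt f w := fun w hw =>
      .of_frontier hf isOpen_interior (hL.isBounded.subset interior_subset) hL0 hD hDc hfr
        (fun z hz => .of_mem_fatouSet (hU.subset (hDU hz))) (hDU.trans hUI) hw
    intro z hz
    refine mem_fatouSet_iff.mpr ⟨hL0 z (subset_closure hz), ?_⟩
    filter_upwards [isOpen_interior.mem_nhds hz] with w hw using heq w hw
  have hYU : ∀ y ∈ Y', y ∉ closure U := by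
    intro y hy hyU
    refine hU.notMem_fatouSet_of_mem_frontier (w := y) ?_ (hWF (hYL hy))
    rw [hU.isOpen.frontier_eq]
    exact ⟨hyU, (hmem y).mp (connectedComponentIn_subset _ _ hy)⟩
  have hY'o : IsOpen Y' := by
    rw [isOpen_iff_mem_nhds]
    intro y hy
    filter_upwards [isClosed_closure.isOpen_compl.mem_nhds (hYU y hy),
      hX'.isOpen_compl.mem_nhds (Set.disjoint_left.mp hdisj hy)] with w h1 h2
    exact (hK w ((hmem w).mpr fun h => h1 (subset_closure h))).resolve_left h2
  have hYne : Y'.Nonempty := by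
    obtain ⟨s, rfl⟩ := ne_infty_iff_exists.mp
      (fun e : t = ∞ => hinfY (e ▸ mem_connectedComponentIn ht))
    exact ⟨s, mem_connectedComponentIn ht⟩
  have huniv := (show IsClopen Y' from ⟨hY'.isClosed, hY'o⟩).eq_univ hYne
  exact Set.disjoint_right.mp hdisj h0X (huniv ▸ mem_univ (0 : ℂ) : (0 : ℂ) ∈ Y')

theorem exists_complement_split {f : ℂ → ℂ} (hf : IsTranscendentalSelfMapCStar f)
    {U : Set ℂ} (hU : IsFatouComponent f U) (hUI : U ⊆ escapingSet f) (hdc : DoublyConnected U) :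
    ∃ X₀ X₁ : Set (OnePoint ℂ), IsClosed X₀ ∧ IsClosed X₁ ∧ IsPreconnected X₀ ∧
      IsPreconnected X₁ ∧ Disjoint X₀ X₁ ∧
      X₀ ∪ X₁ = ((fun z : ℂ => (z : OnePoint ℂ)) '' U)ᶜ ∧
      ((0 : ℂ) : OnePoint ℂ) ∈ X₀ ∧ ∞ ∈ X₁ := by
  obtain ⟨x, hx, y, hy, hxy, hK⟩ := hdc
  have hKc : IsClosed ((fun z : ℂ => (z : OnePoint ℂ)) '' U)ᶜ :=
    (isOpenEmbedding_coe.isOpenMap _ hU.isOpen).isClosed_compl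
  have h0K : ((0 : ℂ) : OnePoint ℂ) ∈ ((fun z : ℂ => (z : OnePoint ℂ)) '' U)ᶜ := by
    rw [mem_compl_iff, coe_injective.mem_set_image]
    exact fun h => (hUI h).1 rfl
  have hinfK : ∞ ∈ ((fun z : ℂ => (z : OnePoint ℂ)) '' U)ᶜ := by simp
  have hne : connectedComponentIn ((fun z : ℂ => (z : OnePoint ℂ)) '' U)ᶜ ((0 : ℂ) : OnePoint ℂ) ≠
      connectedComponentIn ((fun z : ℂ => (z : OnePoint ℂ)) '' U)ᶜ ∞ := by
    rcases hK _ h0K with h | h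
    · refine connectedComponentIn_zero_ne_infty hf hU hUI hy (fun z hz => ?_) (h ▸ hxy.symm)
      have := mem_connectedComponentIn hz
      rw [h]
      exact (hK z hz).imp (fun e => by rwa [← e]) fun e => by rwa [← e]
    · refine connectedComponentIn_zero_ne_infty hf hU hUI hx (fun z hz => ?_) (h ▸ hxy)
      have := mem_connectedComponentIn hz
      rw [h]
      exact (hK z hz).symm.imp (fun e => by rwa [← e]) fun e => by rwa [← e]
  refine ⟨_, _, hKc.isClosed_connectedComponentIn _, hKc.isClosed_connectedComponentIn _,
    isPreconnected_connectedComponentIn, isPreconnected_connectedComponentIn,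
    disjoint_connectedComponentIn hne, Subset.antisymm (union_subset
      (connectedComponentIn_subset _ _) (connectedComponentIn_subset _ _)) fun z hz => ?_,
    mem_connectedComponentIn h0K, mem_connectedComponentIn hinfK⟩
  have hzm := mem_connectedComponentIn hz
  rcases hK _ h0K with h | h <;> rcases hK _ hinfK with h' | h' <;> rcases hK _ hz with e | e
  · exact absurd (h.trans h'.symm) hne
  · exact absurd (h.trans h'.symm) hne
  · exact Or.inl (h ▸ e ▸ hzm)
  · exact Or.inr (h' ▸ e ▸ hzm)
  · exact Or.inr (h' ▸ e ▸ hzm)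
  · exact Or.inl (h ▸ e ▸ hzm)
  · exact absurd (h.trans h'.symm) hne
  · exact absurd (h.trans h'.symm) hne

/-- The inversion `z ↦ 1 / z` of the Riemann sphere. -/
def sphereInv (x : OnePoint ℂ) : OnePoint ℂ :=
  x.elim ((0 : ℂ) : OnePoint ℂ) fun z => if z = 0 then ∞ else ((z⁻¹ : ℂ) : OnePoint ℂ)

theorem sphereInv_infty : sphereInv ∞ = ((0 : ℂ) : OnePoint ℂ) := rfl

theorem sphereInv_zero : sphereInv ((0 : ℂ) : OnePoint ℂ) = ∞ := if_pos rfl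

theorem sphereInv_coe {z : ℂ} (hz : z ≠ 0) :
    sphereInv (z : OnePoint ℂ) = ((z⁻¹ : ℂ) : OnePoint ℂ) := if_neg hz

theorem sphereInv_involutive : Involutive sphereInv := by
  intro x
  induction x using OnePoint.rec with
  | infty => rw [sphereInv_infty, sphereInv_zero]
  | coe z =>
    by_cases hz : z = 0
    · rw [hz, sphereInv_zero, sphereInv_infty]
    · rw [sphereInv_coe hz, sphereInv_coe (inv_ne_zero hz), inv_inv]

theorem continuous_sphereInv : Continuous sphereInv := by
  rw [continuous_iff_continuousAt]
  intro x
  induction x using OnePoint.rec with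
  | infty =>
    rw [continuousAt_infty', coclosedCompact_eq_cocompact, ← Metric.cobounded_eq_cocompact,
      sphereInv_infty]
    refine ((continuous_coe.tendsto (0 : ℂ)).comp tendsto_inv₀_cobounded).congr' ?_
    filter_upwards [(Bornology.isBounded_singleton (x := (0 : ℂ)))] with z hz
    exact (sphereInv_coe hz).symm
  | coe z =>
    rw [continuousAt_coe]
    by_cases hz : z = 0
    · rw [hz, continuousAt_iff_punctured_nhds, comp_apply, sphereInv_zero]
      have h : Tendsto (fun z : ℂ => (z : OnePoint ℂ)) (Bornology.cobounded ℂ) (𝓝 ∞) := by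
        rw [Metric.cobounded_eq_cocompact, ← coclosedCompact_eq_cocompact]
        exact tendsto_coe_infty
      refine (h.comp tendsto_inv₀_nhdsNE_zero).congr' ?_
      filter_upwards [self_mem_nhdsWithin] with z hz
      exact (sphereInv_coe hz).symm
    · have h : ContinuousAt (fun z : ℂ => ((z⁻¹ : ℂ) : OnePoint ℂ)) z :=
        continuous_coe.continuousAt.comp (continuousAt_inv₀ hz)
      refine h.congr ?_
      filter_upwards [isOpen_ne.mem_nhds hz] with w hw
      exact (sphereInv_coe hw).symm

theorem isBounded_of_infty_notMem_closure {U : Set ℂ}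
    (h : ∞ ∉ closure ((fun z : ℂ => (z : OnePoint ℂ)) '' U)) : Bornology.IsBounded U := by
  have h1 := isClosed_closure.isOpen_compl.mem_nhds (mem_compl h)
  have h2 := tendsto_coe_infty (X := ℂ) h1
  rw [coclosedCompact_eq_cocompact, ← Metric.cobounded_eq_cocompact] at h2
  rw [← Bornology.isCobounded_compl_iff]
  refine mem_of_superset h2 fun z hz hzU => hz (subset_closure (mem_image_of_mem _ hzU))

/-- The inversion `z ↦ 1 / z` as a self-homeomorphism of the Riemann sphere. -/
def sphereInvHomeomorph : OnePoint ℂ ≃ₜ OnePoint ℂ where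
  toEquiv := sphereInv_involutive.toPerm
  continuous_toFun := continuous_sphereInv
  continuous_invFun := continuous_sphereInv

theorem coe_sphereInvHomeomorph : ⇑sphereInvHomeomorph = sphereInv := rfl

theorem image_coe_preimage_inv {U : Set ℂ} (hU : ∀ z ∈ U, z ≠ 0) :
    (fun z : ℂ => (z : OnePoint ℂ)) '' ((fun z => z⁻¹) ⁻¹' U) =
      sphereInv ⁻¹' ((fun z : ℂ => (z : OnePoint ℂ)) '' U) := by
  ext x
  induction x using OnePoint.rec with
  | infty =>
    simp only [mem_preimage, sphereInv_infty, mem_image, coe_ne_infty, and_false, exists_false,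
      coe_eq_coe, exists_eq_right, false_iff]
    exact fun h => hU 0 h rfl
  | coe z =>
    by_cases hz : z = 0
    · subst hz
      simp only [mem_preimage, sphereInv_zero, mem_image, coe_ne_infty, and_false, exists_false,
        coe_eq_coe, exists_eq_right, inv_zero, iff_false]
      exact fun h => hU 0 h rfl
    · simp only [mem_preimage, sphereInv_coe hz, mem_image, coe_eq_coe, exists_eq_right]

theorem infty_mem_closure_preimage_inv {U : Set ℂ} (hU : ∀ z ∈ U, z ≠ 0) :
    ∞ ∈ closure ((fun z : ℂ => (z : OnePoint ℂ)) '' ((fun z => z⁻¹) ⁻¹' U)) ↔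
      ((0 : ℂ) : OnePoint ℂ) ∈ closure ((fun z : ℂ => (z : OnePoint ℂ)) '' U) := by
  rw [image_coe_preimage_inv hU, ← coe_sphereInvHomeomorph,
    ← sphereInvHomeomorph.preimage_closure, mem_preimage, coe_sphereInvHomeomorph,
    sphereInv_infty]

theorem mem_frontier_of_mem_frontier_preimage_inv {U : Set ℂ} {z : ℂ} (hz : z ≠ 0)
    (h : z ∈ frontier ((fun z => z⁻¹) ⁻¹' U)) : z⁻¹ ∈ frontier U := by
  rw [frontier_eq_closure_inter_closure] at h ⊢
  exact ⟨closure_mono (image_preimage_subset _ _) (mem_closure_image (continuousAt_inv₀ hz) h.1),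
    closure_mono (image_preimage_subset _ _) (mem_closure_image (continuousAt_inv₀ hz) h.2)⟩

section BakerDomain

variable {f : ℂ → ℂ} {U : Set ℂ} {p : ℕ}

theorem IsFatouComponent.iterate_notMem_of_mem_frontier (hf : IsTranscendentalSelfMapCStar f)
    (hU : IsFatouComponent f U) {z : ℂ} (hz : z ∈ frontier U) (hz0 : z ≠ 0) (n : ℕ) :
    f^[n] z ∉ U := fun h =>
  hU.notMem_fatouSet_of_mem_frontier hz (hf.mem_fatouSet_of_iterate hz0 (hU.subset h))

theorem infty_mem_closure_image_coe (hf : IsTranscendentalSelfMapCStar f)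
    (hU : IsFatouComponent f U) (hp : 0 < p) (hper : f^[p] '' U ⊆ U) (hUI : U ⊆ escapingSet f)
    (hdc : DoublyConnected U) : ∞ ∈ closure ((fun z : ℂ => (z : OnePoint ℂ)) '' U) := by
  by_contra hcon
  obtain ⟨X₀, X₁, h0, h1, h0c, h1c, hd, hu, hz, hi⟩ := exists_complement_split hf hU hUI hdc
  exact IsEscapingRing.not_isEscapingRing hf hp
    { isOpen := hU.isOpen
      isPreconnected := hU.isPreconnected
      isBounded := isBounded_of_infty_notMem_closure hcon
      mapsTo := mapsTo_iff_image_subset.mpr hper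
      escaping := fun C hC hCc ε hε => exists_forall_escape_of_isCompact hf hCc
        (fun w hw => .of_mem_fatouSet (hU.subset (hC hw))) (hC.trans hUI) hε
      frontier_notMem := fun z hz hz0 => hU.iterate_notMem_of_mem_frontier hf hz hz0 p
      isClosed₀ := h0
      isClosed₁ := h1
      isPreconnected₀ := h0c
      isPreconnected₁ := h1c
      disjoint := hd
      union_eq := hu
      zero_mem := hz
      infty_mem := hi }

theorem zero_mem_closure_image_coe (hf : IsTranscendentalSelfMapCStar f)
    (hU : IsFatouComponent f U) (hp : 0 < p) (hper : f^[p] '' U ⊆ U) (hUI : U ⊆ escapingSet f)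
    (hdc : DoublyConnected U) :
    ((0 : ℂ) : OnePoint ℂ) ∈ closure ((fun z : ℂ => (z : OnePoint ℂ)) '' U) := by
  have hU0 : ∀ z ∈ U, z ≠ 0 := fun z hz => (hUI hz).1
  rw [← infty_mem_closure_preimage_inv hU0]
  by_contra hcon
  have himg : (fun z : ℂ => z⁻¹) ⁻¹' U = (fun z : ℂ => z⁻¹) '' U :=
    (congrFun (Set.image_eq_preimage_of_inverse inv_inv inv_inv) U).symm
  have hcont : ContinuousOn (fun z : ℂ => z⁻¹) U := continuousOn_id.inv₀ hU0
  obtain ⟨X₀, X₁, h0, h1, h0c, h1c, hd, hu, hz, hi⟩ := exists_complement_split hf hU hUI hdc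
  have hpre : ∀ X : Set (OnePoint ℂ), IsPreconnected X → IsPreconnected (sphereInv ⁻¹' X) := by
    intro X hX
    rw [← Set.image_eq_preimage_of_inverse sphereInv_involutive sphereInv_involutive]
    exact hX.image _ continuous_sphereInv.continuousOn
  refine IsEscapingRing.not_isEscapingRing (V := (fun z => z⁻¹) ⁻¹' U) (X₀ := sphereInv ⁻¹' X₁)
    (X₁ := sphereInv ⁻¹' X₀) hf.inv_conj hp
    { isOpen := ?_
      isPreconnected := himg ▸ hU.isPreconnected.image _ hcont
      isBounded := isBounded_of_infty_notMem_closure hcon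
      mapsTo := fun z hz => ?_
      escaping := fun C hC hCc ε hε => ?_
      frontier_notMem := fun z hz hz0 => ?_
      isClosed₀ := h1.preimage continuous_sphereInv
      isClosed₁ := h0.preimage continuous_sphereInv
      isPreconnected₀ := hpre _ h1c
      isPreconnected₁ := hpre _ h0c
      disjoint := hd.symm.preimage _
      union_eq := ?_
      zero_mem := by rwa [mem_preimage, sphereInv_zero]
      infty_mem := by rwa [mem_preimage, sphereInv_infty] }
  · have h : (fun z : ℂ => z⁻¹) ⁻¹' U = {0}ᶜ ∩ (fun z : ℂ => z⁻¹) ⁻¹' U :=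
      (inter_eq_self_of_subset_right fun z (hz : z⁻¹ ∈ U) (hz0 : z = 0) =>
        hU0 _ hz (by rw [hz0, inv_zero])).symm
    rw [h]
    exact (continuousOn_id.inv₀ fun z hz => hz).isOpen_inter_preimage
      isOpen_compl_singleton hU.isOpen
  · rw [mem_preimage, IsTranscendentalSelfMapCStar.iterate_inv_conj, inv_inv]
    exact hper (mem_image_of_mem _ hz)
  · have hCU : (fun z : ℂ => z⁻¹) '' C ⊆ U := image_subset_iff.mpr hC
    have hC' : IsCompact ((fun z : ℂ => z⁻¹) '' C) := hCc.image_of_continuousOn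
      (continuousOn_id.inv₀ fun z hz hz0 => hU0 _ (hC hz) (by simp [show z = 0 from hz0]))
    obtain ⟨N, hN⟩ := exists_forall_escape_of_isCompact hf hC'
      (fun w hw => .of_mem_fatouSet (hU.subset (hCU hw))) (hCU.trans hUI) hε
    refine ⟨N, fun n hn z hz => ?_⟩
    have hz0 := hf.iterate_ne_zero n (hU0 _ (hC hz))
    rw [IsTranscendentalSelfMapCStar.iterate_inv_conj, norm_inv]
    rcases hN n hn _ (mem_image_of_mem _ hz) with h | h
    · right
      rw [one_div]
      exact inv_strictAnti₀ (norm_pos_iff.mpr hz0) h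
    · left
      exact inv_lt_of_inv_lt₀ hε (by rwa [one_div] at h)
  · rw [mem_preimage, IsTranscendentalSelfMapCStar.iterate_inv_conj, inv_inv]
    exact hU.iterate_notMem_of_mem_frontier hf (mem_frontier_of_mem_frontier_preimage_inv hz0 hz)
      (inv_ne_zero hz0) p
  · rw [← preimage_union, union_comm, hu, image_coe_preimage_inv hU0, preimage_compl]

end BakerDomain

/-- An open set, relatively compact in `ℂ*`, whose boundary does not meet the escaping set. -/
structure IsEscapeIsolated (f : ℂ → ℂ) (B : Set ℂ) : Prop where
  isOpen : IsOpen B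
  isBounded : Bornology.IsBounded B
  zero_notMem : (0 : ℂ) ∉ closure B
  frontier_notMem : ∀ z ∈ frontier B, z ∉ escapingSet f

/-- A relatively clopen piece of a set in the punctured plane can be cut out by an open set,
relatively compact in the punctured plane, whose boundary misses the set. -/
theorem exists_isolating_open {I A B : Set ℂ} (hA : IsOpen A) (hB : IsOpen B) (hAc : IsCompact Aᶜ)
    (h0 : (0 : ℂ) ∈ A) (hI : I ⊆ A ∪ B) (hIB : (I ∩ B).Nonempty) (hd : I ∩ (A ∩ B) = ∅) :
    ∃ W : Set ℂ, IsOpen W ∧ Bornology.IsBounded W ∧ (0 : ℂ) ∉ closure W ∧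
      (∀ z ∈ frontier W, z ∉ I) ∧ (W ∩ I).Nonempty := by
  obtain ⟨L, hL, hAL, hL0⟩ := exists_compact_between hAc isOpen_compl_singleton
    (fun z hz hz0 => hz ((show z = 0 from hz0) ▸ h0) : Aᶜ ⊆ {(0 : ℂ)}ᶜ)
  have hnot : ∀ z ∈ I, z ∈ A → z ∈ B → False := fun z h1 h2 h3 =>
    (hd ▸ ⟨h1, h2, h3⟩ : z ∈ (∅ : Set ℂ))
  set P := I ∩ B
  set Q := (I ∩ A) ∪ (interior L)ᶜ
  have hQne : Q.Nonempty := ⟨0, Or.inr fun h => hL0 (interior_subset h) rfl⟩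
  have hPB : ∀ z ∈ P, Metric.infDist z P < Metric.infDist z Q := by
    intro z hz
    rw [Metric.infDist_zero_of_mem hz, ← Metric.infDist_closure]
    refine (isClosed_closure.notMem_iff_infDist_pos hQne.closure).mp fun hzQ => ?_
    have hzL : z ∈ interior L := hAL fun h => hnot z hz.1 h hz.2
    obtain ⟨y, ⟨hyB, hyL⟩, hy⟩ := mem_closure_iff.mp hzQ _ (hB.inter isOpen_interior) ⟨hz.2, hzL⟩
    rcases hy with hy | hy
    · exact hnot y hy.1 hy.2 hyB
    · exact hy hyL
  have hWL : {z | Metric.infDist z P < Metric.infDist z Q} ⊆ L := by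
    intro z hz
    by_contra hzL
    have hzQ : z ∈ Q := Or.inr fun h => hzL (interior_subset h)
    have hz' : Metric.infDist z P < Metric.infDist z Q := hz
    rw [Metric.infDist_zero_of_mem hzQ] at hz'
    exact hz'.not_ge Metric.infDist_nonneg
  refine ⟨{z | Metric.infDist z P < Metric.infDist z Q},
    isOpen_lt (Metric.continuous_infDist_pt _) (Metric.continuous_infDist_pt _),
    hL.isBounded.subset hWL, fun h => hL0 (closure_minimal hWL hL.isClosed h) rfl, ?_,
    hIB.mono fun z hz => ⟨hPB z hz, hz.1⟩⟩
  intro z hz hzI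
  have heq : Metric.infDist z P = Metric.infDist z Q := frontier_lt_subset_eq
    (Metric.continuous_infDist_pt _) (Metric.continuous_infDist_pt _) hz
  rcases hI hzI with hzA | hzB
  · rw [Metric.infDist_zero_of_mem (show z ∈ Q from Or.inl ⟨hzI, hzA⟩),
      ← Metric.infDist_closure] at heq
    have hzP := (isClosed_closure.mem_iff_infDist_zero hIB.closure).mpr heq
    obtain ⟨y, hyA, hy⟩ := mem_closure_iff.mp hzP _ hA hzA
    exact hnot y hy.1 hyA hy.2
  · exact (hPB z ⟨hzI, hzB⟩).ne heq

theorem exists_isEscapeIsolated {f : ℂ → ℂ} {U : Set ℂ} (hU : IsPreconnected U)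
    (hUI : U ⊆ escapingSet f)
    (h0 : ((0 : ℂ) : OnePoint ℂ) ∈ closure ((fun z : ℂ => (z : OnePoint ℂ)) '' U))
    (hi : ∞ ∈ closure ((fun z : ℂ => (z : OnePoint ℂ)) '' U))
    (h : ¬ IsPreconnected (escapingSphere f)) :
    ∃ B, IsEscapeIsolated f B ∧ (B ∩ escapingSet f).Nonempty := by
  have hUc : IsPreconnected ((fun z : ℂ => (z : OnePoint ℂ)) '' U ∪ {((0 : ℂ) : OnePoint ℂ), ∞}) :=
    (hU.image _ continuous_coe.continuousOn).subset_closure subset_union_left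
      (union_subset subset_closure (by rintro x (rfl | rfl) <;> assumption))
  have hUS : (fun z : ℂ => (z : OnePoint ℂ)) '' U ∪ {((0 : ℂ) : OnePoint ℂ), ∞} ⊆
      escapingSphere f := union_subset_union_left _ (image_mono hUI)
  have key : ∀ A B : Set (OnePoint ℂ), IsOpen A → IsOpen B → escapingSphere f ⊆ A ∪ B →
      (escapingSphere f ∩ B).Nonempty → escapingSphere f ∩ (A ∩ B) = ∅ →
      (fun z : ℂ => (z : OnePoint ℂ)) '' U ∪ {((0 : ℂ) : OnePoint ℂ), ∞} ⊆ A →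
      ∃ B, IsEscapeIsolated f B ∧ (B ∩ escapingSet f).Nonempty := by
    intro A B hA hB hAB hBne hd hUA
    have hzA : ((0 : ℂ) : OnePoint ℂ) ∈ A := hUA (by simp)
    have hiA : ∞ ∈ A := hUA (by simp)
    have hS0 : ((0 : ℂ) : OnePoint ℂ) ∈ escapingSphere f := hUS (by simp)
    have hSi : ∞ ∈ escapingSphere f := hUS (by simp)
    have hcoe : ∀ z ∈ escapingSet f, (z : OnePoint ℂ) ∈ escapingSphere f :=
      fun z hz => Or.inl (mem_image_of_mem _ hz)
    have hIB : (escapingSet f ∩ (fun z : ℂ => (z : OnePoint ℂ)) ⁻¹' B).Nonempty := by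
      obtain ⟨x, hxS, hxB⟩ := hBne
      rcases hxS with ⟨z, hz, rfl⟩ | rfl | rfl
      · exact ⟨z, hz, hxB⟩
      · exact absurd ⟨hS0, hzA, hxB⟩ (eq_empty_iff_forall_notMem.mp hd _)
      · exact absurd ⟨hSi, hiA, hxB⟩ (eq_empty_iff_forall_notMem.mp hd _)
    obtain ⟨W, h1, h2, h3, h4, h5⟩ := exists_isolating_open (hA.preimage continuous_coe)
      (hB.preimage continuous_coe) ((OnePoint.isOpen_iff_of_mem hiA).mp hA).2 hzA
      (fun z hz => hAB (hcoe z hz)) hIB (eq_empty_iff_forall_notMem.mpr fun z hz =>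
        eq_empty_iff_forall_notMem.mp hd _ ⟨hcoe z hz.1, hz.2⟩)
    exact ⟨W, ⟨h1, h2, h3, h4⟩, h5⟩
  rw [IsPreconnected] at h
  push Not at h
  obtain ⟨A, B, hA, hB, hAB, hAne, hBne, hd⟩ := h
  have hd' := disjoint_iff_inter_eq_empty.mpr hd
  rcases isPreconnected_iff_subset_of_disjoint.mp hUc A B hA hB (hUS.trans hAB)
    (subset_empty_iff.mp (hd ▸ inter_subset_inter_left _ hUS)) with hUA | hUB
  · exact key A B hA hB hAB hBne hd hUA
  · exact key B A hB hA (union_comm A B ▸ hAB) hAne (inter_comm A B ▸ hd) hUB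

namespace IsEscapeIsolated

variable {f : ℂ → ℂ} {B : Set ℂ}

theorem isCompact_closure (h : IsEscapeIsolated f B) : IsCompact (closure B) :=
  h.isBounded.isCompact_closure

theorem ne_zero (h : IsEscapeIsolated f B) {z : ℂ} (hz : z ∈ closure B) : z ≠ 0 :=
  fun hz0 => h.zero_notMem (hz0 ▸ hz)

theorem isCompact_image (hf : IsTranscendentalSelfMapCStar f) (h : IsEscapeIsolated f B) (n : ℕ) :
    IsCompact (f^[n] '' closure B) :=
  h.isCompact_closure.image_of_continuousOn fun _ hz =>
    (hf.continuousAt_iterate n (h.ne_zero hz)).continuousWithinAt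

theorem isOpen_image (hf : IsTranscendentalSelfMapCStar f) (h : IsEscapeIsolated f B) (n : ℕ) :
    IsOpen (f^[n] '' B) := by
  rcases Nat.eq_zero_or_pos n with rfl | hn
  · simpa using h.isOpen
  rw [isOpen_iff_mem_nhds]
  rintro _ ⟨z, hz, rfl⟩
  have hz0 := h.ne_zero (subset_closure hz)
  have han : AnalyticAt ℂ f^[n] z :=
    (hf.differentiableOn_iterate n).analyticAt (isOpen_compl_singleton.mem_nhds hz0)
  rcases han.eventually_constant_or_nhds_le_map_nhds with hc | hle
  · refine absurd ?_ (hf.not_eventually_deriv_iterate_eq_zero hn hz0)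
    filter_upwards [eventually_eventually_nhds.mpr hc] with w hw
    have hw' : f^[n] =ᶠ[𝓝 w] fun _ => f^[n] z := hw
    rw [hw'.deriv_eq, deriv_const]
  · exact hle (image_mem_map (h.isOpen.mem_nhds hz))

/-- A connected set of escaping points meeting the image of an isolated set lies inside it. -/
theorem subset_image (hf : IsTranscendentalSelfMapCStar f) (h : IsEscapeIsolated f B) (n : ℕ)
    {X : Set ℂ} (hX : IsPreconnected X) (hXI : X ⊆ escapingSet f)
    (hne : (X ∩ f^[n] '' B).Nonempty) :
    X ⊆ f^[n] '' B := by
  refine hX.subset_left_of_subset_union (h.isOpen_image hf n)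
    (h.isCompact_image hf n).isClosed.isOpen_compl
    (disjoint_compl_right.mono_left (image_mono subset_closure)) (fun x hx => ?_) hne
  by_contra hcon
  rw [mem_union, mem_compl_iff, not_or, not_not] at hcon
  obtain ⟨hxB, z, hz, rfl⟩ := hcon
  refine h.frontier_notMem z ⟨hz, fun hzi => hxB ?_⟩
    ((escapingSet_iterate_mem hf n (h.ne_zero hz)).mp (hXI hx))
  exact mem_image_of_mem _ (interior_subset hzi)

theorem connectedComponentIn (h : IsEscapeIsolated f B) (z : ℂ) :
    IsEscapeIsolated f (connectedComponentIn B z) where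
  isOpen := h.isOpen.connectedComponentIn
  isBounded := h.isBounded.subset (connectedComponentIn_subset _ _)
  zero_notMem h0 := h.zero_notMem (closure_mono (connectedComponentIn_subset _ _) h0)
  frontier_notMem w hw := by
    refine h.frontier_notMem w ?_
    rw [h.isOpen.frontier_eq]
    rw [h.isOpen.connectedComponentIn.frontier_eq] at hw
    refine ⟨closure_mono (connectedComponentIn_subset _ _) hw.1, fun hwB => hw.2 ?_⟩
    obtain ⟨y, hy, hyz⟩ := mem_closure_iff.mp hw.1 _ h.isOpen.connectedComponentIn
      (mem_connectedComponentIn hwB)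
    rw [connectedComponentIn_eq hyz, ← connectedComponentIn_eq hy]
    exact mem_connectedComponentIn hwB

end IsEscapeIsolated

theorem norm_sub_le_mul_sqrt (X u : ℂ) : ‖X - u‖ ≤ (1 + ‖u‖) * Real.sqrt (1 + ‖X‖ ^ 2) := by
  have h1 : 1 ≤ Real.sqrt (1 + ‖X‖ ^ 2) := Real.one_le_sqrt.mpr (by nlinarith [sq_nonneg ‖X‖])
  have h2 : ‖X‖ ≤ Real.sqrt (1 + ‖X‖ ^ 2) := Real.le_sqrt_of_sq_le (by linarith)
  have h3 := norm_sub_le X u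
  nlinarith [norm_nonneg u]

theorem chordalDist_le_norm_inv_sub_inv {X Y u : ℂ} (hX : X ≠ u) (hY : Y ≠ u) :
    chordalDist X Y ≤ (1 + ‖u‖) ^ 2 * ‖(X - u)⁻¹ - (Y - u)⁻¹‖ := by
  have hX' := sub_ne_zero.mpr hX
  have hY' := sub_ne_zero.mpr hY
  have hid : X - Y = -((X - u) * (Y - u) * ((X - u)⁻¹ - (Y - u)⁻¹)) := by
    field_simp
    ring
  rw [chordalDist, div_le_iff₀ (by positivity), hid, norm_neg, norm_mul, norm_mul,
    Real.sqrt_mul (by positivity)]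
  have h := mul_le_mul (norm_sub_le_mul_sqrt X u) (norm_sub_le_mul_sqrt Y u) (norm_nonneg _)
    (by positivity)
  calc ‖X - u‖ * ‖Y - u‖ * ‖(X - u)⁻¹ - (Y - u)⁻¹‖
      ≤ _ * ‖(X - u)⁻¹ - (Y - u)⁻¹‖ := mul_le_mul_of_nonneg_right h (norm_nonneg _)
    _ = _ := by ring

/-- Iterates omitting a fixed disc on an open set are equicontinuous there. -/
theorem ChordalEquicontinuousAt.of_omits {f : ℂ → ℂ} (hf : IsTranscendentalSelfMapCStar f)
    {B : Set ℂ} (hB : IsOpen B) (hB0 : ∀ w ∈ B, w ≠ 0) {u : ℂ} {r : ℝ} (hr : 0 < r)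
    (h : ∀ n : ℕ, ∀ w ∈ B, r ≤ ‖f^[n] w - u‖) {z : ℂ} (hz : z ∈ B) :
    ChordalEquicontinuousAt f z := by
  obtain ⟨ρ, hρ, hρB⟩ := Metric.isOpen_iff.mp hB z hz
  have hne : ∀ n : ℕ, ∀ w ∈ B, f^[n] w ≠ u := fun n w hw e => by
    have := h n w hw
    rw [e, sub_self, norm_zero] at this
    linarith
  have hbound : ∀ n : ℕ, ∀ w ∈ B, ‖(f^[n] w - u)⁻¹‖ ≤ r⁻¹ := fun n w hw => by
    rw [norm_inv]
    exact inv_anti₀ hr (h n w hw)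
  have hlip : ∀ n : ℕ, ∀ w ∈ Metric.ball z ρ,
      chordalDist (f^[n] z) (f^[n] w) ≤ (1 + ‖u‖) ^ 2 * (2 * r⁻¹ / ρ * dist w z) := by
    intro n w hw
    refine (chordalDist_le_norm_inv_sub_inv (hne n z hz) (hne n w (hρB hw))).trans ?_
    gcongr
    have hd : DifferentiableOn ℂ (fun w => (f^[n] w - u)⁻¹) (Metric.ball z ρ) := fun w hw =>
      (((hf.differentiableAt_iterate n (hB0 w (hρB hw))).sub_const u).inv
        (sub_ne_zero.mpr (hne n w (hρB hw)))).differentiableWithinAt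
    rw [← dist_eq_norm, dist_comm]
    refine Complex.dist_le_div_mul_dist_of_mapsTo_ball hd (fun w hw => ?_) hw
    rw [Metric.mem_closedBall, dist_eq_norm]
    have h1 := norm_sub_le (f^[n] w - u)⁻¹ (f^[n] z - u)⁻¹
    have h2 := hbound n w (hρB hw)
    have h3 := hbound n z hz
    linarith
  intro ε hε
  have hlim : Tendsto (fun w => (1 + ‖u‖) ^ 2 * (2 * r⁻¹ / ρ * dist w z)) (𝓝 z) (𝓝 0) := by
    have : Continuous fun w : ℂ => (1 + ‖u‖) ^ 2 * (2 * r⁻¹ / ρ * dist w z) := by fun_prop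
    simpa using this.tendsto z
  filter_upwards [hlim.eventually_lt_const hε, Metric.ball_mem_nhds z hρ] with w h1 h2 n
  exact (hlip n w h2).trans_lt h1

namespace IsEscapeIsolated

variable {f : ℂ → ℂ} {B U : Set ℂ}

theorem zero_notMem_closure_of_subset (hf : IsTranscendentalSelfMapCStar f)
    (h : IsEscapeIsolated f B) (n : ℕ) (hU : U ⊆ f^[n] '' B) :
    ((0 : ℂ) : OnePoint ℂ) ∉ closure ((fun z : ℂ => (z : OnePoint ℂ)) '' U) := by
  intro h0
  have hsub : U ⊆ f^[n] '' closure B := hU.trans (image_mono subset_closure)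
  have hcl := closure_minimal (image_mono (f := fun z : ℂ => (z : OnePoint ℂ)) hsub)
    ((h.isCompact_image hf n).image continuous_coe).isClosed h0
  obtain ⟨_, ⟨z, hz, rfl⟩, hz0⟩ := hcl
  exact hf.iterate_ne_zero n (h.ne_zero hz) (coe_injective hz0)

/-- An isolated set is a set of equicontinuity if there is a connected open set of escaping points
accumulating at the origin. -/
theorem chordalEquicontinuousAt (hf : IsTranscendentalSelfMapCStar f) (h : IsEscapeIsolated f B)
    (hUo : IsOpen U) (hUc : IsPreconnected U) (hne : U.Nonempty) (hUI : U ⊆ escapingSet f)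
    (h0 : ((0 : ℂ) : OnePoint ℂ) ∈ closure ((fun z : ℂ => (z : OnePoint ℂ)) '' U))
    {z : ℂ} (hz : z ∈ B) : ChordalEquicontinuousAt f z := by
  obtain ⟨u, hu⟩ := hne
  obtain ⟨r, hr, hrU⟩ := Metric.isOpen_iff.mp hUo u hu
  refine .of_omits hf h.isOpen (fun w hw => h.ne_zero (subset_closure hw)) hr
    (fun n w hw => ?_) hz (u := u)
  by_contra! hcon
  rw [← dist_eq_norm] at hcon
  exact h.zero_notMem_closure_of_subset hf n
    (h.subset_image hf n hUc hUI ⟨_, hrU hcon, mem_image_of_mem _ hw⟩) h0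

theorem isPreconnected_image (hf : IsTranscendentalSelfMapCStar f) (h : IsEscapeIsolated f B)
    (hBc : IsPreconnected B) (n : ℕ) : IsPreconnected (f^[n] '' B) :=
  hBc.image _ fun _ hz =>
    (hf.continuousAt_iterate n (h.ne_zero (subset_closure hz))).continuousWithinAt

theorem image_subset_escapingSet (hf : IsTranscendentalSelfMapCStar f)
    (hBI : B ⊆ escapingSet f) (n : ℕ) : f^[n] '' B ⊆ escapingSet f := by
  rintro _ ⟨z, hz, rfl⟩
  exact (escapingSet_iterate_mem hf n (hBI hz).1).mpr (hBI hz)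

theorem image_ne_image (hf : IsTranscendentalSelfMapCStar f) (h : IsEscapeIsolated f B)
    (hBI : B ⊆ escapingSet f) (hne : B.Nonempty) (n : ℕ) {d : ℕ} (hd : 0 < d) :
    f^[n] '' B ≠ f^[d + n] '' B := by
  intro heq
  rw [iterate_add, image_comp] at heq
  have hmap : MapsTo f^[d] (f^[n] '' B) (f^[n] '' B) := fun w hw => by
    rw [heq]
    exact mem_image_of_mem _ hw
  have hcomp := h.isCompact_image hf n
  obtain ⟨z, hz⟩ := hne
  have hzB : ∀ j : ℕ, f^[n + d * j] z ∈ f^[n] '' closure B := fun j => by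
    rw [add_comm, iterate_add_apply, iterate_mul]
    exact image_mono subset_closure (hmap.iterate j (mem_image_of_mem _ hz))
  obtain ⟨a, ha, hlow⟩ := hcomp.exists_pos_forall_lt continuous_norm.continuousOn (by
    rintro _ ⟨w, hw, rfl⟩
    exact norm_pos_iff.mpr (hf.iterate_ne_zero n (h.ne_zero hw)))
  obtain ⟨M, hM, hup⟩ := hcomp.exists_pos_forall_norm_lt continuousOn_id
  obtain ⟨N, hN⟩ := (hBI hz).2 (min a (1 / M)) (by positivity)
  have hle : N ≤ n + d * N := (Nat.le_mul_of_pos_left N hd).trans (Nat.le_add_left _ _)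
  rcases hN _ hle with h1 | h1
  · exact (hlow _ (hzB N)).not_ge (h1.le.trans (min_le_left _ _))
  · have h2 : M ≤ 1 / min a (1 / M) := by
      rw [le_one_div hM (by positivity)]
      exact min_le_right _ _
    exact (hup _ (hzB N)).not_ge (h2.trans h1.le)

/-- The iterated images of a connected isolated set of escaping points are pairwise disjoint. -/
theorem pairwise_disjoint_image (hf : IsTranscendentalSelfMapCStar f) (h : IsEscapeIsolated f B)
    (hBc : IsPreconnected B) (hBI : B ⊆ escapingSet f) (hne : B.Nonempty) :
    Pairwise (Disjoint on fun n : ℕ => f^[n] '' B) := by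
  have key : ∀ n m : ℕ, n < m → Disjoint (f^[n] '' B) (f^[m] '' B) := by
    intro n m hnm
    by_contra hcon
    rw [Set.not_disjoint_iff_nonempty_inter] at hcon
    have h1 := h.subset_image hf m (h.isPreconnected_image hf hBc n)
      (image_subset_escapingSet hf hBI n) hcon
    have h2 := h.subset_image hf n (h.isPreconnected_image hf hBc m)
      (image_subset_escapingSet hf hBI m) (inter_comm _ _ ▸ hcon)
    refine h.image_ne_image hf hBI hne n (Nat.sub_pos_of_lt hnm) ?_
    rw [Nat.sub_add_cancel hnm.le]
    exact h1.antisymm h2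
  intro n m hnm
  rcases hnm.lt_or_gt with h' | h'
  · exact key n m h'
  · exact (key m n h').symm

end IsEscapeIsolated

theorem integrableOn_ball_inv_norm (r : ℝ) :
    IntegrableOn (fun v : ℂ => ‖v‖⁻¹) (Metric.ball 0 r) := by
  rw [integrableOn_fun_norm_addHaar volume (f := fun y : ℝ => y⁻¹), Complex.finrank_real_complex]
  refine (integrableOn_const (C := (1 : ℝ)) (by simp)).congr_fun (fun y hy => ?_) measurableSet_Ioo
  simp [hy.1.ne']

theorem setIntegral_ball_inv_norm {r : ℝ} (hr : 0 ≤ r) :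
    ∫ v in Metric.ball (0 : ℂ) r, ‖v‖⁻¹ = 2 * volume.real (Metric.ball (0 : ℂ) 1) * r := by
  have h1 : (Metric.ball (0 : ℂ) r).indicator (fun v : ℂ => ‖v‖⁻¹) =
      fun v : ℂ => (Iio r).indicator (fun y : ℝ => y⁻¹) ‖v‖ := by
    ext v
    simp [indicator]
  rw [← integral_indicator measurableSet_ball, h1,
    integral_fun_norm_addHaar volume (fun y => (Iio r).indicator (fun y : ℝ => y⁻¹) y),
    Complex.finrank_real_complex]
  have h2 : ∫ y in Ioi (0 : ℝ), y ^ (2 - 1) • (Iio r).indicator (fun y : ℝ => y⁻¹) y =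
      ∫ y in Ioi (0 : ℝ), (Iio r).indicator (fun _ => (1 : ℝ)) y := by
    refine setIntegral_congr_fun measurableSet_Ioi fun y (hy : 0 < y) => ?_
    by_cases h : y < r <;> simp [h, hy.ne']
  rw [h2, setIntegral_indicator measurableSet_Iio, Ioi_inter_Iio]
  simp [hr]
  ring

/-- The Cauchy kernel is integrable over sets of finite area, with a bound in terms of the area. -/
theorem exists_setIntegral_inv_norm_sub_le : ∃ C > (0 : ℝ), ∀ E : Set ℂ, MeasurableSet E →
    volume E ≠ ⊤ → ∀ w : ℂ, IntegrableOn (fun ζ => ‖ζ - w‖⁻¹) E ∧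
      ∫ ζ in E, ‖ζ - w‖⁻¹ ≤ C * Real.sqrt (volume.real E) := by
  refine ⟨2 * volume.real (Metric.ball (0 : ℂ) 1) + 1, by positivity, fun E hE hEt w => ?_⟩
  have hball : ∀ r : ℝ, (fun ζ : ℂ => ζ - w) ⁻¹' Metric.ball 0 r = Metric.ball w r := fun r => by
    ext ζ
    simp [dist_eq_norm]
  have hmp : MeasurePreserving (fun ζ : ℂ => ζ - w) volume volume :=
    measurePreserving_sub_right volume w
  have hme : MeasurableEmbedding fun ζ : ℂ => ζ - w :=
    (Homeomorph.subRight w).measurableEmbedding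
  have hinteg : ∀ r, IntegrableOn (fun ζ => ‖ζ - w‖⁻¹) (Metric.ball w r) := fun r => by
    rw [← hball r]
    exact (hmp.integrableOn_comp_preimage hme).mpr (integrableOn_ball_inv_norm r)
  have hval : ∀ r, 0 ≤ r → ∫ ζ in Metric.ball w r, ‖ζ - w‖⁻¹ =
      2 * volume.real (Metric.ball (0 : ℂ) 1) * r := fun r hr => by
    rw [← hball r, hmp.setIntegral_preimage_emb hme (fun v : ℂ => ‖v‖⁻¹),
      setIntegral_ball_inv_norm hr]
  have hmeas : Measurable fun ζ : ℂ => ‖ζ - w‖⁻¹ := by fun_prop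
  have hfar : ∀ r > 0, ∀ ζ ∈ E \ Metric.ball w r, ‖‖ζ - w‖⁻¹‖ ≤ r⁻¹ := fun r hr ζ hζ => by
    have : r ≤ ‖ζ - w‖ := by simpa [dist_eq_norm] using hζ.2
    rw [norm_inv, norm_norm]
    exact inv_anti₀ hr this
  have hdt : ∀ r, volume (E \ Metric.ball w r) < ⊤ := fun r =>
    (measure_mono sdiff_subset).trans_lt hEt.lt_top
  have hinteg_far : ∀ r > 0, IntegrableOn (fun ζ => ‖ζ - w‖⁻¹) (E \ Metric.ball w r) := fun r hr =>
    Measure.integrableOn_of_bounded (hdt r).ne hmeas.aestronglyMeasurable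
      ((ae_restrict_iff' (hE.diff measurableSet_ball)).mpr (.of_forall (hfar r hr)))
  have hinteg_near : ∀ r, IntegrableOn (fun ζ => ‖ζ - w‖⁻¹) (E ∩ Metric.ball w r) := fun r =>
    (hinteg r).mono_set inter_subset_right
  refine ⟨(inter_union_sdiff E (Metric.ball w 1)) ▸
    (hinteg_near 1).union (hinteg_far 1 one_pos), ?_⟩
  rcases eq_or_ne (volume.real E) 0 with h0 | h0
  · rw [setIntegral_measure_zero _ ((measureReal_eq_zero_iff hEt).mp h0), h0]
    simp
  have hpos : 0 < volume.real E := lt_of_le_of_ne measureReal_nonneg h0.symm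
  set r := Real.sqrt (volume.real E) with hr
  have hr0 : 0 < r := Real.sqrt_pos.mpr hpos
  have hr2 : volume.real E = r ^ 2 := (Real.sq_sqrt hpos.le).symm
  rw [← integral_inter_add_sdiff (s := E) measurableSet_ball
    ((inter_union_sdiff E (Metric.ball w r)) ▸ (hinteg_near r).union (hinteg_far r hr0))]
  have h1 : ∫ ζ in E ∩ Metric.ball w r, ‖ζ - w‖⁻¹ ≤
      2 * volume.real (Metric.ball (0 : ℂ) 1) * r := by
    rw [← hval r hr0.le]
    exact setIntegral_mono_set (hinteg r) (.of_forall fun ζ => by positivity)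
      (LE.le.eventuallyLE inter_subset_right)
  have h2 : ∫ ζ in E \ Metric.ball w r, ‖ζ - w‖⁻¹ ≤ r := by
    refine (le_abs_self _).trans
      ((norm_setIntegral_le_of_norm_le_const (hdt r) (hfar r hr0)).trans ?_)
    rw [inv_mul_le_iff₀ hr0, ← pow_two, ← hr2]
    exact measureReal_mono sdiff_subset hEt
  exact (add_le_add h1 h2).trans_eq (by ring)

/-- The Cauchy kernel against a compactly supported bounded density. -/
theorem integrable_mul_inv_sub {g : ℂ → ℂ} (hg : Continuous g) (hc : HasCompactSupport g) (w : ℂ) :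
    Integrable fun ζ => g ζ * (ζ - w)⁻¹ := by
  obtain ⟨C, -, hC⟩ := exists_setIntegral_inv_norm_sub_le
  obtain ⟨M, hM⟩ := hc.exists_bound_of_continuous hg
  have h := (hC (tsupport g) (isClosed_tsupport g).measurableSet hc.measure_ne_top w).1
  rw [← integrableOn_iff_integrable_of_support_subset (s := tsupport g)
    (fun ζ hζ => subset_tsupport g (left_ne_zero_of_mul hζ))]
  refine (h.const_mul M).mono' (by fun_prop) (.of_forall fun ζ => ?_)
  rw [norm_mul, norm_inv]
  exact mul_le_mul_of_nonneg_right (hM ζ) (by positivity)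

/-- The bump `(2 / i) ∂/∂v̄` of the regularised Cauchy kernel at unit scale. -/
def kernelBump (v : ℂ) : ℝ := 6 * (max 0 (1 - normSq v)) ^ 2

theorem continuous_kernelBump : Continuous kernelBump := by
  unfold kernelBump
  have := contDiff_normSq.continuous
  fun_prop

theorem hasCompactSupport_kernelBump : HasCompactSupport kernelBump := by
  refine HasCompactSupport.intro (isCompact_closedBall (0 : ℂ) 1) fun v hv => ?_
  rw [Metric.mem_closedBall, dist_zero_right, not_le] at hv
  have : max 0 (1 - normSq v) = 0 := max_eq_left (by rw [normSq_eq_norm_sq]; nlinarith)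
  simp [kernelBump, this]

theorem integral_kernelBump_pos : 0 < ∫ v, kernelBump v :=
  continuous_kernelBump.integral_pos_of_hasCompactSupport_nonneg_nonzero (x := 0)
    hasCompactSupport_kernelBump (fun v => by simp only [kernelBump, Pi.zero_apply]; positivity)
    (by simp [kernelBump])

theorem norm_regKernel_le (δ : ℝ) (v : ℂ) : ‖regKernel δ v‖ ≤ ‖v⁻¹‖ := by
  have h0 : 0 ≤ normSq v / δ ^ 2 := div_nonneg (normSq_nonneg v) (sq_nonneg δ)
  have h1 : (max 0 (1 - normSq v / δ ^ 2)) ^ 3 ≤ 1 :=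
    pow_le_one₀ (le_max_left _ _) (max_le zero_le_one (by linarith))
  have h2 : 0 ≤ (max 0 (1 - normSq v / δ ^ 2)) ^ 3 := by positivity
  rw [regKernel, div_eq_mul_inv, norm_mul, norm_real, Real.norm_of_nonneg (by linarith)]
  exact mul_le_of_le_one_left (norm_nonneg _) (by linarith)

theorem integral_dbar_mul_regKernel {θ : ℂ → ℂ} (hθ : ContDiff ℝ 1 θ) (hc : HasCompactSupport θ)
    {δ : ℝ} (hδ : 0 < δ) (w : ℂ) :
    ∫ ζ, dbar θ ζ * regKernel δ (ζ - w) = -∫ v, θ (w + δ • v) * kernelBump v := by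
  have hk : ContDiff ℝ 1 fun ζ => regKernel δ (ζ - w) :=
    (contDiff_regKernel hδ).comp (contDiff_id.sub contDiff_const)
  have hprod := integral_dbar_eq_zero (hθ.mul hk) hc.mul_right
  have hpt : ∀ ζ, dbar (fun ζ => θ ζ * regKernel δ (ζ - w)) ζ =
      dbar θ ζ * regKernel δ (ζ - w) + θ ζ * dbar (regKernel δ) (ζ - w) := fun ζ => by
    have h := dbar_comp (η := regKernel δ) (F := fun ζ => ζ - w) (z := ζ)
      ((contDiff_regKernel hδ).differentiable one_ne_zero _) (by fun_prop)
    rw [dbar_mul (hθ.differentiable one_ne_zero ζ) (hk.differentiable one_ne_zero ζ), h]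
    simp
  have hcd : HasCompactSupport (dbar θ) :=
    (hc.fderiv (𝕜 := ℝ)).of_isClosed_subset (isClosed_tsupport _) (tsupport_dbar_subset θ)
  have i1 : Integrable fun ζ => dbar θ ζ * regKernel δ (ζ - w) :=
    (hθ.continuous_dbar.mul hk.continuous).integrable_of_hasCompactSupport hcd.mul_right
  have i2 : Integrable fun ζ => θ ζ * dbar (regKernel δ) (ζ - w) :=
    (hθ.continuous.mul ((contDiff_regKernel hδ).continuous_dbar.comp
      (continuous_id.sub continuous_const))).integrable_of_hasCompactSupport hc.mul_right
  have hsub : ∫ ζ, θ ζ * dbar (regKernel δ) (ζ - w) = ∫ v, θ (w + δ • v) * kernelBump v := by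
    rw [← integral_add_left_eq_self _ w]
    have h := Measure.integral_comp_smul volume
      (fun v : ℂ => θ (w + v) * dbar (regKernel δ) (w + v - w)) δ
    rw [Complex.finrank_real_complex, abs_of_pos (by positivity)] at h
    have hd : ((δ ^ 2)⁻¹ : ℝ) ≠ 0 := by positivity
    refine smul_right_injective _ hd ?_
    simp only
    rw [← h, ← integral_smul]
    congr 1
    ext v
    rw [add_sub_cancel_left, dbar_regKernel hδ, real_smul, kernelBump]
    have hn : normSq ((δ : ℂ) * v) / δ ^ 2 = normSq v := by
      rw [map_mul, normSq_ofReal]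
      field_simp
    rw [hn, real_smul]
    push_cast
    ring
  simp only [hpt] at hprod
  rw [integral_add i1 i2] at hprod
  rw [← hsub]
  exact eq_neg_of_add_eq_zero_left hprod

/-- The Cauchy–Pompeiu formula for a compactly supported function. -/
theorem integral_dbar_mul_inv_sub {θ : ℂ → ℂ} (hθ : ContDiff ℝ 1 θ) (hc : HasCompactSupport θ)
    (w : ℂ) : ∫ ζ, dbar θ ζ * (ζ - w)⁻¹ = -(θ w * (∫ v, kernelBump v : ℝ)) := by
  have hcd : HasCompactSupport (dbar θ) :=
    (hc.fderiv (𝕜 := ℝ)).of_isClosed_subset (isClosed_tsupport _) (tsupport_dbar_subset θ)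
  have l1 : Tendsto (fun δ : ℝ => ∫ ζ, dbar θ ζ * regKernel δ (ζ - w)) (𝓝[>] 0)
      (𝓝 (∫ ζ, dbar θ ζ * (ζ - w)⁻¹)) := by
    refine tendsto_integral_filter_of_dominated_convergence
      (fun ζ => ‖dbar θ ζ * (ζ - w)⁻¹‖) ?_ ?_
      (integrable_mul_inv_sub hθ.continuous_dbar hcd w).norm ?_
    · filter_upwards [self_mem_nhdsWithin] with δ hδ
      have := hθ.continuous_dbar
      have := (contDiff_regKernel hδ).continuous
      exact Continuous.aestronglyMeasurable (by fun_prop)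
    · refine .of_forall fun δ => .of_forall fun ζ => ?_
      rw [norm_mul, norm_mul]
      gcongr
      exact norm_regKernel_le δ _
    · filter_upwards [compl_mem_ae_iff.mpr (measure_singleton w)] with ζ hζ
      have hpos : 0 < ‖ζ - w‖ := norm_pos_iff.mpr (sub_ne_zero.mpr hζ)
      refine tendsto_const_nhds.congr' ?_
      filter_upwards [Ioo_mem_nhdsGT hpos] with δ hδ
      rw [regKernel_eq_inv hδ.1 hδ.2.le, one_div]
  have l2 : Tendsto (fun δ : ℝ => ∫ v, θ (w + δ • v) * kernelBump v) (𝓝[>] 0)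
      (𝓝 (∫ v, θ w * kernelBump v)) := by
    obtain ⟨M, hM⟩ := hc.exists_bound_of_continuous hθ.continuous
    have hb := continuous_kernelBump
    have hbi : Integrable fun v => (kernelBump v : ℂ) :=
      (hb.integrable_of_hasCompactSupport hasCompactSupport_kernelBump).ofReal
    have hθc := hθ.continuous
    refine tendsto_integral_filter_of_dominated_convergence
      (fun v => M * ‖(kernelBump v : ℂ)‖) ?_ ?_ (hbi.norm.const_mul M) ?_
    · exact .of_forall fun δ => Continuous.aestronglyMeasurable (by fun_prop)
    · refine .of_forall fun δ => .of_forall fun v => ?_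
      rw [norm_mul]
      exact mul_le_mul_of_nonneg_right (hM _) (norm_nonneg _)
    · refine .of_forall fun v => ?_
      have : Continuous fun δ : ℝ => θ (w + δ • v) * (kernelBump v : ℂ) := by fun_prop
      simpa using (this.tendsto 0).mono_left nhdsWithin_le_nhds
  have l3 : Tendsto (fun δ : ℝ => ∫ ζ, dbar θ ζ * regKernel δ (ζ - w)) (𝓝[>] 0)
      (𝓝 (-∫ v, θ w * kernelBump v)) := by
    refine l2.neg.congr' ?_
    filter_upwards [self_mem_nhdsWithin] with δ hδ
    exact (integral_dbar_mul_regKernel hθ hc hδ w).symm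
  rw [tendsto_nhds_unique l1 l3, integral_const_mul, integral_complex_ofReal]

/-- A Cauchy integral over the complement of an open set is holomorphic on that set. -/
theorem differentiableOn_setIntegral_mul_inv_sub {g : ℂ → ℂ} (hg : Continuous g)
    (hc : HasCompactSupport g) {V : Set ℂ} (hV : IsOpen V) :
    DifferentiableOn ℂ (fun w => ∫ ζ in Vᶜ, g ζ * (ζ - w)⁻¹) V := by
  intro w hw
  obtain ⟨ρ, hρ, hρV⟩ := Metric.isOpen_iff.mp hV w hw
  have hfar : ∀ ζ ∈ Vᶜ, ∀ x ∈ Metric.ball w (ρ / 2), ρ / 2 ≤ ‖ζ - x‖ := fun ζ hζ x hx => by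
    have h1 : ρ ≤ dist ζ w := by
      by_contra! h
      exact hζ (hρV h)
    have h2 := dist_triangle ζ x w
    have h3 : dist x w < ρ / 2 := hx
    rw [← dist_eq_norm]
    linarith
  have hmeas : ∀ x, AEStronglyMeasurable (fun ζ => g ζ * (ζ - x)⁻¹) (volume.restrict Vᶜ) :=
    fun x => (integrable_mul_inv_sub hg hc x).aestronglyMeasurable.restrict
  have hgm := hg.measurable
  have h := hasDerivAt_integral_of_dominated_loc_of_deriv_le (𝕜 := ℂ) (μ := volume.restrict Vᶜ)
    (F := fun x ζ => g ζ * (ζ - x)⁻¹) (F' := fun x ζ => g ζ * ((ζ - x) ^ 2)⁻¹)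
    (x₀ := w) (s := Metric.ball w (ρ / 2)) (bound := fun ζ => ‖g ζ‖ * ((ρ / 2) ^ 2)⁻¹)
    (Metric.ball_mem_nhds w (half_pos hρ)) (.of_forall hmeas)
    (integrable_mul_inv_sub hg hc w).integrableOn
    (Measurable.aestronglyMeasurable (by fun_prop)) ?_ ?_ ?_
  · exact h.2.differentiableAt.differentiableWithinAt
  · refine (ae_restrict_iff' hV.measurableSet.compl).mpr (.of_forall fun ζ hζ x hx => ?_)
    rw [norm_mul, norm_inv, norm_pow]
    gcongr
    exact hfar ζ hζ x hx
  · exact ((hg.integrable_of_hasCompactSupport hc).norm.mul_const _).integrableOn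
  · refine (ae_restrict_iff' hV.measurableSet.compl).mpr (.of_forall fun ζ hζ x hx => ?_)
    have hne : ζ - x ≠ 0 := norm_pos_iff.mp ((half_pos hρ).trans_le (hfar ζ hζ x hx))
    have h1 := (((hasDerivAt_id x).const_sub ζ).inv hne).const_mul (g ζ)
    refine h1.congr_deriv ?_
    simp [div_eq_mul_inv]

/-- On an open set, a compactly supported function is approximated by a holomorphic one, up to an
error controlled by the area of the set. -/
theorem exists_holomorphic_approximation {θ : ℂ → ℂ} (hθ : ContDiff ℝ 1 θ)
    (hc : HasCompactSupport θ) : ∃ C > 0, ∀ V : Set ℂ, IsOpen V → ∃ H : ℂ → ℂ,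
      DifferentiableOn ℂ H V ∧
        ∀ w ∈ V, ‖H w - θ w‖ ≤ C * Real.sqrt (volume.real (V ∩ tsupport θ)) := by
  obtain ⟨C, hC0, hC⟩ := exists_setIntegral_inv_norm_sub_le
  have hg := hθ.continuous_dbar
  have hcd : HasCompactSupport (dbar θ) :=
    (hc.fderiv (𝕜 := ℝ)).of_isClosed_subset (isClosed_tsupport _) (tsupport_dbar_subset θ)
  have hsupp : ∀ ζ, ζ ∉ tsupport θ → dbar θ ζ = 0 := fun ζ hζ =>
    image_eq_zero_of_notMem_tsupport fun h =>
      hζ (tsupport_fderiv_subset ℝ (tsupport_dbar_subset θ h))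
  obtain ⟨M, hM⟩ := hcd.exists_bound_of_continuous hg
  have hM0 : 0 ≤ M := (norm_nonneg _).trans (hM 0)
  set c : ℝ := ∫ v, kernelBump v with hcdef
  have hc0 : 0 < c := integral_kernelBump_pos
  have hcc : (c : ℂ) ≠ 0 := ofReal_ne_zero.mpr hc0.ne'
  refine ⟨c⁻¹ * ((M + 1) * C), by positivity, fun V hV =>
    ⟨fun w => -(c : ℂ)⁻¹ * ∫ ζ in Vᶜ, dbar θ ζ * (ζ - w)⁻¹,
      (differentiableOn_setIntegral_mul_inv_sub hg hcd hV).const_mul _, fun w _ => ?_⟩⟩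
  have hsplit := integral_add_compl hV.measurableSet (integrable_mul_inv_sub hg hcd w)
  rw [integral_dbar_mul_inv_sub hθ hc w, ← hcdef] at hsplit
  have heq : -(c : ℂ)⁻¹ * (∫ ζ in Vᶜ, dbar θ ζ * (ζ - w)⁻¹) - θ w =
      (c : ℂ)⁻¹ * ∫ ζ in V, dbar θ ζ * (ζ - w)⁻¹ := by
    have : θ w = -(c : ℂ)⁻¹ * -(θ w * c) := by field_simp
    rw [this, ← hsplit]
    ring
  simp only [heq, norm_mul, norm_inv, norm_real, Real.norm_of_nonneg hc0.le]
  rw [mul_assoc, mul_assoc]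
  gcongr
  have hE : MeasurableSet (V ∩ tsupport θ) :=
    hV.measurableSet.inter (isClosed_tsupport θ).measurableSet
  have hEt : volume (V ∩ tsupport θ) ≠ ⊤ :=
    ((measure_mono inter_subset_right).trans_lt hc.measure_lt_top).ne
  obtain ⟨hi, hle⟩ := hC _ hE hEt w
  have hres : ∫ ζ in V, dbar θ ζ * (ζ - w)⁻¹ = ∫ ζ in V ∩ tsupport θ, dbar θ ζ * (ζ - w)⁻¹ :=
    setIntegral_eq_of_subset_of_forall_sdiff_eq_zero hV.measurableSet inter_subset_left
      fun ζ hζ => by rw [hsupp ζ fun h => hζ.2 ⟨hζ.1, h⟩, zero_mul]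
  rw [hres]
  calc ‖∫ ζ in V ∩ tsupport θ, dbar θ ζ * (ζ - w)⁻¹‖
      ≤ ∫ ζ in V ∩ tsupport θ, (M + 1) * ‖ζ - w‖⁻¹ := by
        refine norm_integral_le_of_norm_le (hi.const_mul _) (.of_forall fun ζ => ?_)
        rw [norm_mul, norm_inv]
        gcongr
        exact (hM ζ).trans (by linarith)
    _ = (M + 1) * ∫ ζ in V ∩ tsupport θ, ‖ζ - w‖⁻¹ := integral_const_mul _ _
    _ ≤ (M + 1) * (C * Real.sqrt (volume.real (V ∩ tsupport θ))) := by gcongr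

/-- The minimum principle for real parts of holomorphic functions on bounded domains. -/
theorem le_re_of_forall_frontier_eventually_le_re {G : Set ℂ} (hGo : IsOpen G)
    (hGc : IsPreconnected G) (hGb : Bornology.IsBounded G) {P : ℂ → ℂ}
    (hP : DifferentiableOn ℂ P G) {m : ℝ}
    (hm : ∀ b ∈ frontier G, ∀ᶠ w in 𝓝[G] b, m ≤ (P w).re) {z : ℂ} (hz : z ∈ G) :
    m ≤ (P z).re := by
  by_contra! hlt
  set L := {w ∈ G | (P w).re ≤ (P z).re} with hL
  have hcont : ContinuousOn (fun w => (P w).re) G :=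
    continuous_re.comp_continuousOn hP.continuousOn
  have hLcl : IsClosed L := by
    refine isClosed_of_closure_subset fun b hb => ?_
    have hfreq : ∃ᶠ w in 𝓝[G] b, (P w).re ≤ (P z).re := by
      rw [mem_closure_iff_frequently] at hb
      rw [frequently_nhdsWithin_iff]
      exact hb.mono fun w hw => ⟨hw.2, hw.1⟩
    by_cases hbG : b ∈ G
    · refine ⟨hbG, ?_⟩
      exact le_of_tendsto_of_frequently (hcont b hbG) hfreq
    · have hbf : b ∈ frontier G := by
        rw [hGo.frontier_eq]
        exact ⟨closure_mono (sep_subset G _) hb, hbG⟩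
      obtain ⟨w, hw1, hw2⟩ := (hfreq.and_eventually (hm b hbf)).exists
      linarith
  have hLc : IsCompact L :=
    Metric.isCompact_of_isClosed_isBounded hLcl (hGb.subset (sep_subset G _))
  obtain ⟨z₁, hz₁, hmin⟩ := hLc.exists_isMinOn ⟨z, hz, le_rfl⟩ (hcont.mono (sep_subset G _))
  have hminG : ∀ w ∈ G, (P z₁).re ≤ (P w).re := fun w hw => by
    by_cases h : (P w).re ≤ (P z).re
    · exact hmin ⟨hw, h⟩
    · exact hz₁.2.trans (not_le.mp h).le
  have hmax : IsMaxOn (norm ∘ fun w => exp (-P w)) G z₁ := fun w hw => by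
    simpa [norm_exp] using hminG w hw
  have hconst := norm_eqOn_of_isPreconnected_of_isMaxOn hGc hGo hP.neg.cexp hz₁.1 hmax
  have hGL : G = L := Subset.antisymm (fun w hw => ⟨hw, by
    have h := hconst hw
    simp only [comp_apply, const_apply, norm_exp, Real.exp_eq_exp] at h
    exact (neg_inj.mp h).trans_le hz₁.2⟩) (sep_subset G _)
  have huniv : G = univ := IsClopen.eq_univ ⟨hGL ▸ hLcl, hGo⟩ ⟨z, hz⟩
  exact NormedSpace.unbounded_univ ℝ ℂ (huniv ▸ hGb)

/-- Holomorphic functions with nonnegative real part on the members of a disjoint sequence of open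
sets, which are summably small where the cutoff `θ` vanishes and large where it is close to one. -/
theorem exists_holomorphic_barriers {θ : ℂ → ℝ} (hθ : ContDiff ℝ 1 θ) (hc : HasCompactSupport θ)
    {V : ℕ → Set ℂ} (hV : ∀ n, IsOpen (V n)) (hd : Pairwise (Disjoint on V)) :
    ∃ (q : ℕ → ℂ → ℂ) (s : ℕ → ℝ), Summable s ∧ (∀ n, 0 ≤ s n) ∧
      (∀ n, DifferentiableOn ℂ (q n) (V n)) ∧ (∀ n, ∀ w ∈ V n, 0 ≤ (q n w).re) ∧
      (∀ n, ∀ w ∈ V n, θ w = 0 → (q n w).re ≤ s n) ∧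
      ∀ᶠ n in atTop, ∀ w ∈ V n, 7 / 8 < θ w → 1 / 2 ≤ (q n w).re := by
  obtain ⟨C, hC0, hC⟩ := exists_holomorphic_approximation (contDiff_ofReal_comp hθ)
    (hc.comp_left ofReal_zero)
  set T := tsupport fun z => (θ z : ℂ)
  have hT : IsCompact T := hc.comp_left (g := fun x : ℝ => (x : ℂ)) ofReal_zero
  choose H hHd hH using fun n => hC (V n) (hV n)
  set ε : ℕ → ℝ := fun n => C * Real.sqrt (volume.real (V n ∩ T)) with hε
  have hε0 : ∀ n, 0 ≤ ε n := fun n => by positivity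
  have hsum : Summable fun n => 2 * ε n ^ 2 := by
    have : IsFiniteMeasure (volume.restrict T) := ⟨by simpa using hT.measure_lt_top⟩
    have h := summable_measure_toReal (μ := volume.restrict T) (fun n => (hV n).measurableSet) hd
    refine (h.mul_left (2 * C ^ 2)).congr fun n => ?_
    rw [measureReal_restrict_apply (hV n).measurableSet, hε]
    simp only [mul_pow, Real.sq_sqrt measureReal_nonneg]
    ring
  have hre : ∀ n w, (H n w ^ 2 + ((ε n : ℝ) : ℂ) ^ 2).re =
      (H n w).re ^ 2 - (H n w).im ^ 2 + ε n ^ 2 := fun n w => by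
    simp [pow_two]
  have him : ∀ n, ∀ w ∈ V n, (H n w).im ^ 2 ≤ ε n ^ 2 := fun n w hw => by
    have h := (abs_im_le_norm _).trans (hH n w hw)
    rw [sub_im, ofReal_im, sub_zero] at h
    exact sq_le_sq' (abs_le.mp h).1 (abs_le.mp h).2
  have hreθ : ∀ n, ∀ w ∈ V n, |(H n w).re - θ w| ≤ ε n := fun n w hw => by
    have h := (abs_re_le_norm _).trans (hH n w hw)
    rwa [sub_re, ofReal_re] at h
  refine ⟨fun n w => H n w ^ 2 + ((ε n : ℝ) : ℂ) ^ 2, fun n => 2 * ε n ^ 2, hsum,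
    fun n => by positivity, fun n => ((hHd n).pow 2).add_const _, fun n w hw => ?_,
    fun n w hw h0 => ?_, ?_⟩
  · rw [hre]
    nlinarith [him n w hw, sq_nonneg (H n w).re]
  · have h := hreθ n w hw
    rw [h0, sub_zero] at h
    rw [hre]
    nlinarith [sq_nonneg (H n w).im, sq_le_sq' (abs_le.mp h).1 (abs_le.mp h).2]
  · filter_upwards [hsum.tendsto_atTop_zero.eventually_lt_const (show (0 : ℝ) < 1 / 32 by norm_num)]
      with n hn w hw hw1
    have hε1 : ε n ≤ 1 / 8 := by nlinarith [hε0 n]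
    have h := (abs_le.mp (hreθ n w hw)).1
    rw [hre]
    nlinarith [him n w hw]

/-- Harmonic barriers along an orbit of disjoint images, summing to at most `1 / 4` at a given
escaping point, one of which is at least `1 / 2` near any given boundary point. -/
theorem IsEscapeIsolated.exists_barriers {f : ℂ → ℂ} (hf : IsTranscendentalSelfMapCStar f)
    {G : Set ℂ} (hG : IsEscapeIsolated f G)
    (hdis : Pairwise (Disjoint on fun n : ℕ => f^[n] '' G)) {z : ℂ} (hzG : z ∈ G)
    (hz : z ∈ escapingSet f) :
    ∃ Q : ℕ → ℕ → ℂ → ℂ, (∀ k n, DifferentiableOn ℂ (Q k n) G) ∧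
      (∀ k n, ∀ w ∈ G, 0 ≤ (Q k n w).re) ∧
      (∀ k M, ∑ n ∈ Finset.range M, (Q k n z).re ≤ (1 / 2) ^ k / 8) ∧
      ∀ b ∈ frontier G, ∃ k n, ∀ᶠ w in 𝓝[G] b, 1 / 2 ≤ (Q k n w).re := by
  have hcut : ∀ k : ℕ, ∃ θ : ℂ → ℝ, ContDiff ℝ 1 θ ∧ HasCompactSupport θ ∧
      (∀ w, (1 : ℝ) / (k + 1) ≤ ‖w‖ → ‖w‖ ≤ k + 1 → θ w = 1) ∧
      ∀ w, (‖w‖ < 1 / (k + 2 : ℝ) ∨ (k + 2 : ℝ) < ‖w‖) → θ w = 0 := fun k => by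
    have hK : IsCompact {w : ℂ | (1 : ℝ) / (k + 1) ≤ ‖w‖ ∧ ‖w‖ ≤ k + 1} := by
      refine (isCompact_closedBall (0 : ℂ) (k + 1)).of_isClosed_subset ?_ fun w hw => by
        simpa using hw.2
      exact (isClosed_le continuous_const continuous_norm).inter
        (isClosed_le continuous_norm continuous_const)
    have hO : IsOpen {w : ℂ | (1 : ℝ) / (k + 2) < ‖w‖ ∧ ‖w‖ < k + 2} :=
      (isOpen_lt continuous_const continuous_norm).inter
        (isOpen_lt continuous_norm continuous_const)
    obtain ⟨θ, h1, h2, h3, h4, -⟩ := exists_smooth_cutoff hK hO fun w hw =>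
      ⟨lt_of_lt_of_le (by gcongr; norm_num) hw.1, lt_of_le_of_lt hw.2 (by linarith)⟩
    refine ⟨θ, h1.of_le (by norm_num), h2,
      fun w hw1 hw2 => subset_of_mem_nhdsSet h4 ⟨hw1, hw2⟩, fun w hw => ?_⟩
    refine image_eq_zero_of_notMem_tsupport fun h => ?_
    obtain ⟨ha, hb⟩ := h3 h
    rcases hw with hw | hw <;> linarith
  choose θ hθ hθc hθ1 hθ0 using hcut
  choose q s hs hs0 hqd hq0 hqs hq1 using fun k =>
    exists_holomorphic_barriers (hθ k) (hθc k) (hG.isOpen_image hf) hdis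
  have hN : ∀ k, ∃ N : ℕ, ∑' n, s k (n + N) < (1 / 2) ^ k / 8 ∧
      (∀ n ≥ N, θ k (f^[n] z) = 0) ∧
      ∀ n ≥ N, ∀ w ∈ f^[n] '' G, 7 / 8 < θ k w → 1 / 2 ≤ (q k n w).re := fun k => by
    obtain ⟨N₀, hN₀⟩ := hz.2 (1 / (k + 2)) (by positivity)
    have h1 := (tendsto_sum_nat_add (s k)).eventually_lt_const
      (show (0 : ℝ) < (1 / 2) ^ k / 8 by positivity)
    obtain ⟨N₁, hN₁⟩ := eventually_atTop.mp (hq1 k)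
    obtain ⟨N, hN, hNN⟩ := (h1.and (eventually_ge_atTop (max N₀ N₁))).exists
    refine ⟨N, hN, fun n hn => hθ0 k _ ?_,
      fun n hn => hN₁ n ((le_max_right _ _).trans (hNN.trans hn))⟩
    simpa using hN₀ n ((le_max_left _ _).trans (hNN.trans hn))
  choose N hNs hNθ hNq using hN
  refine ⟨fun k n w => q k (n + N k) (f^[n + N k] w), fun k n => ?_, fun k n w hw =>
    hq0 k _ _ (mem_image_of_mem _ hw), fun k M => ?_, fun b hb => ?_⟩
  · exact (hqd k (n + N k)).comp ((hf.differentiableOn_iterate _).mono fun w hw =>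
      hG.ne_zero (subset_closure hw)) (mapsTo_image _ _)
  · calc ∑ n ∈ Finset.range M, (q k (n + N k) (f^[n + N k] z)).re
        ≤ ∑ n ∈ Finset.range M, s k (n + N k) := Finset.sum_le_sum fun n _ =>
          hqs k _ _ (mem_image_of_mem _ hzG) (hNθ k _ (Nat.le_add_left _ _))
      _ ≤ ∑' n, s k (n + N k) :=
        ((summable_nat_add_iff (N k)).mpr (hs k)).sum_le_tsum _ fun n _ => hs0 k _
      _ ≤ (1 / 2) ^ k / 8 := (hNs k).le
  · have hb0 : b ≠ 0 := hG.ne_zero (frontier_subset_closure hb)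
    have hbI := hG.frontier_notMem b hb
    simp only [escapingSet, mem_ofPred_eq, not_and, not_forall, not_exists, not_or, not_lt] at hbI
    obtain ⟨ε, hε, hb'⟩ := hbI hb0
    obtain ⟨k, hk⟩ := exists_nat_one_div_lt hε
    obtain ⟨n, hn, hn1, hn2⟩ := hb' (N k)
    have hθb : θ k (f^[n] b) = 1 := by
      refine hθ1 k _ (hk.le.trans hn1) (hn2.trans ?_)
      rw [div_le_iff₀ hε]
      rw [div_lt_iff₀ (by positivity)] at hk
      linarith
    obtain ⟨m, rfl⟩ := Nat.exists_eq_add_of_le' hn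
    have hev : ∀ᶠ w in 𝓝 b, 7 / 8 < θ k (f^[m + N k] w) :=
      ((hθ k).continuous.continuousAt.comp (hf.continuousAt_iterate _ hb0)).eventually_const_lt
        (by simp only [comp_apply, hθb]; norm_num)
    refine ⟨k, m, ?_⟩
    filter_upwards [hev.filter_mono nhdsWithin_le_nhds, self_mem_nhdsWithin] with w hw hwG
    exact hNq k _ hn _ (mem_image_of_mem _ hwG) hw

/-- Bounded domains whose images are disjoint and which are isolated in the escaping set cannot
contain escaping points. -/
theorem IsEscapeIsolated.notMem_escapingSet {f : ℂ → ℂ} (hf : IsTranscendentalSelfMapCStar f)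
    {G : Set ℂ} (hG : IsEscapeIsolated f G) (hGc : IsPreconnected G)
    (hdis : Pairwise (Disjoint on fun n : ℕ => f^[n] '' G)) {z : ℂ} (hzG : z ∈ G) :
    z ∉ escapingSet f := by
  intro hz
  obtain ⟨Q, hQd, hQ0, hQz, hQb⟩ := hG.exists_barriers hf hdis hzG hz
  set P : ℕ → ℂ → ℂ := fun K w => ∑ k ∈ Finset.range K, ∑ n ∈ Finset.range K, Q k n w with hP
  have hPre : ∀ K w, (P K w).re =
      ∑ k ∈ Finset.range K, ∑ n ∈ Finset.range K, (Q k n w).re := fun K w => by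
    simp [hP]
  have hPge : ∀ K, ∀ k < K, ∀ n < K, ∀ w ∈ G, (Q k n w).re ≤ (P K w).re :=
    fun K k hk n hn w hw => by
      rw [hPre]
      calc (Q k n w).re ≤ ∑ n ∈ Finset.range K, (Q k n w).re :=
            Finset.single_le_sum (f := fun n => (Q k n w).re) (fun n _ => hQ0 k n w hw)
              (Finset.mem_range.mpr hn)
        _ ≤ _ := Finset.single_le_sum (f := fun k => ∑ n ∈ Finset.range K, (Q k n w).re)
          (fun k _ => Finset.sum_nonneg fun n _ => hQ0 k n w hw) (Finset.mem_range.mpr hk)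
  have hfc : IsCompact (frontier G) :=
    hG.isCompact_closure.of_isClosed_subset isClosed_frontier frontier_subset_closure
  obtain ⟨K₀, hK₀⟩ : ∃ K₀, ∀ K ≥ K₀, ∀ b ∈ frontier G, ∀ᶠ w in 𝓝[G] b, 1 / 2 ≤ (P K w).re := by
    refine hfc.induction_on
      (p := fun S => ∃ K₀, ∀ K ≥ K₀, ∀ b ∈ S, ∀ᶠ w in 𝓝[G] b, 1 / 2 ≤ (P K w).re)
      ⟨0, fun _ _ _ hb => hb.elim⟩ (fun S S' hS ⟨K₀, h⟩ => ⟨K₀, fun K hK b hb => h K hK b (hS hb)⟩)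
      (fun S S' ⟨K₀, h⟩ ⟨K₁, h'⟩ => ⟨max K₀ K₁, fun K hK b hb => hb.elim
        (h K ((le_max_left _ _).trans hK) b) (h' K ((le_max_right _ _).trans hK) b)⟩) fun b hb => ?_
    obtain ⟨k, n, hkn⟩ := hQb b hb
    rw [eventually_nhdsWithin_iff] at hkn
    refine ⟨_, mem_nhdsWithin_of_mem_nhds (eventually_eventually_nhds.mpr hkn), max k n + 1,
      fun K hK b' hb' => ?_⟩
    rw [eventually_nhdsWithin_iff]
    filter_upwards [show ∀ᶠ w in 𝓝 b', w ∈ G → 1 / 2 ≤ (Q k n w).re from hb'] with w hw hwG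
    exact (hw hwG).trans (hPge K k (by omega) n (by omega) w hwG)
  have hlow := le_re_of_forall_frontier_eventually_le_re hG.isOpen hGc hG.isBounded
    (DifferentiableOn.fun_sum fun k _ => DifferentiableOn.fun_sum fun n _ => hQd k n)
    (hK₀ K₀ le_rfl) hzG
  have hup : (P K₀ z).re ≤ 1 / 4 := by
    rw [hPre]
    calc _ ≤ ∑ k ∈ Finset.range K₀, (1 / 2 : ℝ) ^ k / 8 := Finset.sum_le_sum fun k _ => hQz k K₀
      _ = (∑ k ∈ Finset.range K₀, (1 / 2 : ℝ) ^ k) / 8 := (Finset.sum_div _ _ _).symm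
      _ ≤ 2 / 8 := by
        gcongr
        exact sum_geometric_two_le K₀
      _ = 1 / 4 := by norm_num
  linarith

theorem isPreconnected_escapingSphere {f : ℂ → ℂ} (hf : IsTranscendentalSelfMapCStar f)
    {U : Set ℂ} (hUo : IsOpen U) (hUc : IsPreconnected U) (hne : U.Nonempty)
    (hUI : U ⊆ escapingSet f)
    (h0 : ((0 : ℂ) : OnePoint ℂ) ∈ closure ((fun z : ℂ => (z : OnePoint ℂ)) '' U))
    (hi : ∞ ∈ closure ((fun z : ℂ => (z : OnePoint ℂ)) '' U)) :
    IsPreconnected (escapingSphere f) := by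
  by_contra hcon
  obtain ⟨B, hB, z, hzB, hzI⟩ := exists_isEscapeIsolated hUc hUI h0 hi hcon
  have hG := hB.connectedComponentIn z
  have hzG : z ∈ _root_.connectedComponentIn B z := mem_connectedComponentIn hzB
  have hGI : _root_.connectedComponentIn B z ⊆ escapingSet f :=
    isPreconnected_connectedComponentIn.subset_escapingSet hf
      (fun w hw => hG.ne_zero (subset_closure hw))
      (fun w hw => hG.chordalEquicontinuousAt hf hUo hUc hne hUI h0 hw) hzG hzI
  exact hG.notMem_escapingSet hf isPreconnected_connectedComponentIn
    (hG.pairwise_disjoint_image hf isPreconnected_connectedComponentIn hGI ⟨z, hzG⟩) hzG hzI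

/-- If a transcendental self-map `f` of `ℂ*` has a doubly connected Baker
domain `U`, then the closure of `U` in `ℂ̂` contains both `0` and `∞`, and consequently
`I(f) ∪ {0,∞} ⊆ ℂ̂` is connected. -/
theorem doubly_connected_baker_domain_closure (f : ℂ → ℂ)
    (hf : IsTranscendentalSelfMapCStar f) (U : Set ℂ)
    (hU : IsFatouComponent f U) (p : ℕ) (hp : 0 < p) (hper : f^[p] '' U ⊆ U)
    (hUI : U ⊆ escapingSet f) (hdc : DoublyConnected U) :
    ((0 : ℂ) : OnePoint ℂ) ∈ closure ((fun z : ℂ => (z : OnePoint ℂ)) '' U) ∧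
    (∞ : OnePoint ℂ) ∈ closure ((fun z : ℂ => (z : OnePoint ℂ)) '' U) ∧
    IsConnected (escapingSphere f) := by
  have h0 := zero_mem_closure_image_coe hf hU hp hper hUI hdc
  have hi := infty_mem_closure_image_coe hf hU hp hper hUI hdc
  exact ⟨h0, hi, ⟨∞, Or.inr (Or.inr rfl)⟩,
    isPreconnected_escapingSphere hf hU.isOpen hU.isPreconnected hU.nonempty hUI h0 hi⟩
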